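/- A planar triangulation on at least 5 vertices is 4-connected if and only if it contains no separating triangle. -/

import Mathlib

def AcyclicOn {V : Type*} (A : V → V → Prop) (X : Set V) : Prop :=
  ∀ v ∈ X, ¬ Relation.TransGen (fun a b => a ∈ X ∧ b ∈ X ∧ A a b) v v

def IsAcyclicColoring {V : Type*} (A : V → V → Prop) (k : ℕ) (c : V → Fin k) : Prop :=
  ∀ i : Fin k, AcyclicOn A {v | c v = i}

def IsOrientation {V : Type*} (G : SimpleGraph V) (A : V → V → Prop) : Prop :=
  (∀ a b, A a b → ¬ A b a) ∧ (∀ a b, G.Adj a b ↔ (A a b ∨ A b a))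

def SimpleGraph.IsMinor {W V : Type*} (H : SimpleGraph W) (G : SimpleGraph V) : Prop :=
  ∃ f : W → Set V, (∀ w, (f w).Nonempty) ∧ (∀ w, (G.induce (f w)).Connected) ∧
    (Pairwise fun w w' => Disjoint (f w) (f w')) ∧
    ∀ ⦃w w'⦄, H.Adj w w' → ∃ u ∈ f w, ∃ v ∈ f w', G.Adj u v

def SimpleGraph.Planar {V : Type*} (G : SimpleGraph V) : Prop :=
  ¬ (completeGraph (Fin 5)).IsMinor G ∧ ¬ (completeBipartiteGraph (Fin 3) (Fin 3)).IsMinor G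

def IsPlanarTriangulation {V : Type*} [Finite V] (G : SimpleGraph V) : Prop :=
  3 ≤ Nat.card V ∧ G.Planar ∧ ∀ H : SimpleGraph V, G ≤ H → H.Planar → H = G

def IsTriangle {V : Type*} (G : SimpleGraph V) (a b c : V) : Prop :=
  G.Adj a b ∧ G.Adj a c ∧ G.Adj b c

def IsFacialTriangle {V : Type*} (G : SimpleGraph V) (a b c : V) : Prop :=
  IsTriangle G a b c ∧ (G.induce {v | v ≠ a ∧ v ≠ b ∧ v ≠ c}).Preconnected

def IsSeparatingTriangle {V : Type*} (G : SimpleGraph V) (a b c : V) : Prop :=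
  IsTriangle G a b c ∧ ¬ (G.induce {v | v ≠ a ∧ v ≠ b ∧ v ≠ c}).Preconnected

def FourConnected {V : Type*} [Finite V] (G : SimpleGraph V) : Prop :=
  5 ≤ Nat.card V ∧ ∀ S : Set V, Nat.card S ≤ 3 → (G.induce Sᶜ).Connected

namespace Tri
variable {V : Type} {W : Type}

/-- cut-based preconnectedness of a vertex set -/
def PCn (G : SimpleGraph V) (X : Set V) : Prop :=
  ∀ Y : Set V, (∃ y ∈ X, y ∈ Y) → (∀ y ∈ X, y ∈ Y → ∀ x ∈ X, G.Adj y x → x ∈ Y) → ∀ x ∈ X, x ∈ Y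

def Cn (G : SimpleGraph V) (X : Set V) : Prop := X.Nonempty ∧ PCn G X

def Tch (G : SimpleGraph V) (X Y : Set V) : Prop := ∃ x ∈ X, ∃ y ∈ Y, G.Adj x y

theorem Tch.symm {G : SimpleGraph V} {X Y : Set V} (h : Tch G X Y) : Tch G Y X := by
  obtain ⟨x, hx, y, hy, h⟩ := h
  exact ⟨y, hy, x, hx, h.symm⟩

theorem Tch.mono {G : SimpleGraph V} {X Y X' Y' : Set V} (h : Tch G X Y) (h1 : X ⊆ X')
    (h2 : Y ⊆ Y') : Tch G X' Y' := by
  obtain ⟨x, hx, y, hy, h⟩ := h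
  exact ⟨x, h1 hx, y, h2 hy, h⟩

theorem cn_singleton (G : SimpleGraph V) (x : V) : Cn G {x} := by
  refine ⟨⟨x, rfl⟩, ?_⟩
  rintro Y ⟨y, rfl, hy⟩ _ x rfl
  exact hy

theorem pcn_iff (G : SimpleGraph V) (X : Set V) : PCn G X ↔ (G.induce X).Preconnected := by
  constructor
  · intro h a b
    have := h {v | ∃ hv : v ∈ X, (G.induce X).Reachable a ⟨v, hv⟩}
      ⟨a, a.2, a.2, SimpleGraph.Reachable.refl _⟩ (by
        rintro y hy ⟨_, hr⟩ x hx hxy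
        refine ⟨hx, hr.trans ?_⟩
        apply SimpleGraph.Adj.reachable
        simpa using hxy) b b.2
    exact this.2
  · intro h Y ⟨y, hyX, hyY⟩ hcl x hx
    have hr := h ⟨y, hyX⟩ ⟨x, hx⟩
    rw [SimpleGraph.reachable_iff_reflTransGen] at hr
    have key : ∀ z : X, Relation.ReflTransGen (G.induce X).Adj ⟨y, hyX⟩ z → (z : V) ∈ Y := by
      intro z hz
      induction hz with
      | refl => exact hyY
      | tail _ h2 ih => exact hcl _ (Subtype.property _) ih _ (Subtype.property _) (by simpa using h2)
    exact key _ hr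

theorem cn_iff (G : SimpleGraph V) (X : Set V) : Cn G X ↔ (G.induce X).Connected := by
  rw [SimpleGraph.connected_iff, ← pcn_iff]
  unfold Cn
  rw [Set.nonempty_coe_sort]
  tauto

theorem Cn.union {G : SimpleGraph V} {X Y : Set V} (hX : Cn G X) (hY : Cn G Y)
    (h : Tch G X Y) : Cn G (X ∪ Y) := by
  refine ⟨hX.1.mono Set.subset_union_left, ?_⟩
  intro Z ⟨z, hz, hzZ⟩ hcl
  obtain ⟨x, hx, y, hy, hxy⟩ := h
  have h1 : (∃ z ∈ X, z ∈ Z) → ∀ z ∈ X, z ∈ Z := fun h => hX.2 Z h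
    (fun a ha haZ b hb hab => hcl a (Or.inl ha) haZ b (Or.inl hb) hab)
  have h2 : (∃ z ∈ Y, z ∈ Z) → ∀ z ∈ Y, z ∈ Z := fun h => hY.2 Z h
    (fun a ha haZ b hb hab => hcl a (Or.inr ha) haZ b (Or.inr hb) hab)
  have hxZ : x ∈ Z := by
    rcases hz with hz | hz
    · exact h1 ⟨z, hz, hzZ⟩ x hx
    · exact hcl y (Or.inr hy) (h2 ⟨z, hz, hzZ⟩ y hy) x (Or.inl hx) hxy.symm
  have hyZ : y ∈ Z := hcl x (Or.inl hx) hxZ y (Or.inr hy) hxy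
  rintro w (hw | hw)
  · exact h1 ⟨x, hx, hxZ⟩ w hw
  · exact h2 ⟨y, hy, hyZ⟩ w hw

theorem Cn.mono {G G' : SimpleGraph V} {X : Set V} (hX : Cn G X)
    (h : ∀ x ∈ X, ∀ y ∈ X, G.Adj x y → G'.Adj x y) : Cn G' X :=
  ⟨hX.1, fun Y hY hcl => hX.2 Y hY (fun y hy hyY x hx hyx => hcl y hy hyY x hx (h y hy x hx hyx))⟩

theorem Cn.insert {G : SimpleGraph V} {X : Set V} (hX : Cn G X) {v x : V} (hx : x ∈ X)
    (h : G.Adj v x) : Cn G (insert v X) := by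
  rw [Set.insert_eq]
  exact (cn_singleton G v).union hX ⟨v, rfl, x, hx, h⟩

theorem Cn.subset_of {G : SimpleGraph V} {X Y : Set V} (hX : Cn G X) {x : V} (hx : x ∈ X)
    (hxY : x ∈ Y) (hcl : ∀ y ∈ X, y ∈ Y → ∀ x ∈ X, G.Adj y x → x ∈ Y) : X ⊆ Y :=
  fun z hz => hX.2 Y ⟨x, hx, hxY⟩ hcl z hz

/-- component of x inside X -/
def comp (G : SimpleGraph V) (X : Set V) (x : V) : Set V :=
  {y | Relation.ReflTransGen (fun a b => a ∈ X ∧ b ∈ X ∧ G.Adj a b) x y}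

theorem mem_comp_self (G : SimpleGraph V) (X : Set V) (x : V) : x ∈ comp G X x :=
  Relation.ReflTransGen.refl

theorem comp_subset {G : SimpleGraph V} {X : Set V} {x : V} (hx : x ∈ X) : comp G X x ⊆ X := by
  intro y hy
  induction hy with
  | refl => exact hx
  | tail _ h _ => exact h.2.1

theorem comp_closed {G : SimpleGraph V} {X : Set V} {x y z : V} (hx : x ∈ X)
    (hy : y ∈ comp G X x) (hz : z ∈ X) (h : G.Adj y z) : z ∈ comp G X x :=
  Relation.ReflTransGen.tail hy ⟨comp_subset hx hy, hz, h⟩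

theorem cn_comp {G : SimpleGraph V} {X : Set V} {x : V} (hx : x ∈ X) : Cn G (comp G X x) := by
  refine ⟨⟨x, mem_comp_self G X x⟩, ?_⟩
  intro Y ⟨y, hy, hyY⟩ hcl
  have hxY : x ∈ Y := by
    have key : ∀ z, z ∈ comp G X x → z ∈ Y → x ∈ Y := by
      intro z hz
      induction hz with
      | refl => exact id
      | tail h1 h2 ih =>
        intro hc
        exact ih (hcl _ (Relation.ReflTransGen.tail h1 h2) hc _ h1 h2.2.2.symm)
    exact key y hy hyY
  intro z hz
  induction hz with
  | refl => exact hxY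
  | tail h1 h2 ih => exact hcl _ h1 ih _ (Relation.ReflTransGen.tail h1 h2) h2.2.2

theorem Cn.subset_comp {G : SimpleGraph V} {X N : Set V} {x : V} (hN : Cn G N) (hNX : N ⊆ X)
    (hx : x ∈ N) : N ⊆ comp G X x :=
  hN.subset_of hx (mem_comp_self G X x)
    (fun _ _ h1 _ hz h2 => comp_closed (hNX hx) h1 (hNX hz) h2)

theorem link {G : SimpleGraph V} {D N1 N2 : Set V} (hD : PCn G D) (h1 : Cn G N1) (h2 : Cn G N2)
    (s1 : N1 ⊆ D) (s2 : N2 ⊆ D) (hd : Disjoint N1 N2) :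
    ∃ N, N1 ⊆ N ∧ N ⊆ D ∧ Disjoint N N2 ∧ Cn G N ∧ Tch G N N2 := by
  obtain ⟨n, hn⟩ := h1.1
  have hsub : N1 ⊆ D \ N2 := fun z hz => ⟨s1 hz, Set.disjoint_left.1 hd hz⟩
  have hn' := hsub hn
  have hc := comp_subset (G := G) hn'
  refine ⟨comp G (D \ N2) n, h1.subset_comp hsub hn, fun z hz => (hc hz).1,
    Set.disjoint_left.2 fun z hz => (hc hz).2, cn_comp hn', ?_⟩
  by_contra hT
  obtain ⟨m, hm⟩ := h2.1
  have := hD (comp G (D \ N2) n) ⟨n, hn'.1, mem_comp_self _ _ _⟩ (by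
    intro y hy hyc x hx hyx
    by_cases hx2 : x ∈ N2
    · exact (hT ⟨y, hyc, x, hx2, hyx⟩).elim
    · exact comp_closed hn' hyc ⟨hx, hx2⟩ hyx) m (s2 hm)
  exact (hc this).2 hm

theorem Cn.sdiff {G : SimpleGraph V} {X A : Set V} (hX : Cn G X) (hne : (X \ A).Nonempty)
    (h : ∀ p ∈ X, ∀ q ∈ X, p ∉ A → q ∉ A → (∃ a ∈ X, a ∈ A ∧ G.Adj p a) →
      (∃ a ∈ X, a ∈ A ∧ G.Adj q a) → p = q ∨ G.Adj p q) : Cn G (X \ A) := by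
  refine ⟨hne, ?_⟩
  intro Y ⟨y, hy, hyY⟩ hcl x hx
  have := hX.2 {z | (z ∉ A ∧ z ∈ Y) ∨ (z ∈ A ∧ ∃ p ∈ X, p ∉ A ∧ p ∈ Y ∧ ∃ a ∈ X, a ∈ A ∧ G.Adj p a)}
    ⟨y, hy.1, Or.inl ⟨hy.2, hyY⟩⟩ (by
      rintro u hu huY v hv huv
      by_cases hvA : v ∈ A
      · right
        refine ⟨hvA, ?_⟩
        rcases huY with ⟨h1, h2⟩ | ⟨h1, h2⟩
        · exact ⟨u, hu, h1, h2, v, hv, hvA, huv⟩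
        · exact h2
      · left
        refine ⟨hvA, ?_⟩
        rcases huY with ⟨h1, h2⟩ | ⟨h1, p, hp, hpA, hpY, h3⟩
        · exact hcl u ⟨hu, h1⟩ h2 v ⟨hv, hvA⟩ huv
        · rcases h p hp v hv hpA hvA h3 ⟨u, hu, h1, huv.symm⟩ with rfl | h4
          · exact hpY
          · exact hcl p ⟨hp, hpA⟩ hpY v ⟨hv, hvA⟩ h4) x hx.1
  rcases this with h | h
  · exact h.2
  · exact (hx.2 h.1).elim

/-! minor models -/
structure Mod (K : SimpleGraph W) (G : SimpleGraph V) (f : W → Set V) : Prop where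
  cn : ∀ i, Cn G (f i)
  dj : ∀ i j x, x ∈ f i → x ∈ f j → i = j
  tch : ∀ i j, K.Adj i j → Tch G (f i) (f j)

abbrev K5 : SimpleGraph (Fin 5) := SimpleGraph.completeGraph (Fin 5)
abbrev K33 : SimpleGraph (Fin 3 ⊕ Fin 3) := completeBipartiteGraph (Fin 3) (Fin 3)

def Pl (G : SimpleGraph V) : Prop := (∀ f, ¬ Mod K5 G f) ∧ ∀ f, ¬ Mod K33 G f

theorem Mod.mono {K : SimpleGraph W} {G G' : SimpleGraph V} {f : W → Set V} (h : Mod K G f)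
    (hG : G ≤ G') : Mod K G' f where
  cn i := (h.cn i).mono fun _ _ _ _ h => hG h
  dj := h.dj
  tch i j hij := by
    obtain ⟨x, hx, y, hy, hxy⟩ := h.tch i j hij
    exact ⟨x, hx, y, hy, hG hxy⟩

theorem Pl.mono {G G' : SimpleGraph V} (h : Pl G') (hG : G ≤ G') : Pl G :=
  ⟨fun f hf => h.1 f (hf.mono hG), fun f hf => h.2 f (hf.mono hG)⟩

theorem K33_r (p q : Fin 3 ⊕ Fin 3) : K33.Adj p q ↔ p.isLeft ≠ q.isLeft := by
  rcases p with p | p <;> rcases q with q | q <;> simp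

def Supp (G : SimpleGraph V) (X : Set V) : Prop := ∀ u v, G.Adj u v → u ∈ X

theorem Cn.supp {G : SimpleGraph V} {X F : Set V} (hF : Cn G F) (hX : Supp G X) {x y : V}
    (hx : x ∈ F) (h : G.Adj x y) : F ⊆ X :=
  hF.subset_of hx (hX _ _ h) (fun _ _ _ _ _ h => hX _ _ h.symm)

theorem Mod.supp {K : SimpleGraph W} {G : SimpleGraph V} {f : W → Set V} (h : Mod K G f)
    (hK : ∀ i, ∃ j, K.Adj i j) {X : Set V} (hX : Supp G X) (i : W) : f i ⊆ X := by
  obtain ⟨j, hj⟩ := hK i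
  obtain ⟨x, hx, y, hy, hxy⟩ := h.tch i j hj
  exact (h.cn i).supp hX hx hxy

theorem K5_ex (i : Fin 5) : ∃ j, K5.Adj i j := ⟨i + 1, by simp⟩
theorem K33_ex (i : Fin 3 ⊕ Fin 3) : ∃ j, K33.Adj i j := by
  rcases i with i | i
  · exact ⟨Sum.inr 0, by simp⟩
  · exact ⟨Sum.inl 0, by simp⟩

theorem cn_biUnion {G G' : SimpleGraph V} {F : Set V} {φ : V → Set V} (hF : Cn G' F)
    (h1 : ∀ v ∈ F, Cn G (φ v)) (h2 : ∀ u ∈ F, ∀ v ∈ F, G'.Adj u v → Tch G (φ u) (φ v)) :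
    Cn G (⋃ v ∈ F, φ v) := by
  refine ⟨?_, ?_⟩
  · obtain ⟨v, hv⟩ := hF.1
    obtain ⟨x, hx⟩ := (h1 v hv).1
    exact ⟨x, Set.mem_biUnion hv hx⟩
  · intro Y ⟨y, hy, hyY⟩ hcl x hx
    have key : ∀ v ∈ F, (∃ z ∈ φ v, z ∈ Y) → ∀ z ∈ φ v, z ∈ Y := by
      intro v hv hz
      refine (h1 v hv).2 Y hz ?_
      intro a ha haY b hb hab
      exact hcl a (Set.mem_biUnion hv ha) haY b (Set.mem_biUnion hv hb) hab
    simp only [Set.mem_iUnion, exists_prop] at hy hx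
    obtain ⟨u, hu, hyu⟩ := hy
    obtain ⟨v, hv, hxv⟩ := hx
    refine hF.2 {v | ∀ z ∈ φ v, z ∈ Y} ⟨u, hu, key u hu ⟨y, hyu, hyY⟩⟩ ?_ v hv x hxv
    intro a ha haY b hb hab
    obtain ⟨p, hp, q, hq, hpq⟩ := h2 a ha b hb hab
    exact key b hb ⟨q, hq, hcl p (Set.mem_biUnion ha hp) (haY p hp) q (Set.mem_biUnion hb hq) hpq⟩

theorem Mod.pull {K : SimpleGraph W} {G G' : SimpleGraph V} {f : W → Set V} (h : Mod K G' f)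
    (hK : ∀ i, ∃ j, K.Adj i j) {X : Set V} (hX : Supp G' X) (φ : V → Set V)
    (h1 : ∀ v ∈ X, Cn G (φ v)) (h2 : ∀ u ∈ X, ∀ v ∈ X, ∀ x, x ∈ φ u → x ∈ φ v → u = v)
    (h3 : ∀ u v, G'.Adj u v → Tch G (φ u) (φ v)) : Mod K G (fun i => ⋃ v ∈ f i, φ v) where
  cn i := cn_biUnion (h.cn i) (fun v hv => h1 v (h.supp hK hX i hv)) (fun u _ v _ huv => h3 u v huv)
  dj i j x hi hj := by
    simp only [Set.mem_iUnion, exists_prop] at hi hj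
    obtain ⟨u, hu, hxu⟩ := hi
    obtain ⟨v, hv, hxv⟩ := hj
    have := h2 u (h.supp hK hX i hu) v (h.supp hK hX j hv) x hxu hxv
    subst this
    exact h.dj i j u hu hv
  tch i j hij := by
    obtain ⟨x, hx, y, hy, hxy⟩ := h.tch i j hij
    exact (h3 x y hxy).mono (Set.subset_biUnion_of_mem hx) (Set.subset_biUnion_of_mem hy)

theorem Pl.pull {G G' : SimpleGraph V} (h : Pl G) {X : Set V} (hX : Supp G' X) (φ : V → Set V)
    (h1 : ∀ v ∈ X, Cn G (φ v)) (h2 : ∀ u ∈ X, ∀ v ∈ X, ∀ x, x ∈ φ u → x ∈ φ v → u = v)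
    (h3 : ∀ u v, G'.Adj u v → Tch G (φ u) (φ v)) : Pl G' :=
  ⟨fun f hf => h.1 _ (hf.pull K5_ex hX φ h1 h2 h3), fun f hf => h.2 _ (hf.pull K33_ex hX φ h1 h2 h3)⟩

theorem no33 {G : SimpleGraph V} (h : Pl G) {A1 A2 A3 B1 B2 B3 : Set V}
    (c1 : Cn G A1) (c2 : Cn G A2) (c3 : Cn G A3) (c4 : Cn G B1) (c5 : Cn G B2) (c6 : Cn G B3)
    (d12 : Disjoint A1 A2) (d13 : Disjoint A1 A3) (d23 : Disjoint A2 A3)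
    (e12 : Disjoint B1 B2) (e13 : Disjoint B1 B3) (e23 : Disjoint B2 B3)
    (f11 : Disjoint A1 B1) (f12 : Disjoint A1 B2) (f13 : Disjoint A1 B3)
    (f21 : Disjoint A2 B1) (f22 : Disjoint A2 B2) (f23 : Disjoint A2 B3)
    (f31 : Disjoint A3 B1) (f32 : Disjoint A3 B2) (f33 : Disjoint A3 B3)
    (t11 : Tch G A1 B1) (t12 : Tch G A1 B2) (t13 : Tch G A1 B3)
    (t21 : Tch G A2 B1) (t22 : Tch G A2 B2) (t23 : Tch G A2 B3)
    (t31 : Tch G A3 B1) (t32 : Tch G A3 B2) (t33 : Tch G A3 B3) : False := by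
  refine h.2 (Sum.elim ![A1, A2, A3] ![B1, B2, B3]) ⟨?_, ?_, ?_⟩
  · rintro (i | i) <;> fin_cases i <;> assumption
  · rw [Set.disjoint_left] at *
    rintro (i | i) (j | j) x <;> fin_cases i <;> fin_cases j <;> simp <;> grind
  · rintro (i | i) (j | j) hij
    · simp at hij
    · fin_cases i <;> fin_cases j <;> assumption
    · fin_cases i <;> fin_cases j <;> apply Tch.symm <;> assumption
    · simp at hij

theorem no5 {G : SimpleGraph V} (h : Pl G) {A1 A2 A3 A4 A5 : Set V}
    (c1 : Cn G A1) (c2 : Cn G A2) (c3 : Cn G A3) (c4 : Cn G A4) (c5 : Cn G A5)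
    (d12 : Disjoint A1 A2) (d13 : Disjoint A1 A3) (d14 : Disjoint A1 A4) (d15 : Disjoint A1 A5)
    (d23 : Disjoint A2 A3) (d24 : Disjoint A2 A4) (d25 : Disjoint A2 A5)
    (d34 : Disjoint A3 A4) (d35 : Disjoint A3 A5) (d45 : Disjoint A4 A5)
    (t12 : Tch G A1 A2) (t13 : Tch G A1 A3) (t14 : Tch G A1 A4) (t15 : Tch G A1 A5)
    (t23 : Tch G A2 A3) (t24 : Tch G A2 A4) (t25 : Tch G A2 A5)
    (t34 : Tch G A3 A4) (t35 : Tch G A3 A5) (t45 : Tch G A4 A5) : False := by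
  refine h.1 ![A1, A2, A3, A4, A5] ⟨?_, ?_, ?_⟩
  · intro i; fin_cases i <;> assumption
  · rw [Set.disjoint_left] at *
    intro i j x
    fin_cases i <;> fin_cases j <;> simp <;> grind
  · intro i j hij
    fin_cases i <;> fin_cases j <;> first | (exact absurd rfl hij) | assumption | (apply Tch.symm; assumption)

end Tri

namespace Tri
variable {V : Type} {W : Type}

theorem Cn.union' {G : SimpleGraph V} {X Y : Set V} (hX : Cn G X) (hY : Cn G Y) {z : V}
    (h1 : z ∈ X) (h2 : z ∈ Y) : Cn G (X ∪ Y) := by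
  refine ⟨hX.1.mono Set.subset_union_left, ?_⟩
  intro Z ⟨u, hu, huZ⟩ hcl
  have k1 : (∃ z ∈ X, z ∈ Z) → ∀ z ∈ X, z ∈ Z := fun h => hX.2 Z h
    (fun a ha haZ b hb hab => hcl a (Or.inl ha) haZ b (Or.inl hb) hab)
  have k2 : (∃ z ∈ Y, z ∈ Z) → ∀ z ∈ Y, z ∈ Z := fun h => hY.2 Z h
    (fun a ha haZ b hb hab => hcl a (Or.inr ha) haZ b (Or.inr hb) hab)
  have hzZ : z ∈ Z := by
    rcases hu with hu | hu
    · exact k1 ⟨u, hu, huZ⟩ z h1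
    · exact k2 ⟨u, hu, huZ⟩ z h2
  rintro w (hw | hw)
  · exact k1 ⟨z, h1, hzZ⟩ w hw
  · exact k2 ⟨z, h2, hzZ⟩ w hw

/-- setting: three touching connected sets (arcs) with connected complement `D`,
and a `K_{2,3}` rooted at the arcs. -/
structure AFH (G : SimpleGraph V) (D I0 I1 I2 Z P Q U W : Set V) : Prop where
  cI0 : Cn G I0
  cI1 : Cn G I1
  cI2 : Cn G I2
  cZ : Cn G Z
  cP : Cn G P
  cQ : Cn G Q
  cU : Cn G U
  cW : Cn G W
  s0 : I0 ⊆ Z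
  s1 : I1 ⊆ P
  s2 : I2 ⊆ Q
  t01 : Tch G I0 I1
  t02 : Tch G I0 I2
  t12 : Tch G I1 I2
  dZ : ∀ x ∈ Z, x ∉ I0 → x ∈ D
  dP : ∀ x ∈ P, x ∉ I1 → x ∈ D
  dQ : ∀ x ∈ Q, x ∉ I2 → x ∈ D
  dU : U ⊆ D
  dW : W ⊆ D
  zp : Disjoint Z P
  zq : Disjoint Z Q
  pq : Disjoint P Q
  uz : Disjoint U Z
  up : Disjoint U P
  uq : Disjoint U Q
  wz : Disjoint W Z
  wp : Disjoint W P
  wq : Disjoint W Q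
  uw : Disjoint U W
  tuz : Tch G U Z
  tup : Tch G U P
  tuq : Tch G U Q
  twz : Tch G W Z
  twp : Tch G W P
  twq : Tch G W Q

theorem AFH.rot {G : SimpleGraph V} {D I0 I1 I2 Z P Q U W : Set V}
    (h : AFH G D I0 I1 I2 Z P Q U W) : AFH G D I1 I2 I0 P Q Z U W where
  cI0 := h.cI1
  cI1 := h.cI2
  cI2 := h.cI0
  cZ := h.cP
  cP := h.cQ
  cQ := h.cZ
  cU := h.cU
  cW := h.cW
  s0 := h.s1
  s1 := h.s2
  s2 := h.s0
  t01 := h.t12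
  t02 := h.t01.symm
  t12 := h.t02.symm
  dZ := h.dP
  dP := h.dQ
  dQ := h.dZ
  dU := h.dU
  dW := h.dW
  zp := h.pq
  zq := h.zp.symm
  pq := h.zq.symm
  uz := h.up
  up := h.uq
  uq := h.uz
  wz := h.wp
  wp := h.wq
  wq := h.wz
  uw := h.uw
  tuz := h.tup
  tup := h.tuq
  tuq := h.tuz
  twz := h.twp
  twp := h.twq
  twq := h.twz

theorem AFH.joint {G : SimpleGraph V} (hG : Pl G) {D I0 I1 I2 Z P Q U W : Set V}
    (h : AFH G D I0 I1 I2 Z P Q U W) {N : Set V} (hN : Cn G N) (hZ : N ⊆ Z)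
    (hI : Disjoint N I0) (hNI : Tch G N I0) (hNU : Tch G N U) (hNW : Tch G N W) : False :=
  no33 hG hN h.cP h.cQ h.cI0 h.cU h.cW
    (h.zp.mono_left hZ) (h.zq.mono_left hZ) h.pq
    (h.uz.symm.mono_left h.s0) (h.wz.symm.mono_left h.s0) h.uw
    hI (h.uz.symm.mono_left hZ) (h.wz.symm.mono_left hZ)
    (h.zp.symm.mono_right h.s0) h.up.symm h.wp.symm
    (h.zq.symm.mono_right h.s0) h.uq.symm h.wq.symm
    hNI hNU hNW
    (h.t01.symm.mono h.s1 subset_rfl) h.tup.symm h.twp.symm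
    (h.t02.symm.mono h.s2 subset_rfl) h.tuq.symm h.twq.symm

theorem grow {G : SimpleGraph V} {I Z U : Set V} (hZ : Cn G Z) (hI : I.Nonempty) (hIZ : I ⊆ Z)
    (hU : Cn G U) (ht : Tch G U Z) : Tch G U I ∨
    ∃ N, Cn G N ∧ N ⊆ Z ∧ Disjoint N I ∧ Tch G N I ∧ Tch G N U := by
  obtain ⟨u, hu, z, hz, huz⟩ := ht
  by_cases hzI : z ∈ I
  · exact Or.inl ⟨u, hu, z, hzI, huz⟩
  right
  have hz' : z ∈ Z \ I := ⟨hz, hzI⟩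
  refine ⟨comp G (Z \ I) z, cn_comp hz', fun x hx => (comp_subset hz' hx).1,
    Set.disjoint_left.2 fun x hx => (comp_subset hz' hx).2, ?_, z, mem_comp_self _ _ _, u, hu, huz.symm⟩
  by_contra hT
  obtain ⟨i, hi⟩ := hI
  have := hZ.subset_of (Y := comp G (Z \ I) z) hz (mem_comp_self _ _ _) (by
    intro y hy hyc x hx hyx
    by_cases hxI : x ∈ I
    · exact (hT ⟨y, hyc, x, hxI, hyx⟩).elim
    · exact comp_closed hz' hyc ⟨hx, hxI⟩ hyx)
  exact (comp_subset hz' (this (hIZ hi))).2 hi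

theorem AFH.step {G : SimpleGraph V} (hG : Pl G) {D I0 I1 I2 Z P Q U W : Set V}
    (h : AFH G D I0 I1 I2 Z P Q U W) : ∃ U' W', AFH G D I0 I1 I2 I0 P Q U' W' := by
  have aux : ∀ U, Cn G U → Tch G U Z → Disjoint U Z → ∃ N, Cn G (U ∪ N) ∧ (N = ∅ ∨ Cn G N ∧
      Tch G N I0 ∧ Tch G N U) ∧ N ⊆ Z ∧ Disjoint N I0 ∧ Tch G (U ∪ N) I0 := by
    intro U hU ht _
    rcases grow h.cZ h.cI0.1 h.s0 hU ht with h1 | ⟨N, h1, h2, h3, h4, h5⟩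
    · exact ⟨∅, by simpa using hU, Or.inl rfl, by simp, by simp, by simpa using h1⟩
    · exact ⟨N, hU.union h1 h5.symm, Or.inr ⟨h1, h4, h5⟩, h2, h3, h4.mono (by simp) subset_rfl⟩
  obtain ⟨N, a1, a2, a3, a4, a5⟩ := aux U h.cU h.tuz h.uz
  obtain ⟨M, b1, b2, b3, b4, b5⟩ := aux W h.cW h.twz h.wz
  have hNM : ∀ x, x ∈ N → x ∈ M → False := by
    intro x hx hy
    rcases a2 with rfl | ⟨a2, a6, a7⟩
    · exact hx
    rcases b2 with rfl | ⟨b2, b6, b7⟩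
    · exact hy
    exact h.joint hG (a2.union' b2 hx hy) (Set.union_subset a3 b3)
      (Set.disjoint_union_left.2 ⟨a4, b4⟩) (a6.mono (by simp) subset_rfl)
      (a7.mono (by simp) subset_rfl) (b7.mono (by simp) subset_rfl)
  have hs0 := h.s0
  have hzp := Set.disjoint_left.1 h.zp
  have hzq := Set.disjoint_left.1 h.zq
  have huz := Set.disjoint_left.1 h.uz
  have hup := Set.disjoint_left.1 h.up
  have huq := Set.disjoint_left.1 h.uq
  have hwz := Set.disjoint_left.1 h.wz
  have hwp := Set.disjoint_left.1 h.wp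
  have hwq := Set.disjoint_left.1 h.wq
  have huw := Set.disjoint_left.1 h.uw
  have hN := Set.disjoint_left.1 a4
  have hM := Set.disjoint_left.1 b4
  have hdZ := h.dZ
  have hdU := h.dU
  have hdW := h.dW
  refine ⟨U ∪ N, W ∪ M, { h with
    cZ := h.cI0
    cU := a1
    cW := b1
    s0 := subset_rfl
    dZ := fun x hx hx' => (hx' hx).elim
    dU := by intro x hx; grind
    dW := by intro x hx; grind
    zp := h.zp.mono_left h.s0
    zq := h.zq.mono_left h.s0
    uz := Set.disjoint_left.2 (by intro x hx; grind)
    up := Set.disjoint_left.2 (by intro x hx; grind)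
    uq := Set.disjoint_left.2 (by intro x hx; grind)
    wz := Set.disjoint_left.2 (by intro x hx; grind)
    wp := Set.disjoint_left.2 (by intro x hx; grind)
    wq := Set.disjoint_left.2 (by intro x hx; grind)
    uw := Set.disjoint_left.2 (by intro x hx; grind)
    tuz := a5
    tup := h.tup.mono (by simp) subset_rfl
    tuq := h.tuq.mono (by simp) subset_rfl
    twz := b5
    twp := h.twp.mono (by simp) subset_rfl
    twq := h.twq.mono (by simp) subset_rfl }⟩

theorem AFH.false {G : SimpleGraph V} (hG : Pl G) {D I0 I1 I2 Z P Q U W : Set V} (hD : PCn G D)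
    (e0 : Disjoint D I0) (e1 : Disjoint D I1) (e2 : Disjoint D I2)
    (h : AFH G D I0 I1 I2 Z P Q U W) : False := by
  obtain ⟨U, W, h⟩ := h.step hG
  obtain ⟨U, W, h⟩ := h.rot.step hG
  obtain ⟨U, W, h⟩ := h.rot.step hG
  obtain ⟨N, h1, h2, h3, h4, h5⟩ := link hD h.cU h.cW h.dU h.dW h.uw
  exact no5 hG h.cI0 h.cI1 h.cI2 h4 h.cW h.zp h.zq (e2.mono_left h2).symm h.wz.symm
    h.pq (e0.mono_left h2).symm h.wp.symm (e1.mono_left h2).symm h.wq.symm h3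
    h.t01 h.t02 (h.tuz.mono h1 subset_rfl).symm h.twz.symm h.t12 (h.tup.mono h1 subset_rfl).symm
    h.twp.symm (h.tuq.mono h1 subset_rfl).symm h.twq.symm h5

/-- rooted `K_{2,3}` -/
def R23 (G : SimpleGraph V) (s a t : V) : Prop :=
  ∃ Z P Q U W : Set V, Cn G Z ∧ Cn G P ∧ Cn G Q ∧ Cn G U ∧ Cn G W ∧ s ∈ Z ∧ a ∈ P ∧ t ∈ Q ∧
    Disjoint Z P ∧ Disjoint Z Q ∧ Disjoint P Q ∧ Disjoint U Z ∧ Disjoint U P ∧ Disjoint U Q ∧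
    Disjoint W Z ∧ Disjoint W P ∧ Disjoint W Q ∧ Disjoint U W ∧
    Tch G U Z ∧ Tch G U P ∧ Tch G U Q ∧ Tch G W Z ∧ Tch G W P ∧ Tch G W Q

/-- induced cycle `c 0, ..., c k` with `D` disjoint from it -/
structure Cyc (G : SimpleGraph V) (c : ℕ → V) (k : ℕ) (D : Set V) : Prop where
  hk : 2 ≤ k
  inj : ∀ i ≤ k, ∀ j ≤ k, c i = c j → i = j
  adj : ∀ i < k, G.Adj (c i) (c (i + 1))
  adj0 : G.Adj (c 0) (c k)
  ind : ∀ i j, i < j → j ≤ k → G.Adj (c i) (c j) → j = i + 1 ∨ (i = 0 ∧ j = k)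
  dD : ∀ i ≤ k, c i ∉ D
  conn : PCn G D
  supp : ∀ u v, G.Adj u v → u ∈ D ∨ ∃ i ≤ k, c i = u

def arc (c : ℕ → V) (i j : ℕ) : Set V := {v | ∃ l, i ≤ l ∧ l ≤ j ∧ c l = v}

theorem mem_arc {c : ℕ → V} {i j l : ℕ} (h1 : i ≤ l) (h2 : l ≤ j) : c l ∈ arc c i j := ⟨l, h1, h2, rfl⟩

theorem cn_arc {G : SimpleGraph V} {c : ℕ → V} {i j : ℕ} (hij : i ≤ j)
    (h : ∀ l, i ≤ l → l < j → G.Adj (c l) (c (l + 1))) : Cn G (arc c i j) := by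
  induction j, hij using Nat.le_induction with
  | base =>
    have : arc c i i = {c i} := by
      ext v; constructor
      · rintro ⟨l, h1, h2, rfl⟩
        have : l = i := by omega
        subst this; rfl
      · rintro rfl; exact mem_arc le_rfl le_rfl
    rw [this]; exact cn_singleton _ _
  | succ j hj ih =>
    have : arc c i (j + 1) = insert (c (j + 1)) (arc c i j) := by
      ext v; constructor
      · rintro ⟨l, h1, h2, rfl⟩
        by_cases hl : l = j + 1
        · subst hl; left; rfl
        · right; exact mem_arc h1 (by omega)
      · rintro (rfl | ⟨l, h1, h2, rfl⟩)
        · exact mem_arc (by omega) le_rfl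
        · exact mem_arc h1 (by omega)
    rw [this]
    exact (ih (fun l h1 h2 => h l h1 (by omega))).insert (mem_arc hj le_rfl) (h j hj (by omega)).symm

end Tri

namespace Tri
variable {V : Type} {W : Type}

theorem Cyc.extract {G : SimpleGraph V} {c : ℕ → V} {k : ℕ} {D : Set V} (hc : Cyc G c k D)
    {E : Set V} (hE : Cn G E) {x y p q : ℕ} (hy : y ≤ k) (nx : c x ∉ E) (ny : c y ∉ E)
    (hp : x < p ∧ p < y) (hq : q < x ∨ y < q) (hqk : q ≤ k) (pE : c p ∈ E) (qE : c q ∈ E) :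
    ∃ N l h, Cn G N ∧ N ⊆ E ∧ N ⊆ D ∧ (x < l ∧ l < y) ∧ (h < x ∨ y < h) ∧ h ≤ k ∧ c l ∈ E ∧ c h ∈ E ∧
      Tch G N {c l} ∧ Tch G N {c h} := by
  by_contra hcon
  have hsub := hE.subset_of (x := c p)
    (Y := {v | (∃ i, x < i ∧ i < y ∧ c i = v) ∨ (v ∈ E ∩ D ∧ ∃ i, x < i ∧ i < y ∧ c i ∈ E ∧
      Tch G (comp G (E ∩ D) v) {c i})}) pE (Or.inl ⟨p, hp.1, hp.2, rfl⟩) (by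
    rintro u hu huY v hv huv
    rcases hc.supp v u huv.symm with hvD | ⟨j, hj, rfl⟩
    · right
      refine ⟨⟨hv, hvD⟩, ?_⟩
      rcases huY with ⟨i, hi1, hi2, rfl⟩ | ⟨huD, i, hi1, hi2, hiE, hiT⟩
      · exact ⟨i, hi1, hi2, hu, v, mem_comp_self _ _ _, _, rfl, huv.symm⟩
      · refine ⟨i, hi1, hi2, hiE, hiT.mono ?_ subset_rfl⟩
        exact (cn_comp huD).subset_comp (comp_subset huD)
          (comp_closed huD (mem_comp_self _ _ _) ⟨hv, hvD⟩ huv)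
    · left
      have jx : j ≠ x := by rintro rfl; exact nx hv
      have jy : j ≠ y := by rintro rfl; exact ny hv
      by_contra hj'
      have hj2 : j < x ∨ y < j := by
        by_contra h
        exact hj' ⟨j, by omega, by omega, rfl⟩
      rcases huY with ⟨i, hi1, hi2, rfl⟩ | ⟨huD, i, hi1, hi2, hiE, hiT⟩
      · rcases hj2 with hj2 | hj2
        · have := hc.ind j i (by omega) (by omega) huv.symm
          omega
        · have := hc.ind i j (by omega) (by omega) huv
          omega
      · exact hcon ⟨comp G (E ∩ D) u, i, j, cn_comp huD, fun z hz => (comp_subset huD hz).1,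
          fun z hz => (comp_subset huD hz).2, ⟨hi1, hi2⟩, hj2, hj, hiE, hv, hiT,
          u, mem_comp_self _ _ _, _, rfl, huv⟩)
  rcases hsub qE with ⟨i, hi1, hi2, hi⟩ | ⟨h, _⟩
  · have := hc.inj i (by omega) q hqk hi
    omega
  · exact hc.dD q hqk h.2

theorem Cyc.outer {G : SimpleGraph V} {c : ℕ → V} {k : ℕ} {D : Set V} (hc : Cyc G c k D)
    {l h j : ℕ} (hlh : l < h) (hk : h ≤ k) (hj : j < l ∨ h < j) (hjk : j ≤ k) :
    ∃ O, Cn G O ∧ (∀ v ∈ O, ∃ i, (i < l ∨ h < i) ∧ i ≤ k ∧ c i = v) ∧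
      (∀ i, (i < l ∨ h < i) → i ≤ k → c i ∈ O) ∧ Tch G {c l} O ∧ Tch G {c h} O := by
  have hcn : ∀ a b, a ≤ b → b ≤ k → Cn G (arc c a b) := fun a b h1 h2 =>
    cn_arc h1 (fun l _ h4 => hc.adj l (by omega))
  have hO : ∀ O, Cn G O → (∀ v ∈ O, ∃ i, (i < l ∨ h < i) ∧ i ≤ k ∧ c i = v) → 
      (∀ i, (i < l ∨ h < i) → i ≤ k → c i ∈ O) → ∃ O, Cn G O ∧ (∀ v ∈ O, ∃ i, (i < l ∨ h < i) ∧ i ≤ k ∧ c i = v) ∧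
      (∀ i, (i < l ∨ h < i) → i ≤ k → c i ∈ O) ∧ Tch G {c l} O ∧ Tch G {c h} O := by
    intro O h1 h2 h3
    refine ⟨O, h1, h2, h3, ?_, ?_⟩
    · by_cases hl : l = 0
      · subst hl
        exact ⟨_, rfl, c k, h3 k (by omega) le_rfl, hc.adj0⟩
      · refine ⟨_, rfl, c (l - 1), h3 _ (by omega) (by omega), ?_⟩
        have := hc.adj (l - 1) (by omega)
        rw [show l - 1 + 1 = l by omega] at this
        exact this.symm
    · by_cases hl : h = k
      · subst hl
        exact ⟨_, rfl, c 0, h3 0 (by omega) (by omega), hc.adj0.symm⟩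
      · exact ⟨_, rfl, c (h + 1), h3 _ (by omega) (by omega), hc.adj h (by omega)⟩
  by_cases h0 : l = 0
  · refine hO (arc c (h + 1) k) (hcn _ _ (by omega) le_rfl) ?_ ?_
    · rintro v ⟨i, h1, h2, rfl⟩
      exact ⟨i, by omega, h2, rfl⟩
    · intro i h1 h2; exact mem_arc (by omega) h2
  by_cases h1 : h = k
  · refine hO (arc c 0 (l - 1)) (hcn _ _ (by omega) (by omega)) ?_ ?_
    · rintro v ⟨i, h1, h2, rfl⟩
      exact ⟨i, by omega, by omega, rfl⟩
    · intro i h1 h2; exact mem_arc (by omega) (by omega)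
  refine hO (arc c 0 (l - 1) ∪ arc c (h + 1) k) ((hcn _ _ (by omega) (by omega)).union
    (hcn _ _ (by omega) le_rfl) ⟨c 0, mem_arc le_rfl (by omega), c k, mem_arc (by omega) le_rfl, hc.adj0⟩) ?_ ?_
  · rintro v (⟨i, h1, h2, rfl⟩ | ⟨i, h1, h2, rfl⟩) <;>
    exact ⟨i, by omega, by omega, rfl⟩
  · rintro i (h1 | h1) h2
    · left; exact mem_arc (by omega) (by omega)
    · right; exact mem_arc (by omega) (by omega)

theorem Cyc.cross {G : SimpleGraph V} {c : ℕ → V} {k : ℕ} {D : Set V} (hc : Cyc G c k D) (hG : Pl G)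
    {E F : Set V} (hE : Cn G E) (hF : Cn G F) (hEF : ∀ x, x ∈ E → x ∈ F → False)
    {i1 i2 i3 i4 : ℕ} (h12 : i1 < i2) (h23 : i2 < i3) (h34 : i3 < i4) (h4 : i4 ≤ k)
    (e1 : c i1 ∈ E) (e3 : c i3 ∈ E) (f2 : c i2 ∈ F) (f4 : c i4 ∈ F) : False := by
  obtain ⟨N1, l, h, a1, a2, a3, a4, a5, a6, a7, a8, a9, a10⟩ := hc.extract hE (x := i2) (y := i4)
    (p := i3) (q := i1) h4 (fun h => hEF _ h f2) (fun h => hEF _ h f4) (by omega) (by omega) (by omega) e3 e1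
  have main : ∃ lo hi, lo < hi ∧ hi ≤ k ∧ Tch G N1 {c lo} ∧ Tch G N1 {c hi} ∧ ∃ N2 l2 h2, Cn G N2 ∧
      N2 ⊆ F ∧ N2 ⊆ D ∧ (lo < l2 ∧ l2 < hi) ∧ (h2 < lo ∨ hi < h2) ∧ h2 ≤ k ∧ Tch G N2 {c l2} ∧
      Tch G N2 {c h2} := by
    rcases a5 with a5 | a5
    · obtain ⟨N2, l2, h2, b⟩ := hc.extract hF (x := h) (y := l) (p := i2) (q := i4) (by omega)
        (fun h => hEF _ a8 h) (fun h => hEF _ a7 h) (by omega) (by omega) (by omega) f2 f4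
      exact ⟨h, l, by omega, by omega, a10, a9, N2, l2, h2, by tauto⟩
    · obtain ⟨N2, l2, h2, b⟩ := hc.extract hF (x := l) (y := h) (p := i4) (q := i2) (by omega)
        (fun h => hEF _ a7 h) (fun h => hEF _ a8 h) (by omega) (by omega) (by omega) f4 f2
      exact ⟨l, h, by omega, by omega, a9, a10, N2, l2, h2, by tauto⟩
  obtain ⟨lo, hi, b1, b2, b3, b4, N2, l2, h2, d1, d2, d3, d4, d5, d6, d7, d8⟩ := main
  obtain ⟨N, n1, n2, n3, n4, n5⟩ := link hc.conn a1 d1 a3 d3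
    (Set.disjoint_left.2 fun x hx hx' => hEF x (a2 hx) (d2 hx'))
  obtain ⟨O, o1, o2, o3, o4, o5⟩ := hc.outer b1 b2 d5 d6
  have hI : Cn G (arc c (lo + 1) (hi - 1)) :=
    cn_arc (by omega) (fun l _ h4 => hc.adj l (by omega))
  have hinj := hc.inj
  have hdD := hc.dD
  refine no33 hG (cn_singleton G (c lo)) (cn_singleton G (c hi)) d1 hI o1 n4
    ?_ ?_ ?_ ?_ ?_ ?_ ?_ ?_ ?_ ?_ ?_ ?_ ?_ ?_ n3.symm ?_ o4 (b3.symm.mono subset_rfl n1)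
    ?_ o5 (b4.symm.mono subset_rfl n1) (d7.mono subset_rfl ?_) (d8.mono subset_rfl ?_) n5.symm
  · simp only [Set.disjoint_singleton]; intro h; have := hinj _ (by omega) _ (by omega) h; omega
  · simp only [Set.disjoint_singleton_left]; intro h; exact hdD _ (by omega) (d3 h)
  · simp only [Set.disjoint_singleton_left]; intro h; exact hdD _ (by omega) (d3 h)
  · rw [Set.disjoint_left]; rintro v ⟨i, j1, j2, rfl⟩ hv
    obtain ⟨j, j3, j4, j5⟩ := o2 _ hv
    have := hinj _ (by omega) _ (by omega) j5; omega
  · rw [Set.disjoint_left]; rintro v ⟨i, j1, j2, rfl⟩ hv; exact hdD _ (by omega) (n2 hv)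
  · rw [Set.disjoint_left]; rintro v hv hv'
    obtain ⟨j, j3, j4, rfl⟩ := o2 _ hv
    exact hdD _ (by omega) (n2 hv')
  · simp only [Set.disjoint_singleton_left]; rintro ⟨i, j1, j2, j3⟩
    have := hinj _ (by omega) _ (by omega) j3; omega
  · simp only [Set.disjoint_singleton_left]; intro h; obtain ⟨i, j1, j2, j3⟩ := o2 _ h
    have := hinj _ (by omega) _ (by omega) j3; omega
  · simp only [Set.disjoint_singleton_left]; intro h; exact hdD _ (by omega) (n2 h)
  · simp only [Set.disjoint_singleton_left]; rintro ⟨i, j1, j2, j3⟩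
    have := hinj _ (by omega) _ (by omega) j3; omega
  · simp only [Set.disjoint_singleton_left]; intro h; obtain ⟨i, j1, j2, j3⟩ := o2 _ h
    have := hinj _ (by omega) _ (by omega) j3; omega
  · simp only [Set.disjoint_singleton_left]; intro h; exact hdD _ (by omega) (n2 h)
  · rw [Set.disjoint_left]; rintro v hv ⟨i, j1, j2, rfl⟩; exact hdD _ (by omega) (d3 hv)
  · rw [Set.disjoint_left]; intro v hv hv'; obtain ⟨i, j1, j2, rfl⟩ := o2 _ hv'
    exact hdD _ (by omega) (d3 hv)
  · exact ⟨_, rfl, _, mem_arc le_rfl (by omega), hc.adj _ (by omega)⟩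
  · refine ⟨_, rfl, c (hi - 1), mem_arc (by omega) le_rfl, ?_⟩
    have := hc.adj (hi - 1) (by omega)
    rw [show hi - 1 + 1 = hi by omega] at this
    exact this.symm
  · simp only [Set.singleton_subset_iff]; exact mem_arc (by omega) (by omega)
  · simp only [Set.singleton_subset_iff]; exact o3 _ d5 d6


set_option maxHeartbeats 1000000 in
theorem Cyc.noR23 {G : SimpleGraph V} {c : ℕ → V} {k : ℕ} {D : Set V} (hc : Cyc G c k D)
    (hG : Pl G) : ¬ R23 G (c 0) (c 1) (c k) := by
  rintro ⟨Z, P, Q, U, W, cZ, cP, cQ, cU, cW, hsZ, haP, htQ, zp, zq, pq, uz, up, uq, wz, wp, wq, uw,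
    tuz, tup, tuq, twz, twp, twq⟩
  have hk := hc.hk
  rw [Set.disjoint_left] at zp zq pq uz up uq wz wp wq uw
  have hinj := hc.inj
  have hdD := hc.dD
  -- helper: a connected set containing `c 0` disjoint from a connected set containing `c 1`, `c k`
  have key : ∀ E F, Cn G E → Cn G F → c 0 ∈ E → c 1 ∈ F → c k ∈ F → (∀ x, x ∈ E → x ∈ F → False) →
      ∀ i, 1 ≤ i → i ≤ k → c i ∈ E → False := by
    intro E F hE hF h0 h1 hk' hEF i hi hik hiE
    have i1 : i ≠ 1 := by rintro rfl; exact hEF _ hiE h1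
    have i2 : i ≠ k := by rintro rfl; exact hEF _ hiE hk'
    exact hc.cross hG hE hF hEF (i1 := 0) (i2 := 1) (i3 := i) (i4 := k) (by omega) (by omega) (by omega)
      le_rfl h0 hiE h1 hk'
  have kU : ∀ i, 1 ≤ i → i ≤ k → c i ∉ U := by
    intro i h1 h2 h3
    refine key (Z ∪ U) (P ∪ W ∪ Q) (cZ.union cU tuz.symm) ((cP.union cW twp.symm).union cQ
      (twq.mono (by simp) subset_rfl)) (Or.inl hsZ) (Or.inl (Or.inl haP)) (Or.inr htQ) ?_ i h1 h2 (Or.inr h3)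
    rintro x (hx | hx) ((hy | hy) | hy) <;> grind
  have kW : ∀ i, 1 ≤ i → i ≤ k → c i ∉ W := by
    intro i h1 h2 h3
    refine key (Z ∪ W) (P ∪ U ∪ Q) (cZ.union cW twz.symm) ((cP.union cU tup.symm).union cQ
      (tuq.mono (by simp) subset_rfl)) (Or.inl hsZ) (Or.inl (Or.inl haP)) (Or.inr htQ) ?_ i h1 h2 (Or.inr h3)
    rintro x (hx | hx) ((hy | hy) | hy) <;> grind
  have kZ : ∀ i, 1 ≤ i → i ≤ k → c i ∉ Z := by
    intro i h1 h2 h3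
    refine key Z (P ∪ U ∪ Q) cZ ((cP.union cU tup.symm).union cQ
      (tuq.mono (by simp) subset_rfl)) hsZ (Or.inl (Or.inl haP)) (Or.inr htQ) ?_ i h1 h2 h3
    rintro x hx ((hy | hy) | hy) <;> grind
  have kPQ : ∀ i j, 1 ≤ i → i ≤ k → 1 ≤ j → j ≤ k → c i ∈ Q → c j ∈ P → j < i := by
    intro i j h1 h2 h3 h4 h5 h6
    by_contra hcon
    have i1 : i ≠ 1 := by rintro rfl; exact pq haP h5
    have i2 : j ≠ k := by rintro rfl; exact pq h6 htQ
    have i3 : i ≠ j := by rintro rfl; exact pq h6 h5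
    exact hc.cross hG cP cQ (fun x hx hy => pq hx hy) (i1 := 1) (i2 := i) (i3 := j) (i4 := k)
      (by omega) (by omega) (by omega) le_rfl haP h6 h5 htQ
  classical
  obtain ⟨m, ⟨hm1, hmk, hmP⟩, hmax⟩ : ∃ m, (1 ≤ m ∧ m ≤ k ∧ c m ∈ P) ∧ ∀ j, 1 ≤ j → j ≤ k → c j ∈ P → j ≤ m := by
    have hex : ∃ m, 1 ≤ m ∧ m ≤ k ∧ c m ∈ P := ⟨1, le_rfl, by omega, haP⟩
    let S := (Finset.range (k+1)).filter (fun m => 1 ≤ m ∧ c m ∈ P)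
    have hS : S.Nonempty := ⟨1, by simp [S, haP]; omega⟩
    refine ⟨S.max' hS, ?_, ?_⟩
    · have h := Finset.mem_filter.1 (S.max'_mem hS)
      exact ⟨h.2.1, Nat.lt_succ_iff.1 (Finset.mem_range.1 h.1), h.2.2⟩
    · intro j h1 h2 h3
      exact S.le_max' _ (by simp [S]; exact ⟨by omega, h1, h3⟩)
  have hmk' : m < k := kPQ k m (by omega) le_rfl hm1 hmk htQ hmP
  have hcn : ∀ a b, a ≤ b → b ≤ k → Cn G (arc c a b) := fun a b h1 h2 =>
    cn_arc h1 (fun l _ h4 => hc.adj l (by omega))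
  have hI1 : ∀ v ∈ arc c 1 m, v ∈ P ∨ v ∉ Z ∧ v ∉ Q ∧ v ∉ U ∧ v ∉ W := by
    rintro v ⟨i, h1, h2, rfl⟩
    by_cases hP : c i ∈ P
    · exact Or.inl hP
    · right
      refine ⟨kZ i h1 (by omega), ?_, kU i h1 (by omega), kW i h1 (by omega)⟩
      intro hQ
      have := kPQ i m h1 (by omega) hm1 hmk hQ hmP
      omega
  have hI2 : ∀ v ∈ arc c (m+1) k, v ∉ P ∧ v ∉ Z ∧ v ∉ U ∧ v ∉ W := by
    rintro v ⟨i, h1, h2, rfl⟩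
    refine ⟨?_, kZ i (by omega) (by omega), kU i (by omega) (by omega), kW i (by omega) (by omega)⟩
    intro hP
    have := hmax i (by omega) h2 hP
    omega
  have hI12 : ∀ v ∈ arc c 1 m, v ∉ arc c (m+1) k := by
    rintro v ⟨i, h1, h2, rfl⟩ ⟨j, h3, h4, h5⟩
    have := hinj _ (by omega) _ (by omega) h5; omega
  have hsup : ∀ E, Cn G E → (∃ i ≤ k, c i ∈ E) → ∀ x ∈ E, x ∈ D ∨ ∃ i ≤ k, c i = x := by
    rintro E hE ⟨i, hi, hiE⟩
    exact hE.subset_of (Y := {x | x ∈ D ∨ ∃ i ≤ k, c i = x}) hiE (Or.inr ⟨i, hi, rfl⟩)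
      (fun y _ _ x _ h => hc.supp x y h.symm)
  have h0Z : ∀ v, v ∈ P ∨ v ∈ Q ∨ v ∈ U ∨ v ∈ W → v ≠ c 0 := by
    rintro v hv rfl; grind
  have hsup2 : ∀ E, Cn G E → Tch G E Z → ∀ x ∈ E, x ∈ D ∨ ∃ i ≤ k, c i = x := by
    rintro E hE ⟨x, hx, y, hy, hxy⟩
    exact hE.subset_of (Y := {x | x ∈ D ∨ ∃ i ≤ k, c i = x}) hx (hc.supp x y hxy)
      (fun y _ _ x _ h => hc.supp x y h.symm)
  have M : ∀ x, (x ∈ Z → x ∉ P) ∧ (x ∈ Z → x ∉ Q) ∧ (x ∈ P → x ∉ Q) ∧ (x ∈ U → x ∉ P) ∧ (x ∈ U → x ∉ Q) ∧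
      (x ∈ W → x ∉ P) ∧ (x ∈ W → x ∉ Q) ∧ (x ∈ arc c 1 m → x ∈ P ∨ x ∉ Z ∧ x ∉ Q ∧ x ∉ U ∧ x ∉ W) ∧
      (x ∈ arc c (m+1) k → x ∉ P ∧ x ∉ Z ∧ x ∉ U ∧ x ∉ W) ∧ (x ∈ arc c 1 m → x ∉ arc c (m+1) k) :=
    fun x => ⟨@zp x, @zq x, @pq x, @up x, @uq x, @wp x, @wq x, hI1 x, hI2 x, hI12 x⟩
  have hA : AFH G D {c 0} (arc c 1 m) (arc c (m+1) k) Z (P ∪ arc c 1 m) (Q ∪ arc c (m+1) k) U W := {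
    cI0 := cn_singleton _ _
    cI1 := hcn _ _ hm1 hmk
    cI2 := hcn _ _ (by omega) le_rfl
    cZ := cZ
    cP := cP.union' (hcn _ _ hm1 hmk) haP (mem_arc le_rfl hm1)
    cQ := cQ.union' (hcn _ _ (by omega) le_rfl) htQ (mem_arc (by omega) le_rfl)
    cU := cU
    cW := cW
    s0 := by simpa using hsZ
    s1 := Set.subset_union_right
    s2 := Set.subset_union_right
    t01 := ⟨_, rfl, _, mem_arc le_rfl hm1, hc.adj 0 (by omega)⟩
    t02 := ⟨_, rfl, _, mem_arc (by omega) le_rfl, hc.adj0⟩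
    t12 := ⟨_, mem_arc hm1 le_rfl, _, mem_arc le_rfl (by omega), hc.adj m hmk'⟩
    dZ := by
      intro x hx hx0
      rcases hsup Z cZ ⟨0, by omega, hsZ⟩ x hx with h | ⟨i, hi, rfl⟩
      · exact h
      · by_cases h0 : i = 0
        · subst h0; exact (hx0 rfl).elim
        · exact (kZ i (by omega) hi hx).elim
    dP := by
      rintro x (hx | hx) hx0
      · rcases hsup P cP ⟨1, by omega, haP⟩ x hx with h | ⟨i, hi, rfl⟩
        · exact h
        · by_cases h0 : i = 0
          · subst h0; exact (h0Z _ (Or.inl hx) rfl).elim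
          · exact (hx0 (mem_arc (by omega) (hmax i (by omega) hi hx))).elim
      · exact (hx0 hx).elim
    dQ := by
      rintro x (hx | hx) hx0
      · rcases hsup Q cQ ⟨k, by omega, htQ⟩ x hx with h | ⟨i, hi, rfl⟩
        · exact h
        · by_cases h0 : i = 0
          · subst h0; exact (h0Z _ (Or.inr (Or.inl hx)) rfl).elim
          · exact (hx0 (mem_arc (kPQ i m (by omega) hi hm1 hmk hx hmP) hi)).elim
      · exact (hx0 hx).elim
    dU := by
      intro x hx
      rcases hsup2 U cU tuz x hx with h | ⟨i, hi, rfl⟩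
      · exact h
      · by_cases h0 : i = 0
        · subst h0; exact (h0Z _ (by tauto) rfl).elim
        · exact (kU i (by omega) hi hx).elim
    dW := by
      intro x hx
      rcases hsup2 W cW twz x hx with h | ⟨i, hi, rfl⟩
      · exact h
      · by_cases h0 : i = 0
        · subst h0; exact (h0Z _ (by tauto) rfl).elim
        · exact (kW i (by omega) hi hx).elim
    zp := Set.disjoint_left.2 (by intro x hx hy; have := M x; clear key kU kW kZ kPQ hmax hsup hsup2 hI1 hI2 hI12 h0Z hcn hdD hinj zp zq pq uz up uq wz wp wq uw; clear M hsZ haP htQ hc cZ cP cQ cU cW hmP; simp only [Set.mem_union] at hx hy; grind)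
    zq := Set.disjoint_left.2 (by intro x hx hy; have := M x; clear key kU kW kZ kPQ hmax hsup hsup2 hI1 hI2 hI12 h0Z hcn hdD hinj zp zq pq uz up uq wz wp wq uw; clear M hsZ haP htQ hc cZ cP cQ cU cW hmP; simp only [Set.mem_union] at hx hy; grind)
    pq := Set.disjoint_left.2 (by intro x hx hy; have := M x; clear key kU kW kZ kPQ hmax hsup hsup2 hI1 hI2 hI12 h0Z hcn hdD hinj zp zq pq uz up uq wz wp wq uw; clear M hsZ haP htQ hc cZ cP cQ cU cW hmP; simp only [Set.mem_union] at hx hy; grind)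
    uz := Set.disjoint_left.2 uz
    up := Set.disjoint_left.2 (by intro x hx hy; have := M x; clear key kU kW kZ kPQ hmax hsup hsup2 hI1 hI2 hI12 h0Z hcn hdD hinj zp zq pq uz up uq wz wp wq uw; clear M hsZ haP htQ hc cZ cP cQ cU cW hmP; simp only [Set.mem_union] at hx hy; grind)
    uq := Set.disjoint_left.2 (by intro x hx hy; have := M x; clear key kU kW kZ kPQ hmax hsup hsup2 hI1 hI2 hI12 h0Z hcn hdD hinj zp zq pq uz up uq wz wp wq uw; clear M hsZ haP htQ hc cZ cP cQ cU cW hmP; simp only [Set.mem_union] at hx hy; grind)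
    wz := Set.disjoint_left.2 wz
    wp := Set.disjoint_left.2 (by intro x hx hy; have := M x; clear key kU kW kZ kPQ hmax hsup hsup2 hI1 hI2 hI12 h0Z hcn hdD hinj zp zq pq uz up uq wz wp wq uw; clear M hsZ haP htQ hc cZ cP cQ cU cW hmP; simp only [Set.mem_union] at hx hy; grind)
    wq := Set.disjoint_left.2 (by intro x hx hy; have := M x; clear key kU kW kZ kPQ hmax hsup hsup2 hI1 hI2 hI12 h0Z hcn hdD hinj zp zq pq uz up uq wz wp wq uw; clear M hsZ haP htQ hc cZ cP cQ cU cW hmP; simp only [Set.mem_union] at hx hy; grind)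
    uw := Set.disjoint_left.2 uw
    tuz := tuz
    tup := tup.mono subset_rfl Set.subset_union_left
    tuq := tuq.mono subset_rfl Set.subset_union_left
    twz := twz
    twp := twp.mono subset_rfl Set.subset_union_left
    twq := twq.mono subset_rfl Set.subset_union_left }
  refine hA.false hG hc.conn ?_ ?_ ?_
  · simp only [Set.disjoint_singleton_right]; exact hdD 0 (by omega)
  · rw [Set.disjoint_right]; rintro v ⟨i, h1, h2, rfl⟩; exact hdD i (by omega)
  · rw [Set.disjoint_right]; rintro v ⟨i, h1, h2, rfl⟩; exact hdD i (by omega)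

end Tri

namespace Tri
variable {V : Type} {W : Type}

theorem R23.swap {G : SimpleGraph V} {s a t : V} (h : R23 G s a t) : R23 G s t a := by
  obtain ⟨Z, P, Q, U, W, cZ, cP, cQ, cU, cW, hsZ, haP, htQ, zp, zq, pq, uz, up, uq, wz, wp, wq, uw,
    tuz, tup, tuq, twz, twp, twq⟩ := h
  exact ⟨Z, Q, P, U, W, cZ, cQ, cP, cU, cW, hsZ, htQ, haP, zq, zp, pq.symm, uz, uq, up, wz, wq, wp, uw,
    tuz, tuq, tup, twz, twq, twp⟩

/-- `G'` is `G` plus possibly the edge `a t`. -/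
def Plus (G G' : SimpleGraph V) (a t : V) : Prop :=
  G ≤ G' ∧ ∀ u v, G'.Adj u v → G.Adj u v ∨ (u = a ∧ v = t) ∨ (u = t ∧ v = a)

theorem Plus.swap {G G' : SimpleGraph V} {a t : V} (h : Plus G G' a t) : Plus G G' t a :=
  ⟨h.1, fun u v huv => by have := h.2 u v huv; tauto⟩

theorem Plus.cn {G G' : SimpleGraph V} {a t : V} (h : Plus G G' a t) {X : Set V} (hX : Cn G' X)
    (hn : ¬ (a ∈ X ∧ t ∈ X)) : Cn G X := by
  refine hX.mono fun x hx y hy hxy => ?_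
  rcases h.2 x y hxy with h | ⟨rfl, rfl⟩ | ⟨rfl, rfl⟩
  · exact h
  · exact (hn ⟨hx, hy⟩).elim
  · exact (hn ⟨hy, hx⟩).elim

theorem Plus.cn3 {G G' : SimpleGraph V} {a t s : V} (h : Plus G G' a t) {X : Set V} (hX : Cn G' X)
    (hs : s ∈ X) (hsa : G.Adj s a) (hst : G.Adj s t) : Cn G X := by
  refine ⟨hX.1, fun Y hY hcl => hX.2 Y hY ?_⟩
  intro y hy hyY x hx hyx
  rcases h.2 y x hyx with h | ⟨rfl, rfl⟩ | ⟨rfl, rfl⟩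
  · exact hcl y hy hyY x hx h
  · exact hcl s hs (hcl y hy hyY s hs hsa.symm) x hx hst
  · exact hcl s hs (hcl y hy hyY s hs hst.symm) x hx hsa

theorem Plus.tch {G G' : SimpleGraph V} {a t : V} (h : Plus G G' a t) {X Y : Set V} (hX : Tch G' X Y)
    (h1 : ¬ (a ∈ X ∧ t ∈ Y)) (h2 : ¬ (t ∈ X ∧ a ∈ Y)) : Tch G X Y := by
  obtain ⟨x, hx, y, hy, hxy⟩ := hX
  rcases h.2 x y hxy with h | ⟨rfl, rfl⟩ | ⟨rfl, rfl⟩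
  · exact ⟨x, hx, y, hy, h⟩
  · exact (h1 ⟨hx, hy⟩).elim
  · exact (h2 ⟨hx, hy⟩).elim

theorem Mod.addv [DecidableEq W] {K : SimpleGraph W} {G : SimpleGraph V} {f : W → Set V} (h : Mod K G f) {s a : V}
    (hs : ∀ i, s ∉ f i) {p : W} (ha : a ∈ f p) (hsa : G.Adj s a) :
    Mod K G (Function.update f p (insert s (f p))) := by
  have hsub : ∀ i, f i ⊆ Function.update f p (insert s (f p)) i := by
    intro i
    by_cases hi : i = p
    · subst hi; simp
    · simp [hi]
  have hmem : ∀ i x, x ∈ Function.update f p (insert s (f p)) i → x ∈ f i ∨ (x = s ∧ i = p) := by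
    intro i x hx
    by_cases hi : i = p
    · subst hi; simp at hx; tauto
    · simp [hi] at hx; tauto
  refine ⟨?_, ?_, fun i j hij => (h.tch i j hij).mono (hsub i) (hsub j)⟩
  · intro i
    by_cases hi : i = p
    · subst hi; simp; exact (h.cn i).insert ha hsa
    · simp [hi]; exact h.cn i
  · intro i j x hi hj
    have := h.dj i j x
    have := hs i
    have := hs j
    rcases hmem i x hi with h1 | ⟨rfl, h1⟩ <;> rcases hmem j x hj with h2 | ⟨h3, h2⟩ <;> grind

/-- shrink one branch set -/
theorem Mod.shrink [DecidableEq W] {K : SimpleGraph W} {G : SimpleGraph V} {f : W → Set V} {p : W} {X : Set V}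
    (hX : Cn G X) (hXp : X ⊆ f p) (hcn : ∀ i, i ≠ p → Cn G (f i))
    (dj : ∀ i j x, x ∈ f i → x ∈ f j → i = j)
    (htch : ∀ i j, i ≠ p → j ≠ p → K.Adj i j → Tch G (f i) (f j))
    (hp : ∀ j, K.Adj p j → Tch G X (f j)) : Mod K G (Function.update f p X) := by
  have hmem : ∀ i x, x ∈ Function.update f p X i → x ∈ f i := by
    intro i x hx
    by_cases hi : i = p
    · subst hi; simp at hx; exact hXp hx
    · simpa [hi] using hx
  refine ⟨?_, fun i j x hi hj => dj i j x (hmem i x hi) (hmem j x hj), ?_⟩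
  · intro i
    by_cases hi : i = p
    · subst hi; simpa using hX
    · simpa [hi] using hcn i hi
  · intro i j hij
    have hne := hij.ne
    by_cases hi : i = p
    · subst hi; simpa [hne.symm] using hp j hij
    · by_cases hj : j = p
      · subst hj; simpa [hi] using (hp i hij.symm).symm
      · simpa [hi, hj] using htch i j hi hj hij

/-- the outcome of the generic part of the chord lemma -/
theorem chord_generic [DecidableEq W] {K : SimpleGraph W} {G G' : SimpleGraph V} {s a t : V} (hP : Plus G G' a t)
    (hsa : G.Adj s a) (hst : G.Adj s t) {f : W → Set V} (hf : Mod K G' f)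
    (hno : ∀ f, ¬ Mod K G f) : ∃ f : W → Set V, ∃ p q r, (∀ i j, i ≠ j → Disjoint (f i) (f j)) ∧ r ≠ p ∧ r ≠ q ∧ 
      s ∈ f r ∧ (∀ i, i ≠ p ∨ p ≠ q → Cn G (f i)) ∧
      (∀ i j, K.Adj i j → ¬(i = p ∧ j = q) → ¬(i = q ∧ j = p) → Tch G (f i) (f j)) ∧
      ((p ≠ q ∧ K.Adj p q ∧ a ∈ f p ∧ t ∈ f q) ∨ (p = q ∧ ∃ X Y, Cn G X ∧ Cn G Y ∧ Disjoint X Y ∧ a ∈ X ∧ t ∈ Y ∧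
        X ⊆ f p ∧ Y ⊆ f p ∧
        (∀ j, K.Adj p j → Tch G X (f j) ∨ Tch G Y (f j)) ∧ (∃ j, K.Adj p j ∧ ¬ Tch G X (f j)) ∧
        ∃ j, K.Adj p j ∧ ¬ Tch G Y (f j))) := by
  -- a and t are used
  have use : ∀ f, Mod K G' f → (∃ p, a ∈ f p) ∧ ∃ q, t ∈ f q := by
    intro f hf
    by_contra hcon
    have hcon : (∀ p, a ∉ f p) ∨ ∀ q, t ∉ f q := by
      by_cases h : ∃ p, a ∈ f p
      · right; intro q hq; exact hcon ⟨h, q, hq⟩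
      · left; push Not at h; exact h
    refine hno f ⟨fun i => hP.cn (hf.cn i) ?_, hf.dj, fun i j hij => hP.tch (hf.tch i j hij) ?_ ?_⟩ <;> grind
  obtain ⟨f, hf, hs⟩ : ∃ f, Mod K G' f ∧ ∃ r, s ∈ f r := by
    by_cases h : ∃ r, s ∈ f r
    · exact ⟨f, hf, h⟩
    · push Not at h
      obtain ⟨p, hp⟩ := (use f hf).1
      exact ⟨_, hf.addv h hp (hP.1 hsa), p, by simp⟩
  obtain ⟨⟨p, hp⟩, q, hq⟩ := use f hf
  obtain ⟨r, hr⟩ := hs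
  have hdj := hf.dj
  have ndj : ∀ i j x, x ∈ f i → x ∈ f j → i = j := hf.dj
  have tchG : ∀ i j, K.Adj i j → ¬(i = p ∧ j = q) → ¬(i = q ∧ j = p) → Tch G (f i) (f j) := by
    intro i j hij h1 h2
    refine hP.tch (hf.tch i j hij) ?_ ?_
    · rintro ⟨h3, h4⟩; exact h1 ⟨ndj _ _ _ h3 hp, ndj _ _ _ h4 hq⟩
    · rintro ⟨h3, h4⟩; exact h2 ⟨ndj _ _ _ h3 hq, ndj _ _ _ h4 hp⟩
  have cnG : ∀ i, i ≠ p ∨ p ≠ q → Cn G (f i) := by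
    intro i hi
    refine hP.cn (hf.cn i) ?_
    rintro ⟨h1, h2⟩
    have e1 := ndj _ _ _ h1 hp
    have e2 := ndj _ _ _ h2 hq
    subst e1; subst e2; simp at hi
  have hrp : r ≠ p := by
    rintro rfl
    refine hno f ⟨fun i => ?_, hf.dj, fun i j hij => ?_⟩
    · by_cases hi : i = r
      · subst hi; exact hP.cn3 (hf.cn i) hr hsa hst
      · exact cnG i (Or.inl hi)
    · by_cases h1 : i = r ∧ j = q
      · exact ⟨s, by rw [h1.1]; exact hr, t, by rw [h1.2]; exact hq, hst⟩
      by_cases h2 : i = q ∧ j = r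
      · exact ⟨t, by rw [h2.1]; exact hq, s, by rw [h2.2]; exact hr, hst.symm⟩
      exact tchG i j hij h1 h2
  have hrq : r ≠ q := by
    rintro rfl
    refine hno f ⟨fun i => ?_, hf.dj, fun i j hij => ?_⟩
    · exact cnG i (Or.inr (Ne.symm hrp))
    · by_cases h1 : i = p ∧ j = r
      · exact ⟨a, by rw [h1.1]; exact hp, s, by rw [h1.2]; exact hr, hsa.symm⟩
      by_cases h2 : i = r ∧ j = p
      · exact ⟨s, by rw [h2.1]; exact hr, a, by rw [h2.2]; exact hp, hsa⟩
      exact tchG i j hij h1 h2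
  refine ⟨f, p, q, r, fun i j hij => Set.disjoint_left.2 fun x h1 h2 => hij (hf.dj i j x h1 h2), hrp, hrq, hr,
    cnG, tchG, ?_⟩
  by_cases hpq : p = q
  · right
    refine ⟨hpq, ?_⟩
    subst hpq
    have hnc : ¬ Cn G (f p) := by
      intro hc
      refine hno f ⟨fun i => ?_, hf.dj, fun i j hij => tchG i j hij ?_ ?_⟩
      · by_cases hi : i = p
        · subst hi; exact hc
        · exact cnG i (Or.inl hi)
      · rintro ⟨rfl, rfl⟩; exact hij.ne rfl
      · rintro ⟨rfl, rfl⟩; exact hij.ne rfl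
    have hcov : f p ⊆ comp G (f p) a ∪ comp G (f p) t := by
      refine (hf.cn p).subset_of hp (Or.inl (mem_comp_self _ _ _)) ?_
      rintro y hy hyc x hx hyx
      rcases hP.2 y x hyx with h | ⟨rfl, rfl⟩ | ⟨rfl, rfl⟩
      · rcases hyc with hyc | hyc
        · exact Or.inl (comp_closed hp hyc hx h)
        · exact Or.inr (comp_closed hq hyc hx h)
      · exact Or.inr (mem_comp_self _ _ _)
      · exact Or.inl (mem_comp_self _ _ _)
    have hX : comp G (f p) a ⊆ f p := comp_subset hp
    have hY : comp G (f p) t ⊆ f p := comp_subset hq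
    have aux : ∀ X, Cn G X → X ⊆ f p → ∃ j, K.Adj p j ∧ ¬ Tch G X (f j) := by
      intro X hX hXp
      by_contra hcon
      push Not at hcon
      exact hno _ (Mod.shrink hX hXp (fun i hi => cnG i (Or.inl hi)) hf.dj
        (fun i j h1 h2 h3 => tchG i j h3 (by tauto) (by tauto)) hcon)
    refine ⟨_, _, cn_comp hp, cn_comp hq, ?_, mem_comp_self _ _ _, mem_comp_self _ _ _, hX, hY, ?_,
      aux _ (cn_comp hp) hX, aux _ (cn_comp hq) hY⟩
    · rw [Set.disjoint_left]
      intro z h1 h2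
      apply hnc
      have := (cn_comp hp).union' (cn_comp hq) h1 h2
      rwa [Set.Subset.antisymm (Set.union_subset hX hY) hcov] at this
    · intro j hj
      obtain ⟨x, hx, y, hy, hxy⟩ := tchG p j hj (by rintro ⟨_, rfl⟩; exact hj.ne rfl)
        (by rintro ⟨_, rfl⟩; exact hj.ne rfl)
      rcases hcov hx with h | h
      · exact Or.inl ⟨x, h, y, hy, hxy⟩
      · exact Or.inr ⟨x, h, y, hy, hxy⟩
  · left
    refine ⟨hpq, ?_, hp, hq⟩
    by_contra hK
    refine hno f ⟨fun i => cnG i (Or.inr hpq), hf.dj, fun i j hij => tchG i j hij ?_ ?_⟩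
    · rintro ⟨rfl, rfl⟩; exact hK hij
    · rintro ⟨rfl, rfl⟩; exact hK hij.symm

theorem two_more5 : ∀ p q r : Fin 5, p ≠ q → r ≠ p → r ≠ q → ∃ u w, u ≠ w ∧ u ≠ p ∧ u ≠ q ∧ u ≠ r ∧
  w ≠ p ∧ w ≠ q ∧ w ≠ r := by decide

theorem one_more5 : ∀ p q r s : Fin 5, ∃ u, u ≠ p ∧ u ≠ q ∧ u ≠ r ∧ u ≠ s := by decide

theorem two_more33 : ∀ p : Fin 3 ⊕ Fin 3, ∃ u w, u ≠ w ∧ u ≠ p ∧ w ≠ p ∧ u.isLeft = p.isLeft ∧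
   w.isLeft = p.isLeft := by decide

theorem one_more33 : ∀ p q : Fin 3 ⊕ Fin 3, p.isLeft = q.isLeft → ∃ u, u ≠ p ∧ u ≠ q ∧ u.isLeft = p.isLeft := by
  decide

theorem chord5 {G G' : SimpleGraph V} {s a t : V} (hP : Plus G G' a t)
    (hsa : G.Adj s a) (hst : G.Adj s t) {f : Fin 5 → Set V} (hf : Mod K5 G' f)
    (hno : ∀ f, ¬ Mod K5 G f) : R23 G s a t := by
  obtain ⟨f, p, q, r, dj, hrp, hrq, hr, cnG, tchG, h⟩ := chord_generic hP hsa hst hf hno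
  have tchG : ∀ i j, i ≠ j → ¬(i = p ∧ j = q) → ¬(i = q ∧ j = p) → Tch G (f i) (f j) :=
    fun i j hij => tchG i j hij
  rcases h with ⟨hpq, -, ha, ht⟩ | ⟨rfl, h⟩
  · obtain ⟨u, w, h1, h2, h3, h4, h5, h6, h7⟩ := two_more5 p q r hpq hrp hrq
    refine ⟨f r, f p, f q, f u, f w, cnG _ (Or.inr hpq), cnG _ (Or.inr hpq), cnG _ (Or.inr hpq),
      cnG _ (Or.inr hpq), cnG _ (Or.inr hpq), hr, ha, ht, dj _ _ hrp, dj _ _ hrq, dj _ _ hpq, dj _ _ h4, dj _ _ h2,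
      dj _ _ h3, dj _ _ h7, dj _ _ h5, dj _ _ h6, dj _ _ h1, ?_, ?_, ?_, ?_, ?_, ?_⟩ <;>
    exact tchG _ _ (by assumption) (by tauto) (by tauto)
  · have main : ∀ a t : V, G.Adj s a → G.Adj s t → ∀ X Y, Cn G X → Cn G Y → Disjoint X Y → a ∈ X → t ∈ Y →
        X ⊆ f p → Y ⊆ f p → ∀ j1 j2 j3, j1 ≠ p → j2 ≠ p → j3 ≠ p → j1 ≠ r → j2 ≠ r → j3 ≠ r → j1 ≠ j2 → j1 ≠ j3 →
        j2 ≠ j3 → Tch G Y (f j1) → Tch G X (f j2) → Tch G X (f j3) → R23 G s a t := by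
      intro a t hsa hst X Y cX cY dXY haX htY hX hY j1 j2 j3 n1 n2 n3 m1 m2 m3 l1 l2 l3 t1 t2 t3
      have cg : ∀ i, i ≠ p → Cn G (f i) := fun i hi => cnG i (Or.inl hi)
      have tg : ∀ i j, i ≠ j → i ≠ p → j ≠ p → Tch G (f i) (f j) := fun i j h1 h2 h3 =>
        tchG i j h1 (by tauto) (by tauto)
      refine ⟨f r, X, Y ∪ f j1, f j2, f j3, cg _ hrp, cX, cY.union (cg _ n1) t1, cg _ n2, cg _ n3,
        hr, haX, Or.inl htY, (dj _ _ hrp).mono_right hX, 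
        Set.disjoint_union_right.2 ⟨(dj _ _ hrp).mono_right hY, dj _ _ m1.symm⟩,
        Set.disjoint_union_right.2 ⟨dXY, (dj _ _ n1.symm).mono_left hX⟩,
        dj _ _ m2, (dj _ _ n2).mono_right hX, 
        Set.disjoint_union_right.2 ⟨(dj _ _ n2).mono_right hY, dj _ _ l1.symm⟩,
        dj _ _ m3, (dj _ _ n3).mono_right hX, 
        Set.disjoint_union_right.2 ⟨(dj _ _ n3).mono_right hY, dj _ _ l2.symm⟩,
        dj _ _ l3, tg _ _ m2 n2 hrp, t2.symm, (tg _ _ l1.symm n2 n1).mono subset_rfl Set.subset_union_right,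
        tg _ _ m3 n3 hrp, t3.symm, (tg _ _ l2.symm n3 n1).mono subset_rfl Set.subset_union_right⟩
    obtain ⟨X, Y, cX, cY, dXY, haX, htY, hX, hY, hXY, ⟨j1, k1, k2⟩, ⟨j2, k3, k4⟩⟩ := h
    have hXr : Tch G X (f r) := ⟨a, haX, s, hr, hsa.symm⟩
    have hYr : Tch G Y (f r) := ⟨t, htY, s, hr, hst.symm⟩
    have y1 := (hXY j1 k1).resolve_left k2
    have x2 := (hXY j2 k3).resolve_right k4
    have m1 : j1 ≠ r := by rintro rfl; exact k2 hXr
    have m2 : j2 ≠ r := by rintro rfl; exact k4 hYr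
    have l1 : j1 ≠ j2 := by rintro rfl; exact k2 x2
    obtain ⟨j3, g1, g2, g3, g4⟩ := one_more5 p r j1 j2
    have k1 : j1 ≠ p := k1.ne.symm
    have k3 : j2 ≠ p := k3.ne.symm
    rcases hXY j3 g1.symm with h | h
    · exact main a t hsa hst X Y cX cY dXY haX htY hX hY j1 j2 j3 k1 k3 g1 m1 m2 g2 l1 g3.symm g4.symm y1 x2 h
    · exact (main t a hst hsa Y X cY cX dXY.symm htY haX hY hX j2 j1 j3 k3 k1 g1 m2 m1 g2 l1.symm g4.symm
        g3.symm x2 y1 h).swap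

theorem chord33 {G G' : SimpleGraph V} {s a t : V} (hP : Plus G G' a t)
    (hsa : G.Adj s a) (hst : G.Adj s t) {f : Fin 3 ⊕ Fin 3 → Set V} (hf : Mod K33 G' f)
    (hno : ∀ f, ¬ Mod K33 G f) : R23 G s a t := by
  obtain ⟨f, p, q, r, dj, hrp, hrq, hr, cnG, tchG, h⟩ := chord_generic hP hsa hst hf hno
  simp only [K33_r] at tchG h
  rcases h with ⟨hpq, hK, ha, ht⟩ | ⟨rfl, h⟩
  · have main : ∀ a t p q, p ≠ q → r ≠ p → r ≠ q → p.isLeft ≠ q.isLeft → a ∈ f p → t ∈ f q → r.isLeft = p.isLeft →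
       (∀ i j, i.isLeft ≠ j.isLeft → ¬(i = p ∧ j = q) → ¬(i = q ∧ j = p) → Tch G (f i) (f j)) → R23 G s a t := by
      intro a t p q npq nrp nrq hK ha ht hrs tchG
      obtain ⟨p', h1, h2, h3⟩ := one_more33 p r hrs.symm
      obtain ⟨u, w, h4, h5, h6, h7, h8⟩ := two_more33 q
      have e : ∀ i j : Fin 3 ⊕ Fin 3, i.isLeft ≠ j.isLeft → i ≠ j := by rintro i _ h rfl; exact h rfl
      have cg : ∀ i, Cn G (f i) := fun i => cnG i (Or.inr hpq)
      have tg1 : ∀ i j, i.isLeft ≠ j.isLeft → i ≠ p → j ≠ p → Tch G (f i) (f j) := fun i j h1 h2 h3 =>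
        tchG i j h1 (by tauto) (by tauto)
      have tg2 : ∀ i j, i.isLeft ≠ j.isLeft → i ≠ q → j ≠ q → Tch G (f i) (f j) := fun i j h1 h2 h3 =>
        tchG i j h1 (by tauto) (by tauto)
      have D : ∀ i j, i ≠ j → Disjoint (f i) (f j) := dj
      refine ⟨f r, f p, f q ∪ f p', f u, f w, cg _, cg _, (cg _).union (cg _) (tg1 _ _ (by grind) npq.symm h1),
        cg _, cg _, hr, ha, Or.inl ht, dj _ _ nrp, 
        Set.disjoint_union_right.2 ⟨dj _ _ nrq, dj _ _ h2.symm⟩,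
        Set.disjoint_union_right.2 ⟨dj _ _ npq, dj _ _ h1.symm⟩,
        dj _ _ (e _ _ (by grind)), dj _ _ (e _ _ (by grind)), 
        Set.disjoint_union_right.2 ⟨dj _ _ h5, dj _ _ (e _ _ (by grind))⟩,
        dj _ _ (e _ _ (by grind)), dj _ _ (e _ _ (by grind)), 
        Set.disjoint_union_right.2 ⟨dj _ _ h6, dj _ _ (e _ _ (by grind))⟩, dj _ _ h4,
        tg2 _ _ (by grind) h5 (by grind), tg2 _ _ (by grind) h5 npq, 
        (tg2 _ _ (by grind) h5 (e _ _ (by grind))).mono subset_rfl Set.subset_union_right,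
        tg2 _ _ (by grind) h6 (by grind), tg2 _ _ (by grind) h6 npq, 
        (tg2 _ _ (by grind) h6 (e _ _ (by grind))).mono subset_rfl Set.subset_union_right⟩
    by_cases hrs : r.isLeft = p.isLeft
    · exact main a t p q hpq hrp hrq hK ha ht hrs tchG
    · refine (main t a q p hpq.symm hrq hrp hK.symm ht ha ?_ (fun i j h1 h2 h3 => tchG i j h1 h3 h2)).swap
      grind
  · have cg : ∀ i, i ≠ p → Cn G (f i) := fun i hi => cnG i (Or.inl hi)
    have tg : ∀ i j, i.isLeft ≠ j.isLeft → i ≠ p → j ≠ p → Tch G (f i) (f j) := fun i j h1 h2 h3 =>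
      tchG i j h1 (by tauto) (by tauto)
    have e : ∀ i j : Fin 3 ⊕ Fin 3, i.isLeft ≠ j.isLeft → i ≠ j := by rintro i _ h rfl; exact h rfl
    have main : r.isLeft = p.isLeft → ∀ a t : V, G.Adj s a → G.Adj s t → ∀ X Y, Cn G X → Cn G Y → Disjoint X Y → a ∈ X → t ∈ Y →
        X ⊆ f p → Y ⊆ f p → ∀ j1 j2 j3, p.isLeft ≠ j1.isLeft → p.isLeft ≠ j2.isLeft → p.isLeft ≠ j3.isLeft → j1 ≠ j2 → j1 ≠ j3 →
        j2 ≠ j3 → Tch G Y (f j1) → Tch G X (f j2) → Tch G X (f j3) → R23 G s a t := by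
      intro hrs a t hsa hst X Y cX cY dXY haX htY hX hY j1 j2 j3 n1 n2 n3 l1 l2 l3 t1 t2 t3
      obtain ⟨p', h1, h2, h3⟩ := one_more33 p r hrs.symm
      have n1' := (e _ _ n1).symm
      have n2' := (e _ _ n2).symm
      have n3' := (e _ _ n3).symm
      refine ⟨f r, X, (Y ∪ f j1) ∪ f p', f j2, f j3, cg _ hrp, cX, (cY.union (cg _ n1') t1).union (cg _ h1) 
          ((tg _ _ (by grind) n1' h1).mono Set.subset_union_right subset_rfl), cg _ n2', cg _ n3',
        hr, haX, Or.inl (Or.inl htY), (dj _ _ hrp).mono_right hX, 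
        Set.disjoint_union_right.2 ⟨Set.disjoint_union_right.2 ⟨(dj _ _ hrp).mono_right hY, dj _ _ (e _ _ (by grind))⟩, dj _ _ h2.symm⟩,
        Set.disjoint_union_right.2 ⟨Set.disjoint_union_right.2 ⟨dXY, (dj _ _ n1'.symm).mono_left hX⟩, (dj _ _ h1.symm).mono_left hX⟩,
        dj _ _ (e _ _ (by grind)), (dj _ _ n2').mono_right hX, 
        Set.disjoint_union_right.2 ⟨Set.disjoint_union_right.2 ⟨(dj _ _ n2').mono_right hY, dj _ _ l1.symm⟩, dj _ _ (e _ _ (by grind))⟩,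
        dj _ _ (e _ _ (by grind)), (dj _ _ n3').mono_right hX, 
        Set.disjoint_union_right.2 ⟨Set.disjoint_union_right.2 ⟨(dj _ _ n3').mono_right hY, dj _ _ l2.symm⟩, dj _ _ (e _ _ (by grind))⟩,
        dj _ _ l3, tg _ _ (by grind) n2' hrp, t2.symm, (tg _ _ (by grind) n2' h1).mono subset_rfl Set.subset_union_right,
        tg _ _ (by grind) n3' hrp, t3.symm, (tg _ _ (by grind) n3' h1).mono subset_rfl Set.subset_union_right⟩
    obtain ⟨X, Y, cX, cY, dXY, haX, htY, hX, hY, hXY, ⟨j1, k1, k2⟩, ⟨j2, k3, k4⟩⟩ := h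
    have hXr : Tch G X (f r) := ⟨a, haX, s, hr, hsa.symm⟩
    have hYr : Tch G Y (f r) := ⟨t, htY, s, hr, hst.symm⟩
    have y1 := (hXY j1 k1).resolve_left k2
    have x2 := (hXY j2 k3).resolve_right k4
    have m1 : j1 ≠ r := by rintro rfl; exact k2 hXr
    have m2 : j2 ≠ r := by rintro rfl; exact k4 hYr
    have l1 : j1 ≠ j2 := by rintro rfl; exact k2 x2
    by_cases hrs : r.isLeft = p.isLeft
    · obtain ⟨j3, g3, g4, g5⟩ := one_more33 j1 j2 (by grind)
      have g1 : p.isLeft ≠ j3.isLeft := by grind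
      rcases hXY j3 g1 with h | h
      · exact main hrs a t hsa hst X Y cX cY dXY haX htY hX hY j1 j2 j3 k1 k3 g1 l1 g3.symm g4.symm y1 x2 h
      · exact (main hrs t a hst hsa Y X cY cX dXY.symm htY haX hY hX j2 j1 j3 k3 k1 g1 l1.symm g4.symm
          g3.symm x2 y1 h).swap
    · obtain ⟨u, w, h4, h5, h6, h7, h8⟩ := two_more33 p
      have n1' := (e _ _ k1).symm
      have n2' := (e _ _ k3).symm
      refine ⟨f r, X ∪ f j2, Y ∪ f j1, f u, f w, cg _ hrp, cX.union (cg _ n2') x2, cY.union (cg _ n1') y1,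
        cg _ h5, cg _ h6, hr, Or.inl haX, Or.inl htY,
        Set.disjoint_union_right.2 ⟨(dj _ _ hrp).mono_right hX, dj _ _ m2.symm⟩,
        Set.disjoint_union_right.2 ⟨(dj _ _ hrp).mono_right hY, dj _ _ m1.symm⟩,
        Set.disjoint_union_left.2 ⟨Set.disjoint_union_right.2 ⟨dXY, (dj _ _ n1'.symm).mono_left hX⟩,
          Set.disjoint_union_right.2 ⟨(dj _ _ n2').mono_right hY, dj _ _ l1.symm⟩⟩,
        dj _ _ (e _ _ (by grind)),
        Set.disjoint_union_right.2 ⟨(dj _ _ h5).mono_right hX, dj _ _ (e _ _ (by grind))⟩,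
        Set.disjoint_union_right.2 ⟨(dj _ _ h5).mono_right hY, dj _ _ (e _ _ (by grind))⟩,
        dj _ _ (e _ _ (by grind)),
        Set.disjoint_union_right.2 ⟨(dj _ _ h6).mono_right hX, dj _ _ (e _ _ (by grind))⟩,
        Set.disjoint_union_right.2 ⟨(dj _ _ h6).mono_right hY, dj _ _ (e _ _ (by grind))⟩,
        dj _ _ h4, tg _ _ (by grind) h5 hrp,
        (tg _ _ (by grind) h5 n2').mono subset_rfl Set.subset_union_right,
        (tg _ _ (by grind) h5 n1').mono subset_rfl Set.subset_union_right, tg _ _ (by grind) h6 hrp,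
        (tg _ _ (by grind) h6 n2').mono subset_rfl Set.subset_union_right,
        (tg _ _ (by grind) h6 n1').mono subset_rfl Set.subset_union_right⟩

theorem chord {G G' : SimpleGraph V} {s a t : V} (hG : Pl G) (hP : Plus G G' a t)
    (hsa : G.Adj s a) (hst : G.Adj s t) (hR : ¬ R23 G s a t) : Pl G' :=
  ⟨fun _ hf => hR (chord5 hP hsa hst hf hG.1), fun _ hf => hR (chord33 hP hsa hst hf hG.2)⟩

end Tri

namespace Tri
variable {V : Type} {W : Type}

/-- `G'` is `G` plus the vertex `w` with neighbours among `s a t`. -/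
def Apx (G G' : SimpleGraph V) (w s a t : V) : Prop :=
  G ≤ G' ∧ ∀ u v, G'.Adj u v → G.Adj u v ∨ (u = w ∧ (v = s ∨ v = a ∨ v = t)) ∨
    (v = w ∧ (u = s ∨ u = a ∨ u = t))

theorem opp33 : ∀ p : Fin 3 ⊕ Fin 3, ∃ i j k : Fin 3 ⊕ Fin 3, i ≠ j ∧ i ≠ k ∧ j ≠ k ∧ p.isLeft ≠ i.isLeft ∧
   p.isLeft ≠ j.isLeft ∧ p.isLeft ≠ k.isLeft := by decide

theorem four_more5 : ∀ p : Fin 5, ∃ i j k l : Fin 5, p ≠ i ∧ p ≠ j ∧ p ≠ k ∧ p ≠ l ∧ i ≠ j ∧ i ≠ k ∧ i ≠ l ∧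
  j ≠ k ∧ j ≠ l ∧ k ≠ l := by decide

theorem apex_generic [DecidableEq W] {K : SimpleGraph W} {G G' : SimpleGraph V} {w s a t : V}
    (hA : Apx G G' w s a t)
    (hw : ∀ v, ¬ G.Adj w v) (sa : G.Adj s a) (st : G.Adj s t) (ta : G.Adj a t) {f : W → Set V}
    (hf : Mod K G' f) (hno : ∀ f, ¬ Mod K G f) : ∃ p, f p = {w} ∧
      (∀ j, K.Adj p j → s ∈ f j ∨ a ∈ f j ∨ t ∈ f j) ∧ (∀ i, i ≠ p → Cn G (f i)) ∧
      ∀ i j, i ≠ p → j ≠ p → K.Adj i j → Tch G (f i) (f j) := by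
  have hcn : ∀ i, w ∉ f i → Cn G (f i) := by
    intro i hi
    refine (hf.cn i).mono fun x hx y hy hxy => ?_
    rcases hA.2 x y hxy with h | ⟨rfl, _⟩ | ⟨rfl, _⟩
    · exact h
    · exact (hi hx).elim
    · exact (hi hy).elim
  have htch : ∀ i j, w ∉ f i → w ∉ f j → K.Adj i j → Tch G (f i) (f j) := by
    intro i j hi hj hij
    obtain ⟨x, hx, y, hy, hxy⟩ := hf.tch i j hij
    refine ⟨x, hx, y, hy, ?_⟩
    rcases hA.2 x y hxy with h | ⟨rfl, _⟩ | ⟨rfl, _⟩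
    · exact h
    · exact (hi hx).elim
    · exact (hj hy).elim
  by_cases hwu : ∃ p, w ∈ f p
  · obtain ⟨p, hp⟩ := hwu
    have hnp : ∀ i, i ≠ p → w ∉ f i := fun i hi h => hi (hf.dj _ _ _ h hp)
    have hfp : f p = {w} := by
      by_contra hne
      have hN : ∀ y, G'.Adj w y → y = s ∨ y = a ∨ y = t := by
        intro y hy
        rcases hA.2 w y hy with h | h | ⟨rfl, _⟩
        · exact (hw _ h).elim
        · exact h.2
        · exact (hy.ne rfl).elim
      have hcl : ∀ p q, (p = s ∨ p = a ∨ p = t) → (q = s ∨ q = a ∨ q = t) → p = q ∨ G.Adj p q := by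
        have := sa.symm
        have := st.symm
        have := ta.symm
        rintro p q (rfl | rfl | rfl) (rfl | rfl | rfl) <;> tauto
      have hz : ∃ z ∈ f p, G'.Adj w z := by
        by_contra hcon
        push Not at hcon
        apply hne
        refine Set.Subset.antisymm ?_ (by simpa using hp)
        refine (hf.cn p).subset_of hp rfl ?_
        rintro y hy rfl x hx hyx
        exact (hcon x hx hyx).elim
      obtain ⟨z, hz, hwz⟩ := hz
      have hsd : Cn G' (f p \ {w}) := by
        refine (hf.cn p).sdiff ⟨z, hz, hwz.ne.symm⟩ ?_
        rintro x - y - - - ⟨_, -, rfl, h1⟩ ⟨_, -, rfl, h2⟩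
        rcases hcl x y (hN _ h1.symm) (hN _ h2.symm) with h | h
        · exact Or.inl h
        · exact Or.inr (hA.1 h)
      have hsd' : Cn G (f p \ {w}) := by
        refine hsd.mono fun x hx y hy hxy => ?_
        rcases hA.2 x y hxy with h | ⟨rfl, _⟩ | ⟨rfl, _⟩
        · exact h
        · exact (hx.2 rfl).elim
        · exact (hy.2 rfl).elim
      refine hno _ (Mod.shrink hsd' Set.diff_subset (fun i hi => hcn i (hnp i hi)) hf.dj
        (fun i j hi hj => htch i j (hnp i hi) (hnp j hj)) ?_)
      intro j hj
      have hjp : j ≠ p := hj.ne.symm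
      obtain ⟨x, hx, y, hy, hxy⟩ := hf.tch p j hj
      have hyw : y ≠ w := by rintro rfl; exact hnp j hjp hy
      by_cases hxw : x = w
      · subst hxw
        refine ⟨z, ⟨hz, hwz.ne.symm⟩, y, hy, ?_⟩
        rcases hcl z y (hN _ hwz) (hN _ hxy) with rfl | h
        · exact (hjp (hf.dj _ _ _ hy hz)).elim
        · exact h
      · refine ⟨x, ⟨hx, hxw⟩, y, hy, ?_⟩
        rcases hA.2 x y hxy with h | ⟨rfl, _⟩ | ⟨rfl, _⟩
        · exact h
        · exact (hxw rfl).elim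
        · exact (hyw rfl).elim
    refine ⟨p, hfp, ?_, fun i hi => hcn i (hnp i hi), fun i j hi hj => htch i j (hnp i hi) (hnp j hj)⟩
    intro j hj
    obtain ⟨x, hx, y, hy, hxy⟩ := hf.tch p j hj
    rw [hfp] at hx
    obtain rfl : x = w := hx
    rcases hA.2 x y hxy with h | ⟨_, h⟩ | ⟨rfl, _⟩
    · exact (hw _ h).elim
    · rcases h with rfl | rfl | rfl <;> tauto
    · exact (hxy.ne rfl).elim
  · push Not at hwu
    exact (hno f ⟨fun i => hcn i (hwu i), hf.dj, fun i j hij => htch i j (hwu i) (hwu j) hij⟩).elim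

theorem R23.rot {G : SimpleGraph V} {s a t : V} (h : R23 G s a t) : R23 G a s t := by
  obtain ⟨Z, P, Q, U, W, cZ, cP, cQ, cU, cW, hsZ, haP, htQ, zp, zq, pq, uz, up, uq, wz, wp, wq, uw,
    tuz, tup, tuq, twz, twp, twq⟩ := h
  exact ⟨P, Z, Q, U, W, cP, cZ, cQ, cU, cW, haP, hsZ, htQ, zp.symm, pq, zq, up, uz, uq, wp, wz, wq, uw,
    tup, tuz, tuq, twp, twz, twq⟩

theorem apex {G G' : SimpleGraph V} {w s a t : V} (hG : Pl G) (hA : Apx G G' w s a t)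
    (hw : ∀ v, ¬ G.Adj w v) (sa : G.Adj s a) (st : G.Adj s t) (ta : G.Adj a t)
    (hR : ¬ R23 G s a t) : Pl G' := by
  constructor
  · intro f hf
    obtain ⟨p, hp, hN, -, -⟩ := apex_generic hA hw sa st ta hf hG.1
    obtain ⟨i, j, k, l, h1, h2, h3, h4, n1, n2, n3, n4, n5, n6⟩ := four_more5 p
    have a1 := hN i h1
    have a2 := hN j h2
    have a3 := hN k h3
    have a4 := hN l h4
    have dj : ∀ i j x, i ≠ j → x ∈ f i → x ∈ f j → False := fun i j x h h1 h2 => h (hf.dj i j x h1 h2)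
    have d1 := fun x => dj i j x n1
    have d2 := fun x => dj i k x n2
    have d3 := fun x => dj i l x n3
    have d4 := fun x => dj j k x n4
    have d5 := fun x => dj j l x n5
    have d6 := fun x => dj k l x n6
    clear hN hf dj hp hR
    have e1 := d1 s; have e2 := d2 s; have e3 := d3 s; have e4 := d4 s; have e5 := d5 s; have e6 := d6 s
    have g1 := d1 a; have g2 := d2 a; have g3 := d3 a; have g4 := d4 a; have g5 := d5 a; have g6 := d6 a
    have k1 := d1 t; have k2 := d2 t; have k3 := d3 t; have k4 := d4 t; have k5 := d5 t; have k6 := d6 t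
    clear d1 d2 d3 d4 d5 d6
    grind
  · intro f hf
    obtain ⟨p, hp, hN, cn, tch⟩ := apex_generic hA hw sa st ta hf hG.2
    simp only [K33_r] at hN tch
    obtain ⟨i, j, k, n1, n2, n3, h1, h2, h3⟩ := opp33 p
    have dj : ∀ i j, i ≠ j → Disjoint (f i) (f j) := fun i j h => 
      Set.disjoint_left.2 fun x h1 h2 => h (hf.dj i j x h1 h2)
    have main : ∀ i j k, i ≠ j → i ≠ k → j ≠ k → p.isLeft ≠ i.isLeft →
      p.isLeft ≠ j.isLeft → p.isLeft ≠ k.isLeft → s ∈ f i → a ∈ f j → t ∈ f k → False := by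
      intro i j k n1 n2 n3 h1 h2 h3 m1 m2 m3
      obtain ⟨u, v, h4, h5, h6, h7, h8⟩ := two_more33 p
      have e : ∀ i j : Fin 3 ⊕ Fin 3, i.isLeft ≠ j.isLeft → i ≠ j := by rintro i _ h rfl; exact h rfl
      have i1 := (e _ _ h1).symm
      have i2 := (e _ _ h2).symm
      have i3 := (e _ _ h3).symm
      have u1 : u.isLeft ≠ i.isLeft := by rwa [h7]
      have u2 : u.isLeft ≠ j.isLeft := by rwa [h7]
      have u3 : u.isLeft ≠ k.isLeft := by rwa [h7]
      have v1 : v.isLeft ≠ i.isLeft := by rwa [h8]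
      have v2 : v.isLeft ≠ j.isLeft := by rwa [h8]
      have v3 : v.isLeft ≠ k.isLeft := by rwa [h8]
      exact hR ⟨f i, f j, f k, f u, f v, cn _ i1, cn _ i2, cn _ i3, cn _ h5, cn _ h6, m1, m2, m3,
        dj _ _ n1, dj _ _ n2, dj _ _ n3, dj _ _ (e _ _ u1), dj _ _ (e _ _ u2), dj _ _ (e _ _ u3),
        dj _ _ (e _ _ v1), dj _ _ (e _ _ v2), dj _ _ (e _ _ v3), dj _ _ h4, tch _ _ h5 i1 u1,
        tch _ _ h5 i2 u2, tch _ _ h5 i3 u3, tch _ _ h6 i1 v1, tch _ _ h6 i2 v2, tch _ _ h6 i3 v3⟩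
    have d1 := fun x => hf.dj i j x
    have d2 := fun x => hf.dj i k x
    have d3 := fun x => hf.dj j k x
    rcases hN i h1 with a1 | a1 | a1 <;> rcases hN j h2 with a2 | a2 | a2 <;> 
      rcases hN k h3 with a3 | a3 | a3 <;> first
      | exact n1 (d1 _ a1 a2)
      | exact n2 (d2 _ a1 a3)
      | exact n3 (d3 _ a2 a3)
      | exact main i j k n1 n2 n3 h1 h2 h3 a1 a2 a3
      | exact main i k j n2 n1 n3.symm h1 h3 h2 a1 a3 a2
      | exact main j i k n1.symm n3 n2 h2 h1 h3 a2 a1 a3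
      | exact main j k i n3 n1.symm n2.symm h2 h3 h1 a2 a3 a1
      | exact main k i j n2.symm n3.symm n1 h3 h1 h2 a3 a1 a2
      | exact main k j i n3.symm n2.symm n1.symm h3 h2 h1 a3 a2 a1

end Tri

namespace Tri
variable {V : Type} {W : Type}

theorem lemF {G G' : SimpleGraph V} {w s a t : V} {D : Set V} (hG : Pl G) (hA : Apx G G' w s a t)
    (hw : ∀ v, ¬ G.Adj w v) (sa : G.Adj s a) (st : G.Adj s t) (ta : G.Adj a t)
    (hD : PCn G D) (sD : s ∉ D) (aD : a ∉ D) (tD : t ∉ D)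
    (supp : ∀ u v, G.Adj u v → u ∈ D ∨ u = s ∨ u = a ∨ u = t) : Pl G' := by
  have hc : Cyc G (fun i => if i = 0 then s else if i = 1 then a else t) 2 D := by
    have h1 := sa.ne
    have h2 := st.ne
    have h3 := ta.ne
    refine ⟨le_rfl, ?_, ?_, by simpa using st, ?_, ?_, hD, ?_⟩
    · intro i hi j hj
      interval_cases i <;> interval_cases j <;> simp <;> tauto
    · intro i hi
      interval_cases i <;> simp <;> assumption
    · intro i j hi hj _
      omega
    · intro i hi
      interval_cases i <;> simp <;> assumption
    · intro u v huv
      rcases supp u v huv with h | rfl | rfl | rfl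
      · exact Or.inl h
      · exact Or.inr ⟨0, by omega, by simp⟩
      · exact Or.inr ⟨1, by omega, by simp⟩
      · exact Or.inr ⟨2, by omega, by simp⟩
  have := hc.noR23 hG
  simp at this
  exact apex hG hA hw sa st ta this

/-- restriction to a vertex set -/
def res (G : SimpleGraph V) (X : Set V) : SimpleGraph V where
  Adj u v := G.Adj u v ∧ u ∈ X ∧ v ∈ X
  symm := ⟨fun _ _ h => ⟨h.1.symm, h.2.2, h.2.1⟩⟩
  loopless := ⟨fun _ h => h.1.ne rfl⟩

theorem res_adj {G : SimpleGraph V} {X : Set V} {u v : V} : (res G X).Adj u v ↔ G.Adj u v ∧ u ∈ X ∧ v ∈ X := Iff.rfl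

/-- restriction to a vertex set plus a new vertex -/
def app (G : SimpleGraph V) (X : Set V) (w : V) (S : Set V) : SimpleGraph V where
  Adj u v := u ≠ v ∧ ((G.Adj u v ∧ u ∈ X ∧ v ∈ X) ∨ (u = w ∧ v ∈ S) ∨ (v = w ∧ u ∈ S))
  symm := ⟨fun _ _ h => ⟨h.1.symm, by have := h.2; rw [G.adj_comm] at this; tauto⟩⟩
  loopless := ⟨fun _ h => h.1 rfl⟩

theorem app_adj {G : SimpleGraph V} {X : Set V} {w : V} {S : Set V} {u v : V} : (app G X w S).Adj u v ↔
  u ≠ v ∧ ((G.Adj u v ∧ u ∈ X ∧ v ∈ X) ∨ (u = w ∧ v ∈ S) ∨ (v = w ∧ u ∈ S)) := Iff.rfl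

structure Sepn (G : SimpleGraph V) (A B S : Set V) : Prop where
  cov : ∀ u v, G.Adj u v → u ∈ A ∨ u ∈ B ∨ u ∈ S
  dj : ∀ x ∈ A, x ∉ B
  sA : ∀ x ∈ S, x ∉ A
  sB : ∀ x ∈ S, x ∉ B
  no : ∀ a ∈ A, ∀ b ∈ B, ¬ G.Adj a b
  cl : ∀ x ∈ S, ∀ y ∈ S, x ≠ y → G.Adj x y

theorem Sepn.symm {G : SimpleGraph V} {A B S : Set V} (h : Sepn G A B S) : Sepn G B A S :=
  ⟨fun u v huv => by have := h.cov u v huv; tauto, fun x h1 h2 => h.dj x h2 h1, h.sB, h.sA,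
    fun a ha b hb hab => h.no b hb a ha hab.symm, h.cl⟩

theorem Sepn.nb {G : SimpleGraph V} {A B S : Set V} (h : Sepn G A B S) {u v : V} (hu : u ∈ A)
    (huv : G.Adj u v) : v ∈ A ∨ v ∈ S := by
  rcases h.cov v u huv.symm with h1 | h1 | h1
  · exact Or.inl h1
  · exact (h.no u hu v h1 huv).elim
  · exact Or.inr h1

theorem Sepn.meet {G : SimpleGraph V} {A B S X : Set V} (h : Sepn G A B S) (hX : Cn G X) {u : V}
    (hu : u ∈ X) (huA : u ∈ A) (hn : ¬ X ⊆ A) : ∃ p ∈ X, p ∈ S := by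
  by_contra hcon
  push Not at hcon
  refine hn (hX.subset_of hu huA ?_)
  intro y hy hyA x hx hyx
  rcases h.nb hyA hyx with h1 | h1
  · exact h1
  · exact (hcon x hx h1).elim

theorem Sepn.cnd {G : SimpleGraph V} {A B S X : Set V} (h : Sepn G A B S) (hX : Cn G X)
    (hn : ¬ X ⊆ A) : Cn G (X \ A) := by
  refine hX.sdiff (Set.nonempty_of_not_subset hn) ?_
  rintro p - q - hp hq ⟨a, -, ha, hpa⟩ ⟨b, -, hb, hqb⟩
  by_cases hpq : p = q
  · exact Or.inl hpq
  · exact Or.inr (h.cl p ((h.nb ha hpa.symm).resolve_left hp) q ((h.nb hb hqb.symm).resolve_left hq) hpq)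

theorem Sepn.half {K : SimpleGraph W} {G : SimpleGraph V} {A B S : Set V} (h : Sepn G A B S) {f : W → Set V}
    (hf : Mod K G f) (hn : ∀ i, ¬ f i ⊆ A) : Mod K (res G Aᶜ) (fun i => f i \ A) := by
  refine ⟨fun i => (h.cnd (hf.cn i) (hn i)).mono fun x hx y hy hxy => ⟨hxy, hx.2, hy.2⟩,
    fun i j x hi hj => hf.dj i j x hi.1 hj.1, fun i j hij => ?_⟩
  have hne := hij.ne
  obtain ⟨x, hx, y, hy, hxy⟩ := hf.tch i j hij
  have go : ∀ p ∈ f i, ∀ q ∈ f j, p ∈ S → q ∈ S → Tch (res G Aᶜ) (f i \ A) (f j \ A) := by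
    intro p hp q hq hpS hqS
    refine ⟨p, ⟨hp, h.sA p hpS⟩, q, ⟨hq, h.sA q hqS⟩, h.cl p hpS q hqS ?_, h.sA p hpS, h.sA q hqS⟩
    rintro rfl
    exact hne (hf.dj _ _ _ hp hq)
  have m1 := fun hA => h.meet (hf.cn i) hx hA (hn i)
  have m2 := fun hA => h.meet (hf.cn j) hy hA (hn j)
  by_cases hxA : x ∈ A
  · obtain ⟨p, hp, hpS⟩ := m1 hxA
    rcases h.nb hxA hxy with h1 | h1
    · obtain ⟨q, hq, hqS⟩ := m2 h1
      exact go p hp q hq hpS hqS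
    · exact go p hp y hy hpS h1
  · by_cases hyA : y ∈ A
    · obtain ⟨q, hq, hqS⟩ := m2 hyA
      exact go x hx q hq ((h.nb hyA hxy.symm).resolve_left hxA) hqS
    · exact ⟨x, ⟨hx, hxA⟩, y, ⟨hy, hyA⟩, hxy, hxA, hyA⟩

theorem glue33 {G : SimpleGraph V} {A B S : Set V} (h : Sepn G A B S) {f : Fin 3 ⊕ Fin 3 → Set V}
    (hf : Mod K33 G f) {i j k : Fin 3 ⊕ Fin 3} (hij : i ≠ j) (hik : k ≠ i) (hjk : k ≠ j) (sij : i.isLeft = j.isLeft)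
    (sik : k.isLeft = i.isLeft) (hi : f i ⊆ A) (hj : f j ⊆ B) (hk : f k ⊆ A) : 
    ∃ w ∈ B, ¬ Pl (app G Bᶜ w S) := by
  obtain ⟨w, hw⟩ := (hf.cn j).1
  refine ⟨w, hj hw, fun hP => ?_⟩
  have nS : ∀ l, i.isLeft ≠ l.isLeft → ∃ p ∈ f l, p ∈ S := by
    intro l hl
    obtain ⟨x, hx, y, hy, hxy⟩ := hf.tch i l ((K33_r _ _).2 hl)
    obtain ⟨x', hx', y', hy', hxy'⟩ := hf.tch j l ((K33_r _ _).2 (by rwa [← sij]))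
    rcases h.nb (hi hx) hxy with h1 | h1
    · by_cases hy2 : f l ⊆ A
      · exact ⟨y', hy', (h.symm.nb (hj hx') hxy').resolve_left (h.dj _ (hy2 hy'))⟩
      · exact h.meet (hf.cn l) hy h1 hy2
    · exact ⟨y, hy, h1⟩
  obtain ⟨a, b, c, n1, n2, n3, h1, h2, h3⟩ := opp33 i
  have nB : ∀ l, i.isLeft ≠ l.isLeft → ¬ f l ⊆ B := by
    intro l hl hB
    obtain ⟨p, hp, hpS⟩ := nS l hl
    exact h.sB p hpS (hB hp)
  have c1 : ∀ l, i.isLeft ≠ l.isLeft → Cn (app G Bᶜ w S) (f l \ B) := fun l hl =>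
    (h.symm.cnd (hf.cn l) (nB l hl)).mono fun x hx y hy hxy => ⟨hxy.ne, Or.inl ⟨hxy, hx.2, hy.2⟩⟩
  have c2 : ∀ l, f l ⊆ A → Cn (app G Bᶜ w S) (f l) := fun l hl =>
    (hf.cn l).mono fun x hx y hy hxy => ⟨hxy.ne, Or.inl ⟨hxy, h.dj _ (hl hx), h.dj _ (hl hy)⟩⟩
  have dj : ∀ i j, i ≠ j → Disjoint (f i) (f j) := fun i j h => 
      Set.disjoint_left.2 fun x h1 h2 => h (hf.dj i j x h1 h2)
  have dw : ∀ l, l ≠ j → Disjoint {w} (f l) := fun l hl => (dj j l hl.symm).mono_left (by simpa using hw)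
  have t1 : ∀ m l, f m ⊆ A → m.isLeft ≠ l.isLeft → Tch (app G Bᶜ w S) (f m) (f l \ B) := by
    intro m l hm hl
    obtain ⟨x, hx, y, hy, hxy⟩ := hf.tch m l ((K33_r _ _).2 hl)
    have hyB : y ∉ B := fun hB => h.no x (hm hx) y hB hxy
    exact ⟨x, hx, y, ⟨hy, hyB⟩, hxy.ne, Or.inl ⟨hxy, h.dj _ (hm hx), hyB⟩⟩
  have t2 : ∀ l, i.isLeft ≠ l.isLeft → Tch (app G Bᶜ w S) {w} (f l \ B) := by
    intro l hl
    obtain ⟨p, hp, hpS⟩ := nS l hl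
    refine ⟨w, rfl, p, ⟨hp, h.sB p hpS⟩, ?_, Or.inr (Or.inl ⟨rfl, hpS⟩)⟩
    rintro rfl
    exact h.sB _ hpS (hj hw)
  have e : ∀ i j : Fin 3 ⊕ Fin 3, i.isLeft ≠ j.isLeft → i ≠ j := by rintro i _ h rfl; exact h rfl
  have djd : ∀ a b, a ≠ b → Disjoint (f a) (f b \ B) := fun a b h => (dj a b h).mono_right Set.diff_subset
  have dwd : ∀ b, b ≠ j → Disjoint {w} (f b \ B) := fun b h => (dw b h).mono_right Set.diff_subset
  have djdd : ∀ a b, a ≠ b → Disjoint (f a \ B) (f b \ B) := fun a b h => (djd a b h).mono_left Set.diff_subset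
  have k1 : k.isLeft ≠ a.isLeft := by rwa [sik]
  have k2 : k.isLeft ≠ b.isLeft := by rwa [sik]
  have k3 : k.isLeft ≠ c.isLeft := by rwa [sik]
  have j1 : j.isLeft ≠ a.isLeft := by rwa [← sij]
  have j2 : j.isLeft ≠ b.isLeft := by rwa [← sij]
  have j3 : j.isLeft ≠ c.isLeft := by rwa [← sij]
  exact no33 hP (c2 _ hi) (c2 _ hk) (cn_singleton _ w) (c1 _ h1) (c1 _ h2) (c1 _ h3)
    (dj _ _ hik.symm) (dw _ hij).symm (dw _ hjk).symm (djdd _ _ n1) (djdd _ _ n2) (djdd _ _ n3) 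
    (djd _ _ (e _ _ h1)) (djd _ _ (e _ _ h2)) (djd _ _ (e _ _ h3))
    (djd _ _ (e _ _ k1)) (djd _ _ (e _ _ k2)) (djd _ _ (e _ _ k3))
    (dwd _ (e _ _ j1).symm) (dwd _ (e _ _ j2).symm) (dwd _ (e _ _ j3).symm)
    (t1 _ _ hi h1) (t1 _ _ hi h2) (t1 _ _ hi h3) 
    (t1 _ _ hk k1) (t1 _ _ hk k2) (t1 _ _ hk k3) (t2 _ h1) (t2 _ h2) (t2 _ h3) 

theorem glue_gen {G : SimpleGraph V} {A B S : Set V} (h : Sepn G A B S)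
    (hA : Pl (res G Bᶜ)) (hB : Pl (res G Aᶜ))
    (h3 : ∀ p ∈ S, ∀ q ∈ S, ∀ r ∈ S, p ≠ q → p ≠ r → q ≠ r → (∀ v ∈ S, v = p ∨ v = q ∨ v = r) ∧
      (∀ w ∈ B, Pl (app G Bᶜ w S)) ∧ ∀ w ∈ A, Pl (app G Aᶜ w S)) : Pl G := by
  constructor
  · intro f hf
    have h1 : ∃ i, f i ⊆ A := by
      by_contra hcon
      push Not at hcon
      exact hB.1 _ (h.half hf hcon)
    have h2 : ∃ i, f i ⊆ B := by
      by_contra hcon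
      push Not at hcon
      exact hA.1 _ (h.symm.half hf hcon)
    obtain ⟨i, hi⟩ := h1
    obtain ⟨j, hj⟩ := h2
    have hij : i ≠ j := by
      rintro rfl
      obtain ⟨w, hw⟩ := (hf.cn i).1
      exact h.dj w (hi hw) (hj hw)
    obtain ⟨a, ha, b, hb, hab⟩ := hf.tch i j hij
    exact h.no a (hi ha) b (hj hb) hab
  · intro f hf
    have h1 : ∃ i, f i ⊆ A := by
      by_contra hcon
      push Not at hcon
      exact hB.2 _ (h.half hf hcon)
    have h2 : ∃ i, f i ⊆ B := by
      by_contra hcon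
      push Not at hcon
      exact hA.2 _ (h.symm.half hf hcon)
    obtain ⟨i, hi⟩ := h1
    obtain ⟨j, hj⟩ := h2
    have hij : i ≠ j := by
      rintro rfl
      obtain ⟨w, hw⟩ := (hf.cn i).1
      exact h.dj w (hi hw) (hj hw)
    have sij : i.isLeft = j.isLeft := by
      by_contra hne
      obtain ⟨a, ha, b, hb, hab⟩ := hf.tch i j ((K33_r _ _).2 hne)
      exact h.no a (hi ha) b (hj hb) hab
    have nS : ∀ l, i.isLeft ≠ l.isLeft → ∃ p ∈ f l, p ∈ S := by
      intro l hl
      obtain ⟨x, hx, y, hy, hxy⟩ := hf.tch i l ((K33_r _ _).2 hl)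
      obtain ⟨x', hx', y', hy', hxy'⟩ := hf.tch j l ((K33_r _ _).2 (by rwa [← sij]))
      rcases h.nb (hi hx) hxy with h1 | h1
      · by_cases hy2 : f l ⊆ A
        · exact ⟨y', hy', (h.symm.nb (hj hx') hxy').resolve_left (h.dj _ (hy2 hy'))⟩
        · exact h.meet (hf.cn l) hy h1 hy2
      · exact ⟨y, hy, h1⟩
    obtain ⟨a, b, c, n1, n2, n3, h1, h2, h3'⟩ := opp33 i
    obtain ⟨p, hp, hpS⟩ := nS a h1
    obtain ⟨q, hq, hqS⟩ := nS b h2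
    obtain ⟨r, hr, hrS⟩ := nS c h3'
    have pq : p ≠ q := by rintro rfl; exact n1 (hf.dj _ _ _ hp hq)
    have pr : p ≠ r := by rintro rfl; exact n2 (hf.dj _ _ _ hp hr)
    have qr : q ≠ r := by rintro rfl; exact n3 (hf.dj _ _ _ hq hr)
    obtain ⟨hS, hA', hB'⟩ := h3 p hpS q hqS r hrS pq pr qr
    obtain ⟨k, hki, hkj, hks⟩ := one_more33 i j sij
    have e : ∀ i j : Fin 3 ⊕ Fin 3, i.isLeft ≠ j.isLeft → i ≠ j := by rintro i _ h rfl; exact h rfl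
    have kS : ∀ v ∈ f k, v ∉ S := by
      intro v hv hvS
      rcases hS v hvS with rfl | rfl | rfl
      · exact h1 (hks ▸ congrArg Sum.isLeft (hf.dj _ _ _ hv hp))
      · exact h2 (hks ▸ congrArg Sum.isLeft (hf.dj _ _ _ hv hq))
      · exact h3' (hks ▸ congrArg Sum.isLeft (hf.dj _ _ _ hv hr))
    have kAB : f k ⊆ A ∨ f k ⊆ B := by
      obtain ⟨u, hu, v, hv, huv⟩ := hf.tch k a ((K33_r _ _).2 (by rwa [hks]))
      rcases h.cov u v huv with h5 | h5 | h5
      · left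
        by_contra hcon
        obtain ⟨s, hs, hsS⟩ := h.meet (hf.cn k) hu h5 hcon
        exact kS s hs hsS
      · right
        by_contra hcon
        obtain ⟨s, hs, hsS⟩ := h.symm.meet (hf.cn k) hu h5 hcon
        exact kS s hs hsS
      · exact (kS u hu h5).elim
    rcases kAB with hk | hk
    · obtain ⟨w, hw, hP⟩ := glue33 h hf hij hki hkj sij hks hi hj hk
      exact hP (hA' w hw)
    · obtain ⟨w, hw, hP⟩ := glue33 h.symm hf hij.symm hkj hki sij.symm (hks.trans sij) hj hi hk
      exact hP (hB' w hw)

theorem glue2 {G : SimpleGraph V} {A B S : Set V} (h : Sepn G A B S)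
    (hA : Pl (res G Bᶜ)) (hB : Pl (res G Aᶜ))
    (h2 : ∃ x y, ∀ p ∈ S, p = x ∨ p = y) : Pl G := by
  refine glue_gen h hA hB ?_
  obtain ⟨x, y, h2⟩ := h2
  intro p hp q hq r hr pq pr qr
  have := h2 p hp
  have := h2 q hq
  have := h2 r hr
  exfalso
  clear h2 h hA hB
  grind

theorem glue3 {G : SimpleGraph V} {A B : Set V} {x y z : V} (h : Sepn G A B {x, y, z})
    (hA : Pl (res G Bᶜ)) (hB : Pl (res G Aᶜ))
    (hA' : ∀ w ∈ B, Pl (app G Bᶜ w {x, y, z}))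
    (hB' : ∀ w ∈ A, Pl (app G Aᶜ w {x, y, z})) : Pl G := by
  refine glue_gen h hA hB fun p hp q hq r hr pq pr qr => ⟨?_, hA', hB'⟩
  simp only [Set.mem_insert_iff, Set.mem_singleton_iff] at hp hq hr ⊢
  clear * - hp hq hr pq pr qr
  intro v hv
  grind

end Tri

namespace Tri
variable {V : Type} {W : Type}

/-- if the branch set of `w` contains `s` then the edge `st` is not needed -/
theorem yl_caseB {K : SimpleGraph W} {G G' : SimpleGraph V} {w s t : V} (hP : Plus G G' s t)
    (ws : G.Adj w s) (wt : G.Adj w t) {f : W → Set V} (hf : Mod K G' f) {r : W} (hw : w ∈ f r) (hs : s ∈ f r) :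
    Mod K G f := by
  refine ⟨fun i => ?_, hf.dj, fun i j hij => ?_⟩
  · by_cases hi : i = r
    · subst hi; exact hP.cn3 (hf.cn i) hw ws wt
    · exact hP.cn (hf.cn i) fun h => hi (hf.dj _ _ _ h.1 hs)
  · obtain ⟨x, hx, y, hy, hxy⟩ := hf.tch i j hij
    rcases hP.2 x y hxy with h | ⟨rfl, rfl⟩ | ⟨rfl, rfl⟩
    · exact ⟨x, hx, y, hy, h⟩
    · obtain rfl := hf.dj _ _ _ hx hs
      exact ⟨w, hw, y, hy, wt⟩
    · obtain rfl := hf.dj _ _ _ hy hs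
      exact ⟨x, hx, w, hw, wt.symm⟩

theorem yl_generic [DecidableEq W] {K : SimpleGraph W} {G G' : SimpleGraph V} {w s t : V} (hP : Plus G G' s t)
    (ws : G.Adj w s) (wt : G.Adj w t) {f : W → Set V} (hf : Mod K G' f) (hno : ∀ f, ¬ Mod K G f) :
    ∃ r p q, w ∈ f r ∧ s ∈ f p ∧ t ∈ f q ∧ r ≠ p ∧ r ≠ q ∧ (p ≠ q → K.Adj p q) := by
  have use : (∃ p, s ∈ f p) ∧ ∃ q, t ∈ f q := by
    by_contra hcon
    have hcon : (∀ p, s ∉ f p) ∨ ∀ q, t ∉ f q := by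
      by_cases h : ∃ p, s ∈ f p
      · right; intro q hq; exact hcon ⟨h, q, hq⟩
      · left; push Not at h; exact h
    refine hno f ⟨fun i => hP.cn (hf.cn i) ?_, hf.dj, fun i j hij => hP.tch (hf.tch i j hij) ?_ ?_⟩ <;> grind
  obtain ⟨⟨p, hp⟩, q, hq⟩ := use
  have hwu : ∃ r, w ∈ f r := by
    by_contra hcon
    push Not at hcon
    have h1 := hf.addv hcon hp (hP.1 ws)
    exact hno _ (yl_caseB hP ws wt h1 (r := p) (by simp) (by simp [hp]))
  obtain ⟨r, hr⟩ := hwu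
  refine ⟨r, p, q, hr, hp, hq, ?_, ?_, ?_⟩
  · rintro rfl
    exact hno _ (yl_caseB hP ws wt hf hr hp)
  · rintro rfl
    exact hno _ (yl_caseB hP.swap wt ws hf hr hq)
  · intro hpq
    by_contra hK
    refine hno f ⟨fun i => hP.cn (hf.cn i) ?_, hf.dj, fun i j hij => hP.tch (hf.tch i j hij) ?_ ?_⟩
    · rintro ⟨h1, h2⟩
      exact hpq ((hf.dj _ _ _ hp h1).trans (hf.dj _ _ _ h2 hq))
    · rintro ⟨h1, h2⟩
      rw [hf.dj _ _ _ h1 hp, hf.dj _ _ _ h2 hq] at hij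
      exact hK hij
    · rintro ⟨h1, h2⟩
      rw [hf.dj _ _ _ h1 hq, hf.dj _ _ _ h2 hp] at hij
      exact hK hij.symm

theorem yl_rest {K : SimpleGraph W} {G G' : SimpleGraph V} {w s t u : V} (hP : Plus G G' s t)
    (hw : ∀ v, G.Adj w v → v = s ∨ v = t ∨ v = u) (ws : G.Adj w s) (wt : G.Adj w t) 
    {f : W → Set V} (hf : Mod K G' f)
    {r : W} (hr : w ∈ f r) (sr : s ∉ f r) (tr : t ∉ f r) (hne : f r ≠ {w}) :
    u ∈ f r ∧ u ≠ w ∧ G.Adj w u ∧ Cn G' (f r \ {w}) := by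
  have ews : w ≠ s := ws.ne
  have ewt : w ≠ t := wt.ne
  have hw' : ∀ v, G'.Adj w v → v = s ∨ v = t ∨ v = u := by
    intro v hv
    rcases hP.2 _ _ hv with h | h | h
    · exact hw v h
    · exact (ews h.1).elim
    · exact (ewt h.1).elim
  have hz : ∃ z ∈ f r, G'.Adj w z := by
    by_contra hcon
    push Not at hcon
    apply hne
    refine Set.Subset.antisymm ?_ (by simpa using hr)
    refine (hf.cn r).subset_of hr rfl ?_
    rintro y hy rfl x hx hyx
    exact (hcon x hx hyx).elim
  obtain ⟨z, hz, hwz⟩ := hz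
  have hzu : z = u := by
    rcases hw' z hwz with rfl | rfl | h
    · exact (sr hz).elim
    · exact (tr hz).elim
    · exact h
  subst hzu
  refine ⟨hz, hwz.ne.symm, ?_, (hf.cn r).sdiff ⟨z, hz, hwz.ne.symm⟩ ?_⟩
  · rcases hP.2 _ _ hwz with h | h | h
    · exact h
    · exact (ews h.1).elim
    · exact (ewt h.1).elim
  · rintro x hx y hy - - ⟨_, -, rfl, h1⟩ ⟨_, -, rfl, h2⟩
    left
    rcases hw' _ h1.symm with rfl | rfl | rfl
    · exact (sr hx).elim
    · exact (tr hx).elim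
    rcases hw' _ h2.symm with rfl | rfl | h
    · exact (sr hy).elim
    · exact (tr hy).elim
    · exact h.symm

/-- move `w` to the set of `s` -/
theorem yl_move [DecidableEq W] {K : SimpleGraph W} {G G' : SimpleGraph V} {w s t u : V} (hP : Plus G G' s t)
    (hw : ∀ v, G.Adj w v → v = s ∨ v = t ∨ v = u) (ws : G.Adj w s) (wt : G.Adj w t) 
    {f : W → Set V} (hf : Mod K G' f)
    {r p : W} (hr : w ∈ f r) (sr : s ∉ f r) (tr : t ∉ f r) (hne : f r ≠ {w}) (hp : s ∈ f p)
    (hj : ∀ j, j ≠ p → K.Adj r j → t ∉ f j) : ∃ f, Mod K G f := by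
  obtain ⟨hu, huw, wu, cn⟩ := yl_rest hP hw ws wt hf hr sr tr hne
  have hrp : r ≠ p := by rintro rfl; exact sr hp
  have ews : w ≠ s := ws.ne
  have ewt : w ≠ t := wt.ne
  have hw' : ∀ v, G'.Adj w v → v = s ∨ v = t ∨ v = u := by
    intro v hv
    rcases hP.2 _ _ hv with h | h | h
    · exact hw v h
    · exact (ews h.1).elim
    · exact (ewt h.1).elim
  let g : W → Set V := fun i => if i = p then insert w (f p) else if i = r then f r \ {w} else f i
  have gp : g p = insert w (f p) := by simp [g]
  have gr : g r = f r \ {w} := by simp [g, hrp]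
  have go : ∀ i, i ≠ p → i ≠ r → g i = f i := by intro i h1 h2; simp [g, h1, h2]
  have hmem : ∀ i x, x ∈ g i → x ≠ w → x ∈ f i := by
    intro i x hx hxw
    by_cases h1 : i = p
    · subst h1; rw [gp] at hx; exact hx.resolve_left hxw
    by_cases h2 : i = r
    · subst h2; rw [gr] at hx; exact hx.1
    rwa [go i h1 h2] at hx
  have hmem' : ∀ i x, x ∈ f i → x ≠ w → x ∈ g i := by
    intro i x hx hxw
    by_cases h1 : i = p
    · subst h1; rw [gp]; exact Or.inr hx
    by_cases h2 : i = r
    · subst h2; rw [gr]; exact ⟨hx, hxw⟩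
    rwa [go i h1 h2]
  have hwg : ∀ i, w ∈ g i → i = p := by
    intro i hi
    by_contra h1
    by_cases h2 : i = r
    · subst h2; rw [gr] at hi; exact hi.2 rfl
    rw [go i h1 h2] at hi
    exact h2 (hf.dj _ _ _ hi hr)
  have hwp : w ∈ g p := by rw [gp]; exact Or.inl rfl
  refine ⟨g, yl_caseB hP ws wt ?_ hwp (hmem' p s hp ews.symm)⟩
  have key : ∀ i j, K.Adj i j → ∀ x ∈ f i, ∀ y ∈ f j, G'.Adj x y → x = w → Tch G' (g i) (g j) := by
    rintro i j hij x hx y hy hxy rfl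
    obtain rfl := hf.dj _ _ _ hx hr
    have hyr : y ∉ f i := fun h => hij.ne (hf.dj _ _ _ h hy)
    by_cases hjp : j = p
    · subst hjp
      exact ⟨u, hmem' _ _ hu huw, x, hwp, hP.1 wu.symm⟩
    · rcases hw' y hxy with rfl | rfl | rfl
      · exact (hjp (hf.dj _ _ _ hy hp)).elim
      · exact (hj j hjp hij hy).elim
      · exact (hyr hu).elim
  refine ⟨fun i => ?_, fun i j x hi hj => ?_, fun i j hij => ?_⟩
  · by_cases h1 : i = p
    · subst h1; rw [gp]; exact (hf.cn i).insert hp (hP.1 ws)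
    by_cases h2 : i = r
    · subst h2; rw [gr]; exact cn
    rw [go i h1 h2]; exact hf.cn i
  · by_cases hxw : x = w
    · subst hxw
      rw [hwg i hi, hwg j hj]
    · exact hf.dj _ _ _ (hmem i x hi hxw) (hmem j x hj hxw)
  · obtain ⟨x, hx, y, hy, hxy⟩ := hf.tch i j hij
    by_cases hxw : x = w
    · exact key i j hij x hx y hy hxy hxw
    by_cases hyw : y = w
    · exact (key j i hij.symm y hy x hx hxy.symm hyw).symm
    exact ⟨x, hmem' _ _ hx hxw, y, hmem' _ _ hy hyw, hxy⟩

theorem ylemma {G G' : SimpleGraph V} {w s t u : V} (hG : Pl G) (hP : Plus G G' s t)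
    (hw : ∀ v, G.Adj w v → v = s ∨ v = t ∨ v = u) (ws : G.Adj w s) (wt : G.Adj w t) : Pl G' := by
  have ews : w ≠ s := ws.ne
  have ewt : w ≠ t := wt.ne
  have hw' : ∀ v, G'.Adj w v → v = s ∨ v = t ∨ v = u := by
    intro v hv
    rcases hP.2 _ _ hv with h | h | h
    · exact hw v h
    · exact (ews h.1).elim
    · exact (ewt h.1).elim
  constructor
  · intro f hf
    obtain ⟨r, p, q, hr, hp, hq, rp, rq, hK⟩ := yl_generic hP ws wt hf hG.1
    have sr : s ∉ f r := fun h => rp (hf.dj _ _ _ h hp)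
    have tr : t ∉ f r := fun h => rq (hf.dj _ _ _ h hq)
    have hne : f r ≠ {w} := by
      intro hfr
      have hN : ∀ j, r ≠ j → s ∈ f j ∨ t ∈ f j ∨ u ∈ f j := by
        intro j hj
        obtain ⟨x, hx, y, hy, hxy⟩ := hf.tch r j hj
        rw [hfr] at hx
        obtain rfl : x = w := hx
        rcases hw' y hxy with rfl | rfl | rfl <;> tauto
      obtain ⟨i, j, k, l, h1, h2, h3, h4, n1, n2, n3, n4, n5, n6⟩ := four_more5 r
      have a1 := hN i h1
      have a2 := hN j h2
      have a3 := hN k h3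
      have a4 := hN l h4
      have dj : ∀ i j x, i ≠ j → x ∈ f i → x ∈ f j → False := fun i j x h h1 h2 => h (hf.dj i j x h1 h2)
      have d1 := fun x => dj i j x n1
      have d2 := fun x => dj i k x n2
      have d3 := fun x => dj i l x n3
      have d4 := fun x => dj j k x n4
      have d5 := fun x => dj j l x n5
      have d6 := fun x => dj k l x n6
      clear hN hf dj hp
      have e1 := d1 s; have e2 := d2 s; have e3 := d3 s; have e4 := d4 s; have e5 := d5 s; have e6 := d6 s
      have g1 := d1 t; have g2 := d2 t; have g3 := d3 t; have g4 := d4 t; have g5 := d5 t; have g6 := d6 t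
      have k1 := d1 u; have k2 := d2 u; have k3 := d3 u; have k4 := d4 u; have k5 := d5 u; have k6 := d6 u
      clear d1 d2 d3 d4 d5 d6 hw hw' hP hG
      grind
    by_cases hpq : p = q
    · subst hpq
      obtain ⟨g, hg⟩ := yl_move hP hw ws wt hf hr sr tr hne hp
        (fun j hj _ h => hj (hf.dj _ _ _ h hq))
      exact hG.1 g hg
    · obtain ⟨hu, huw, wu, cn⟩ := yl_rest hP hw ws wt hf hr sr tr hne
      obtain ⟨i, j, n1, n2, n3, n4, n5, n6, n7⟩ := two_more5 p q r hpq rp rq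
      have cg : ∀ i, Cn G (f i) := fun i => hP.cn (hf.cn i) fun h => 
        hpq ((hf.dj _ _ _ hp h.1).trans (hf.dj _ _ _ h.2 hq))
      have cn' : Cn G (f r \ {w}) := hP.cn cn fun h => sr h.1.1
      have dj : ∀ i j, i ≠ j → Disjoint (f i) (f j) := fun i j h => 
        Set.disjoint_left.2 fun x h1 h2 => h (hf.dj i j x h1 h2)
      have djr : ∀ i, r ≠ i → Disjoint (f r \ {w}) (f i) := fun i h => (dj r i h).mono_left Set.diff_subset
      have dw : ∀ i, i ≠ r → Disjoint (f i) {w} := fun i h => (dj i r h).mono_right (by simpa using hr)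
      have dwr : Disjoint (f r \ {w}) {w} := Set.disjoint_sdiff_left
      have tg : ∀ a b, a ≠ b → b ≠ p → b ≠ q → Tch G (f a) (f b) := by
        intro a b hab hbp hbq
        refine hP.tch (hf.tch a b hab) ?_ ?_
        · rintro ⟨h1, h2⟩; exact hbq (hf.dj _ _ _ h2 hq)
        · rintro ⟨h1, h2⟩; exact hbp (hf.dj _ _ _ h2 hp)
      have tr' : ∀ b, r ≠ b → b ≠ p → b ≠ q → Tch G (f r \ {w}) (f b) := by
        intro b hb hbp hbq
        obtain ⟨x, hx, y, hy, hxy⟩ := tg r b hb hbp hbq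
        refine ⟨x, ⟨hx, ?_⟩, y, hy, hxy⟩
        rintro rfl
        rcases hw y hxy with rfl | rfl | rfl
        · exact hbp (hf.dj _ _ _ hy hp)
        · exact hbq (hf.dj _ _ _ hy hq)
        · exact hb (hf.dj _ _ _ hu hy)
      exact no33 hG (cg p) (cg q) cn' (cg i) (cg j) (cn_singleton G w) (dj _ _ hpq) (djr _ rp).symm (djr _ rq).symm
        (dj _ _ n1) (dw _ n4) (dw _ n7) (dj _ _ n2.symm) (dj _ _ n5.symm) (dw _ rp.symm)
        (dj _ _ n3.symm) (dj _ _ n6.symm) (dw _ rq.symm) (djr _ n4.symm) (djr _ n7.symm) dwr 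
        (tg _ _ n2.symm n2 n3) (tg _ _ n5.symm n5 n6) ⟨s, hp, w, rfl, ws.symm⟩
        (tg _ _ n3.symm n2 n3) (tg _ _ n6.symm n5 n6) ⟨t, hq, w, rfl, wt.symm⟩
        (tr' _ n4.symm n2 n3) (tr' _ n7.symm n5 n6) ⟨u, ⟨hu, huw⟩, w, rfl, wu.symm⟩
  · intro f hf
    obtain ⟨r, p, q, hr, hp, hq, rp, rq, hK⟩ := yl_generic hP ws wt hf hG.2
    simp only [K33_r] at hK
    have sr : s ∉ f r := fun h => rp (hf.dj _ _ _ h hp)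
    have tr : t ∉ f r := fun h => rq (hf.dj _ _ _ h hq)
    have hne : f r ≠ {w} := by
      intro hfr
      have hN : ∀ j, r.isLeft ≠ j.isLeft → j = p ∨ j = q ∨ u ∈ f j := by
        intro j hj
        obtain ⟨x, hx, y, hy, hxy⟩ := hf.tch r j ((K33_r _ _).2 hj)
        rw [hfr] at hx
        obtain rfl : x = w := hx
        rcases hw' y hxy with rfl | rfl | rfl
        · exact Or.inl (hf.dj _ _ _ hy hp)
        · exact Or.inr (Or.inl (hf.dj _ _ _ hy hq))
        · exact Or.inr (Or.inr hy)
      obtain ⟨i, j, k, n1, n2, n3, h1, h2, h3⟩ := opp33 r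
      have a1 := hN i h1
      have a2 := hN j h2
      have a3 := hN k h3
      have d1 := hf.dj i j u
      have d2 := hf.dj i k u
      have d3 := hf.dj j k u
      clear hN hf hP hG hw' hw
      grind
    by_cases hpq : p = q
    · subst hpq
      obtain ⟨g, hg⟩ := yl_move hP hw ws wt hf hr sr tr hne hp
        (fun j hj _ h => hj (hf.dj _ _ _ h hq))
      exact hG.2 g hg
    · by_cases hrq : r.isLeft = q.isLeft
      · obtain ⟨g, hg⟩ := yl_move hP hw ws wt hf hr sr tr hne hp (by
          intro j hj hrj h
          rw [hf.dj _ _ _ h hq] at hrj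
          exact (K33_r _ _).1 hrj hrq)
        exact hG.2 g hg
      · have hrp : r.isLeft = p.isLeft := by have := hK hpq; grind
        obtain ⟨g, hg⟩ := yl_move (u := u) hP.swap (fun v hv => by have := hw v hv; tauto) wt ws hf hr tr sr hne hq (by
          intro j hj hrj h
          rw [hf.dj _ _ _ h hp] at hrj
          exact (K33_r _ _).1 hrj hrp)
        exact hG.2 g hg

end Tri

namespace Tri
variable {V : Type} {W : Type}

def Sep3 (G : SimpleGraph V) (X : Set V) : Prop :=
  ∀ Y : Set V, Y ⊆ X → Y.Nonempty → ∀ u v, u ∉ Y → v ∉ Y →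
    (∀ y ∈ Y, ∀ x ∈ X, G.Adj y x → x ∈ Y ∨ x = u ∨ x = v) → ∀ z ∈ X, z ∈ Y ∨ z = u ∨ z = v

structure Pth (G : SimpleGraph V) (s t : V) (c : ℕ → V) (k : ℕ) : Prop where
  hk : 2 ≤ k
  inj : ∀ i ≤ k, ∀ j ≤ k, c i = c j → i = j
  adj : ∀ i < k, G.Adj (c i) (c (i + 1))
  c0 : c 0 = s
  ck : c k = t

theorem path_of {H : SimpleGraph V} {P : Set V} (hP : Cn H P) {s t : V} (hs : s ∈ P) (ht : t ∈ P) :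
    ∃ (c : ℕ → V) (k : ℕ), (∀ i ≤ k, ∀ j ≤ k, c i = c j → i = j) ∧ (∀ i < k, H.Adj (c i) (c (i + 1))) ∧
      c 0 = s ∧ c k = t ∧ ∀ i, c i ∈ P := by
  classical
  rw [cn_iff] at hP
  obtain ⟨w, hw⟩ := (hP.preconnected ⟨s, hs⟩ ⟨t, ht⟩).exists_isPath
  refine ⟨fun i => (w.getVert i : P), w.length, ?_, ?_, ?_, ?_, ?_⟩
  · intro i hi j hj hij
    exact hw.getVert_injOn hi hj (Subtype.ext hij)
  · intro i hi
    have := w.adj_getVert_succ hi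
    simpa using this
  · simp
  · simp
  · intro i
    exact Subtype.property _

/-- remove the edge `st` -/
def del (G : SimpleGraph V) (s t : V) : SimpleGraph V where
  Adj u v := G.Adj u v ∧ ¬ (u = s ∧ v = t) ∧ ¬ (u = t ∧ v = s)
  symm := ⟨fun _ _ h => ⟨h.1.symm, by tauto, by tauto⟩⟩
  loopless := ⟨fun _ h => h.1.ne rfl⟩

theorem pth_of {G : SimpleGraph V} {P : Set V} {s t : V} (hP : Cn (del G s t) P) (hs : s ∈ P) (ht : t ∈ P)
    (hst : s ≠ t) : ∃ c k, Pth G s t c k ∧ ∀ i, c i ∈ P := by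
  obtain ⟨c, k, h1, h2, h3, h4, h5⟩ := path_of hP hs ht
  refine ⟨c, k, ⟨?_, h1, fun i hi => (h2 i hi).1, h3, h4⟩, h5⟩
  by_contra hk
  have : k = 0 ∨ k = 1 := by omega
  rcases this with rfl | rfl
  · exact hst (h3.symm.trans h4)
  · exact (h2 0 (by omega)).2.1 ⟨h3, h4⟩

theorem Pth.mem {G : SimpleGraph V} {X : Set V} (hX : Supp G X) {s t : V} {c : ℕ → V} {k : ℕ} (h : Pth G s t c k)
    {i : ℕ} (hi : i ≤ k) : c i ∈ X := by
  have := h.hk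
  by_cases h1 : i = k
  · have := h.adj (k - 1) (by omega)
    rw [show k - 1 + 1 = i by omega] at this
    exact hX _ _ this.symm
  · exact hX _ _ (h.adj i (by omega))

theorem pth_ex [Finite V] {G : SimpleGraph V} {X : Set V} (hX : Supp G X) (hS : Sep3 G X) (hc : 3 ≤ X.ncard)
    {s t : V} (st : G.Adj s t) : ∃ c k, Pth G s t c k := by
  have hs := hX _ _ st
  have ht := hX _ _ st.symm
  suffices h : t ∈ comp (del G s t) X s by
    obtain ⟨c, k, h, -⟩ := pth_of (cn_comp hs) (mem_comp_self _ _ _) h st.ne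
    exact ⟨c, k, h⟩
  by_contra hcon
  have hsub := comp_subset (G := del G s t) hs
  by_cases hne : (comp (del G s t) X s \ {s}).Nonempty
  · have := hS _ (Set.diff_subset.trans hsub) hne s s (by simp) (by simp) (by
      rintro y ⟨hy, hys⟩ x hx hyx
      by_cases hxs : x = s
      · exact Or.inr (Or.inl hxs)
      refine Or.inl ⟨comp_closed hs hy hx ⟨hyx, fun h => hys h.1, fun h => ?_⟩, hxs⟩
      exact hcon (h.1 ▸ hy)) t ht
    rcases this with h | h | h
    · exact hcon h.1
    · exact st.ne h.symm
    · exact st.ne h.symm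
  · rw [Set.not_nonempty_iff_eq_empty, Set.diff_eq_empty] at hne
    have := hS {s} (by simpa using hs) ⟨s, rfl⟩ t t (by simpa using st.ne.symm) (by simpa using st.ne.symm) (by
      rintro y rfl x hx hyx
      by_cases hxt : x = t
      · exact Or.inr (Or.inl hxt)
      have := hne (comp_closed hs (mem_comp_self _ _ _) hx (⟨hyx, fun h => hxt h.2, fun h => st.ne h.1⟩ : (del G y t).Adj y x))
      exact (hyx.ne (Eq.symm this)).elim)
    have h2 : X ⊆ {s, t} := by
      intro z hz
      have := this z hz
      simp at this ⊢
      tauto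
    have h3 := Set.ncard_le_ncard h2
    have h4 := Set.ncard_pair st.ne
    omega

theorem Pth.short {G : SimpleGraph V} {s t : V} {c : ℕ → V} {k : ℕ} (h : Pth G s t c k) {i j : ℕ} (hij : i + 1 < j)
    (hj : j ≤ k) (hne : ¬ (i = 0 ∧ j = k)) (ha : G.Adj (c i) (c j)) :
    ∃ c' k', k' < k ∧ Pth G s t c' k' ∧ ∀ m ≤ k', ∃ l ≤ k, c' m = c l := by
  have hk := h.hk
  refine ⟨fun m => if m ≤ i then c m else c (m + (j - i - 1)), k - (j - i - 1), by omega,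
    ⟨by omega, ?_, ?_, ?_, ?_⟩, ?_⟩
  · intro a ha b hb hab
    split_ifs at hab with h1 h2 h2
    · exact h.inj _ (by omega) _ (by omega) hab
    · have := h.inj _ (by omega) _ (by omega) hab
      omega
    · have := h.inj _ (by omega) _ (by omega) hab
      omega
    · have := h.inj _ (by omega) _ (by omega) hab
      omega
  · intro a ha'
    split_ifs with h1 h2 h2
    · exact h.adj _ (by omega)
    · have e : a = i := by omega
      subst e
      rw [show a + 1 + (j - a - 1) = j by omega]
      exact ha
    · omega
    · rw [show a + 1 + (j - i - 1) = a + (j - i - 1) + 1 by omega]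
      exact h.adj _ (by omega)
  · simp [h.c0]
  · have : ¬ k - (j - i - 1) ≤ i := by omega
    simp only [this, if_false]
    rw [show k - (j - i - 1) + (j - i - 1) = k by omega]
    exact h.ck
  · intro m hm
    simp only
    split_ifs
    · exact ⟨m, by omega, rfl⟩
    · exact ⟨m + (j - i - 1), by omega, rfl⟩

theorem exists_max {P : ℕ → Prop} {b : ℕ} (h : ∃ n, P n) (hb : ∀ n, P n → n ≤ b) :
    ∃ n, P n ∧ ∀ m, P m → m ≤ n := by
  classical
  obtain ⟨n, hn⟩ := h
  exact ⟨Nat.findGreatest P b, Nat.findGreatest_spec (hb n hn) hn, fun m hm => Nat.le_findGreatest (hb m hm) hm⟩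

/-- the optimal choice -/
theorem tutte_opt [Finite V] {G : SimpleGraph V} {X : Set V} (hX : Supp G X) (hS : Sep3 G X) (hc : 3 ≤ X.ncard)
    {s t : V} (st : G.Adj s t) : ∃ c k D, Pth G s t c k ∧ D ⊆ X ∧ PCn G D ∧ (∀ i ≤ k, c i ∉ D) ∧
      (∀ i j, i < j → j ≤ k → G.Adj (c i) (c j) → j = i + 1 ∨ (i = 0 ∧ j = k)) ∧
      ∀ c' k' D', Pth G s t c' k' → D' ⊆ X → PCn G D' → (∀ i ≤ k', c' i ∉ D') → D'.ncard ≤ D.ncard := by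
  classical
  obtain ⟨c0, k0, h0⟩ := pth_ex hX hS hc st
  obtain ⟨n, ⟨c1, k1, D, p1, p2, p3, p4, p5⟩, hmax⟩ := exists_max
    (P := fun n => ∃ c k D, Pth G s t c k ∧ D ⊆ X ∧ PCn G D ∧ (∀ i ≤ k, c i ∉ D) ∧ D.ncard = n)
    (b := X.ncard) ⟨0, c0, k0, ∅, h0, by simp, by rintro Y ⟨y, hy, _⟩; exact hy.elim, by simp, by simp⟩ (by
      rintro _ ⟨c, k, D, -, h, -, -, rfl⟩
      exact Set.ncard_le_ncard h)
  have hex : ∃ k c, Pth G s t c k ∧ (∀ i ≤ k, c i ∉ D) := ⟨k1, c1, p1, p4⟩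
  obtain ⟨c, q1, q2⟩ := Nat.find_spec hex
  refine ⟨c, Nat.find hex, D, q1, p2, p3, q2, ?_, ?_⟩
  · intro i j hij hj ha
    by_contra hcon
    push Not at hcon
    obtain ⟨c', k', hk', hp, hl⟩ := q1.short (i := i) (j := j) (by omega) hj (by tauto) ha
    refine Nat.find_min hex hk' ⟨c', hp, fun m hm => ?_⟩
    obtain ⟨l, hl, e⟩ := hl m hm
    rw [e]
    exact q2 l hl
  · intro c' k' D' h1 h2 h3 h4
    rw [p5]
    exact hmax _ ⟨c', k', D', h1, h2, h3, h4, rfl⟩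

theorem tutte [Finite V] {G : SimpleGraph V} {X : Set V} (hX : Supp G X) (hS : Sep3 G X) (hc : 3 ≤ X.ncard)
    {s t : V} (st : G.Adj s t) : ∃ c k D, Cyc G c k D ∧ c 0 = s ∧ c k = t ∧ D ⊆ X ∧
      ∀ x ∈ X, x ∈ D ∨ ∃ i ≤ k, c i = x := by
  obtain ⟨c, k, D, hp, hDX, hD, hdj, hind, hmax⟩ := tutte_opt hX hS hc st
  have hk := hp.hk
  suffices hcov : ∀ x ∈ X, x ∈ D ∨ ∃ i ≤ k, c i = x by
    refine ⟨c, k, D, ⟨hp.hk, hp.inj, hp.adj, ?_, hind, hdj, hD, fun u v huv => hcov u (hX _ _ huv)⟩,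
      hp.c0, hp.ck, hDX, hcov⟩
    rw [hp.c0, hp.ck]
    exact st
  by_contra hcon
  push Not at hcon
  obtain ⟨r0, hr0X, hr0D, hr0c⟩ := hcon
  have hgrow : ∀ x ∈ X, x ∉ D → (∃ c' k', Pth G s t c' k' ∧ ∀ i ≤ k', c' i ∉ insert x D) →
      ¬ PCn G (insert x D) := by
    rintro x hx hxD ⟨c', k', h1, h2⟩ h3
    have := hmax c' k' (insert x D) h1 (Set.insert_subset hx hDX) h3 h2
    rw [Set.ncard_insert_of_notMem hxD] at this
    omega
  have hDne : D.Nonempty := by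
    by_contra hne
    rw [Set.not_nonempty_iff_eq_empty] at hne
    refine hgrow r0 hr0X hr0D ⟨c, k, hp, ?_⟩ ?_
    · intro i hi
      rw [hne]
      simpa using hr0c i hi
    · rw [hne]
      simpa using (cn_singleton G r0).2
  have hDcn : Cn G D := ⟨hDne, hD⟩
  obtain ⟨R, hR⟩ : ∃ R : Set V, ∀ x, x ∈ R ↔ x ∈ X ∧ x ∉ D ∧ ∀ i ≤ k, c i ≠ x := ⟨{x | _}, fun x => Iff.rfl⟩
  have noRD : ∀ r ∈ R, ∀ d ∈ D, ¬ G.Adj r d := by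
    intro r hr d hd hrd
    rw [hR] at hr
    refine hgrow r hr.1 hr.2.1 ⟨c, k, hp, ?_⟩ (hDcn.insert hd hrd).2
    intro i hi h
    rcases h with h | h
    · exact hr.2.2 i hi h
    · exact hdj i hi h
  have hr0 : r0 ∈ R := (hR _).2 ⟨hr0X, hr0D, hr0c⟩
  have hcR : ∀ i ≤ k, c i ∉ R := fun i hi h => ((hR _).1 h).2.2 i hi rfl
  have hcases : ∀ x ∈ X, x ∈ D ∨ x ∈ R ∨ ∃ i ≤ k, c i = x := by
    intro x hx
    have := hR x
    by_cases h1 : x ∈ D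
    · exact Or.inl h1
    by_cases h2 : ∃ i ≤ k, c i = x
    · exact Or.inr (Or.inr h2)
    · push Not at h2
      exact Or.inr (Or.inl (this.2 ⟨hx, h1, h2⟩))
  obtain ⟨at', hat⟩ : ∃ at' : V → ℕ → Prop, ∀ r i, at' r i ↔ ∃ y ∈ comp G R r, G.Adj y (c i) :=
    ⟨_, fun _ _ => Iff.rfl⟩
  obtain ⟨U, hU⟩ : ∃ U : Set ℕ, ∀ j, j ∈ U ↔ ∃ r ∈ R, ∃ i l, i < j ∧ j < l ∧ l ≤ k ∧ at' r i ∧ at' r l :=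
    ⟨{j | _}, fun _ => Iff.rfl⟩
  have ha : ∀ j ∈ U, ∀ d ∈ D, ¬ G.Adj d (c j) := by
    intro j hj d hd hdj'
    obtain ⟨r, hr, i, l, hij, hjl, hlk, hi, hl⟩ := (hU j).1 hj
    obtain ⟨y, hy, hyi⟩ := (hat _ _).1 hi
    obtain ⟨z, hz, hzl⟩ := (hat _ _).1 hl
    have hKR := comp_subset (G := G) hr
    have hsR : s ∉ R := by rw [← hp.c0]; exact hcR 0 (by omega)
    have htR : t ∉ R := by rw [← hp.ck]; exact hcR k le_rfl
    have hst : ∀ m < k, (del G s t).Adj (c m) (c (m + 1)) := by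
      intro m hm
      refine ⟨hp.adj m hm, ?_, ?_⟩
      · rintro ⟨h1, h2⟩
        rw [← hp.c0] at h1
        rw [← hp.ck] at h2
        have := hp.inj _ (by omega) _ (by omega) h1
        have := hp.inj _ (by omega) _ (by omega) h2
        omega
      · rintro ⟨h1, h2⟩
        rw [← hp.ck] at h1
        have := hp.inj _ (by omega) _ (by omega) h1
        omega
    have hK : Cn (del G s t) (comp G R r) := (cn_comp hr).mono fun a ha b hb hab =>
      ⟨hab, fun h => hsR (h.1 ▸ hKR ha), fun h => htR (h.1 ▸ hKR ha)⟩
    have c1 : Cn (del G s t) (arc c 0 i) := cn_arc (by omega) fun m _ h2 => hst m (by omega)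
    have c2 : Cn (del G s t) (arc c l k) := cn_arc (by omega) fun m _ h2 => hst m (by omega)
    have t1 : Tch (del G s t) (comp G R r) (arc c 0 i) := ⟨y, hy, c i, mem_arc (by omega) le_rfl,
      hyi, fun h => hsR (h.1 ▸ hKR hy), fun h => htR (h.1 ▸ hKR hy)⟩
    have t2 : Tch (del G s t) (comp G R r) (arc c l k) := ⟨z, hz, c l, mem_arc (by omega) (by omega),
      hzl, fun h => hsR (h.1 ▸ hKR hz), fun h => htR (h.1 ▸ hKR hz)⟩
    have cP := (hK.union c1 t1).union c2 (t2.mono Set.subset_union_left subset_rfl)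
    obtain ⟨c', k', hp', hm⟩ := pth_of cP (s := s) (t := t) 
      (Or.inl (Or.inr (hp.c0 ▸ mem_arc le_rfl (by omega)))) (Or.inr (hp.ck ▸ mem_arc hlk le_rfl)) st.ne
    refine hgrow (c j) (hp.mem hX (by omega)) (hdj j (by omega)) ⟨c', k', hp', ?_⟩ (hDcn.insert hd hdj'.symm).2
    intro m _ hm'
    rcases hm m with (h | ⟨a, ha1, ha2, h⟩) | ⟨a, ha1, ha2, h⟩
    · rcases hm' with e | e
      · rw [e] at h
        exact hcR j (by omega) (hKR h)
      · exact ((hR _).1 (hKR h)).2.1 e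
    · rw [← h] at hm'
      rcases hm' with e | e
      · have := hp.inj _ (by omega) _ (by omega) e
        omega
      · exact hdj a (by omega) e
    · rw [← h] at hm'
      rcases hm' with e | e
      · have := hp.inj _ (by omega) _ (by omega) e
        omega
      · exact hdj a (by omega) e
  have hUne : ∃ j, j ∈ U := by
    by_contra hcon
    push Not at hcon
    have key : ∃ m < k, ∀ i ≤ k, at' r0 i → i = m ∨ i = m + 1 := by
      classical
      by_cases hex : ∃ i, i ≤ k ∧ at' r0 i
      · obtain ⟨h1, h2⟩ := Nat.find_spec hex
        have hall : ∀ i ≤ k, at' r0 i → i = Nat.find hex ∨ i = Nat.find hex + 1 := by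
          intro i hi hai
          have h3 := Nat.find_min' hex ⟨hi, hai⟩
          by_contra h4
          exact hcon (Nat.find hex + 1) ((hU _).2 ⟨r0, hr0, Nat.find hex, i, by omega, by omega, hi, h2, hai⟩)
        by_cases h3 : Nat.find hex < k
        · exact ⟨_, h3, hall⟩
        · refine ⟨k - 1, by omega, fun i hi hai => ?_⟩
          have := hall i hi hai
          omega
      · push Not at hex
        exact ⟨0, by omega, fun i hi h => (hex i hi h).elim⟩
    obtain ⟨m, hm, hall⟩ := key
    have hKR := comp_subset (G := G) hr0
    have := hS (comp G R r0) (fun x hx => ((hR _).1 (hKR hx)).1) ⟨r0, mem_comp_self _ _ _⟩ (c m) (c (m + 1))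
      (fun h => hcR m (by omega) (hKR h)) (fun h => hcR (m + 1) (by omega) (hKR h)) (by
        intro y hy x hx hyx
        rcases hcases x hx with h | h | ⟨i, hi, rfl⟩
        · exact (noRD y (hKR hy) x h hyx).elim
        · exact Or.inl (comp_closed hr0 hy h hyx)
        · right
          rcases hall i hi ((hat _ _).2 ⟨y, hy, hyx⟩) with rfl | rfl
          · exact Or.inl rfl
          · exact Or.inr rfl)
    obtain ⟨d, hd⟩ := hDne
    rcases this d (hDX hd) with h | h | h
    · exact ((hR _).1 (hKR h)).2.1 hd
    · exact hdj m (by omega) (h ▸ hd)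
    · exact hdj (m + 1) (by omega) (h ▸ hd)
  obtain ⟨j0, hj0⟩ := hUne
  have h0U : 0 ∉ U := by
    intro h
    obtain ⟨r, hr, i, l, hij, _⟩ := (hU 0).1 h
    omega
  have hkU : ∀ j ∈ U, j < k := by
    intro j h
    obtain ⟨r, hr, i, l, hij, h1, h2, _⟩ := (hU j).1 h
    omega
  obtain ⟨x, ⟨hxU, hxj⟩, hxmax⟩ := exists_max (P := fun n => n ∉ U ∧ n ≤ j0) (b := j0) ⟨0, h0U, by omega⟩ (fun n h => h.2)
  have hyex : ∃ y, y ∉ U ∧ j0 ≤ y := ⟨k, fun h => (hkU k h).ne rfl, (hkU j0 hj0).le⟩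
  classical
  obtain ⟨hyU, hyj⟩ := Nat.find_spec hyex
  have hymin : ∀ m, j0 ≤ m → m < Nat.find hyex → m ∈ U := by
    intro m h1 h2
    have := Nat.find_min hyex h2
    tauto
  have hyk : Nat.find hyex ≤ k := Nat.find_min' hyex ⟨fun h => (hkU k h).ne rfl, (hkU j0 hj0).le⟩
  generalize Nat.find hyex = y at hyU hyj hymin hyk
  have hxj' : x < j0 := lt_of_le_of_ne hxj (by rintro rfl; exact hxU hj0)
  have hyj' : j0 < y := lt_of_le_of_ne hyj (by rintro rfl; exact hyU hj0)
  have hin : ∀ m, x < m → m < y → m ∈ U := by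
    intro m h1 h2
    by_cases h3 : j0 ≤ m
    · exact hymin m h3 h2
    · by_contra h4
      have := hxmax m ⟨h4, by omega⟩
      omega
  have hYR : ∀ z, (∃ m, x < m ∧ m < y ∧ c m = z) → z ∉ R := by
    rintro z ⟨m, _, _, rfl⟩
    exact hcR m (by omega)
  have := hS ({z | ∃ m, x < m ∧ m < y ∧ c m = z} ∪ {r | r ∈ R ∧ ∃ m, x < m ∧ m < y ∧ at' r m}) (by
      rintro z (⟨m, h1, h2, rfl⟩ | ⟨h, _⟩)
      · exact hp.mem hX (by omega)
      · exact ((hR _).1 h).1) ⟨c j0, Or.inl ⟨j0, hxj', hyj', rfl⟩⟩ (c x) (c y) (by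
      rintro (⟨m, h1, h2, e⟩ | ⟨h, _⟩)
      · have := hp.inj _ (by omega) _ (by omega) e
        omega
      · exact hcR x (by omega) h) (by
      rintro (⟨m, h1, h2, e⟩ | ⟨h, _⟩)
      · have := hp.inj _ (by omega) _ (by omega) e
        omega
      · exact hcR y (by omega) h) (by
      rintro a (⟨m, h1, h2, rfl⟩ | ⟨h, m, h1, h2, h3⟩) b hb hab
      · rcases hcases b hb with h | h | ⟨i, hi, rfl⟩
        · exact (ha m (hin m h1 h2) b h hab.symm).elim
        · left; right
          exact ⟨h, m, h1, h2, (hat _ _).2 ⟨b, mem_comp_self _ _ _, hab.symm⟩⟩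
        · have hi' : x ≤ i ∧ i ≤ y := by
            rcases lt_trichotomy m i with h | h | h
            · have := hind m i h hi hab
              omega
            · omega
            · have := hind i m h (by omega) hab.symm
              omega
          by_cases e1 : i = x
          · right; left; rw [e1]
          by_cases e2 : i = y
          · right; right; rw [e2]
          left; left
          exact ⟨i, by omega, by omega, rfl⟩
      · rcases hcases b hb with h' | h' | ⟨i, hi, rfl⟩
        · exact (noRD a h b h' hab).elim
        · left; right
          refine ⟨h', m, h1, h2, (hat _ _).2 ?_⟩
          obtain ⟨y', hy', hyy⟩ := (hat _ _).1 h3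
          exact ⟨y', (cn_comp h).subset_comp (comp_subset h) (comp_closed h (mem_comp_self _ _ _) h' hab) hy', hyy⟩
        · have h5 : at' a i := (hat _ _).2 ⟨a, mem_comp_self _ _ _, hab⟩
          by_cases e1 : i = x
          · right; left; rw [e1]
          by_cases e2 : i = y
          · right; right; rw [e2]
          left; left
          refine ⟨i, ?_, ?_, rfl⟩
          · by_contra h6
            exact hxU ((hU x).2 ⟨a, h, i, m, by omega, h1, by omega, h5, h3⟩)
          · by_contra h6
            exact hyU ((hU y).2 ⟨a, h, m, i, h2, by omega, hi, h3, h5⟩))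
  obtain ⟨d, hd⟩ := hDne
  rcases this d (hDX hd) with (⟨m, h1, h2, rfl⟩ | ⟨h, _⟩) | rfl | rfl
  · exact hdj m (by omega) hd
  · exact ((hR _).1 h).2.1 hd
  · exact hdj x (by omega) hd
  · exact hdj y (by omega) hd

end Tri

namespace Tri
variable {V : Type} {W : Type}

def add (G : SimpleGraph V) (a b : V) : SimpleGraph V where
  Adj u v := u ≠ v ∧ (G.Adj u v ∨ (u = a ∧ v = b) ∨ (u = b ∧ v = a))
  symm := ⟨fun _ _ h => ⟨h.1.symm, by have := h.2; rw [G.adj_comm] at this; tauto⟩⟩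
  loopless := ⟨fun _ h => h.1 rfl⟩

theorem add_adj {G : SimpleGraph V} {a b u v : V} : (add G a b).Adj u v ↔
  u ≠ v ∧ (G.Adj u v ∨ (u = a ∧ v = b) ∨ (u = b ∧ v = a)) := Iff.rfl

theorem le_add (G : SimpleGraph V) (a b : V) : G ≤ add G a b := by
  intro u v h
  exact ⟨h.ne, Or.inl h⟩

theorem plus_add (G : SimpleGraph V) (a b : V) : Plus G (add G a b) a b :=
  ⟨le_add G a b, fun _ _ h => h.2⟩

def MaxPl (G : SimpleGraph V) (X : Set V) : Prop :=
  Supp G X ∧ Pl G ∧ ∀ u ∈ X, ∀ v ∈ X, u ≠ v → Pl (add G u v) → G.Adj u v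

theorem small [Finite V] {G : SimpleGraph V} {X : Set V} (hX : Supp G X) (hc : X.ncard ≤ 4) : Pl G := by
  have gen : ∀ {W : Type} [Fintype W] {K : SimpleGraph W} {f : W → Set V}, Mod K G f → (∀ i, ∃ j, K.Adj i j) →
      Fintype.card W ≤ X.ncard := by
    intro W _ K f hf hK
    choose g hg using fun i => (hf.cn i).1
    have hinj : Function.Injective (fun i => (⟨g i, hf.supp hK hX i (hg i)⟩ : X)) := by
      intro i j hij
      have : g i = g j := congrArg Subtype.val hij
      exact hf.dj i j (g i) (hg i) (this ▸ hg j)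
    have := Nat.card_le_card_of_injective _ hinj
    rwa [Nat.card_eq_fintype_card, Nat.card_coe_set_eq] at this
  constructor
  · intro f hf
    have := gen hf K5_ex
    simp at this
    omega
  · intro f hf
    have := gen hf K33_ex
    simp at this
    omega

/-- a separation of `X` -/
structure Sp (G : SimpleGraph V) (X A B S : Set V) : Prop where
  cov : ∀ u ∈ X, u ∈ A ∨ u ∈ B ∨ u ∈ S
  AX : A ⊆ X
  BX : B ⊆ X
  SX : S ⊆ X
  dj : ∀ x ∈ A, x ∉ B
  sA : ∀ x ∈ S, x ∉ A
  sB : ∀ x ∈ S, x ∉ B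
  no : ∀ a ∈ A, ∀ b ∈ B, ¬ G.Adj a b

theorem Sp.symm {G : SimpleGraph V} {X A B S : Set V} (h : Sp G X A B S) : Sp G X B A S :=
  ⟨fun u hu => by have := h.cov u hu; tauto, h.BX, h.AX, h.SX, fun x h1 h2 => h.dj x h2 h1, h.sB, h.sA,
    fun a ha b hb hab => h.no b hb a ha hab.symm⟩

theorem Sp.sepn {G : SimpleGraph V} {X A B S : Set V} (h : Sp G X A B S) (hX : Supp G X)
    (cl : ∀ x ∈ S, ∀ y ∈ S, x ≠ y → G.Adj x y) : Sepn G A B S :=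
  ⟨fun u v huv => h.cov u (hX u v huv), h.dj, h.sA, h.sB, h.no, cl⟩

theorem Sp.nb {G : SimpleGraph V} {X A B S : Set V} (h : Sp G X A B S) (hX : Supp G X) {u v : V} (hu : u ∈ A)
    (huv : G.Adj u v) : v ∈ A ∨ v ∈ S := by
  rcases h.cov v (hX _ _ huv.symm) with h1 | h1 | h1
  · exact Or.inl h1
  · exact (h.no u hu v h1 huv).elim
  · exact Or.inr h1

theorem res_le (G : SimpleGraph V) (X : Set V) : res G X ≤ G := fun _ _ h => h.1

theorem addab [Finite V] {G : SimpleGraph V} {X A B S : Set V} (hX : Supp G X) (hG : Pl G) (h : Sp G X A B S)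
    {x0 a b : V} (hS : ∀ p ∈ S, p = x0) (ha : a ∈ A) (hb : b ∈ B) (hSa : ∀ u ∈ S, G.Adj u a)
    (hSb : ∀ u ∈ S, G.Adj u b) : Pl (add G a b) := by
  have hab : a ≠ b := by rintro rfl; exact h.dj a ha hb
  have haB := h.dj a ha
  have hbA : b ∉ A := fun h1 => h.dj b h1 hb
  have s1 : Sepn (add G a b) (A \ {a}) B (insert a S) := by
    refine ⟨?_, fun x hx => h.dj x hx.1, ?_, ?_, ?_, ?_⟩
    · intro u v huv
      have hu : u ∈ X := by
        rcases huv.2 with h1 | ⟨rfl, _⟩ | ⟨rfl, _⟩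
        · exact hX _ _ h1
        · exact h.AX ha
        · exact h.BX hb
      by_cases hua : u = a
      · exact Or.inr (Or.inr (Or.inl hua))
      rcases h.cov u hu with h1 | h1 | h1
      · exact Or.inl ⟨h1, hua⟩
      · exact Or.inr (Or.inl h1)
      · exact Or.inr (Or.inr (Or.inr h1))
    · rintro x (rfl | hx) h1
      · exact h1.2 rfl
      · exact h.sA x hx h1.1
    · rintro x (rfl | hx) h1
      · exact haB h1
      · exact h.sB x hx h1
    · rintro x ⟨hx, hxa⟩ y hy ⟨_, h1 | ⟨h1, _⟩ | ⟨h1, _⟩⟩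
      · exact h.no x hx y hy h1
      · exact hxa h1
      · exact hbA (h1 ▸ hx)
    · rintro x (rfl | hx) y (rfl | hy) hxy
      · exact (hxy rfl).elim
      · exact le_add _ _ _ (hSa y hy).symm
      · exact le_add _ _ _ (hSa x hx)
      · exact (hxy ((hS x hx).trans (hS y hy).symm)).elim
  refine glue2 s1 (hG.mono ?_) ?_ ⟨a, x0, ?_⟩
  · rintro u v ⟨⟨_, h1 | ⟨h1, h2⟩ | ⟨h1, h2⟩⟩, h3, h4⟩
    · exact h1
    · exact (h4 (h2 ▸ hb)).elim
    · exact (h3 (h1 ▸ hb)).elim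
  · have s2 : Sepn (res (add G a b) (A \ {a})ᶜ) {a} (B \ {b}) (insert b S) := by
      refine ⟨?_, ?_, ?_, ?_, ?_, ?_⟩
      · rintro u v ⟨huv, hu, hv⟩
        by_cases hua : u = a
        · exact Or.inl hua
        by_cases hub : u = b
        · exact Or.inr (Or.inr (Or.inl hub))
        rcases s1.cov u v huv with h1 | h1 | h1 | h1
        · exact (hu h1).elim
        · exact Or.inr (Or.inl ⟨h1, hub⟩)
        · exact Or.inl h1
        · exact Or.inr (Or.inr (Or.inr h1))
      · rintro x rfl h1
        exact haB h1.1
      · rintro x (rfl | hx) h1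
        · exact hab h1.symm
        · exact h.sA x hx (h1 ▸ ha)
      · rintro x (rfl | hx) h1
        · exact h1.2 rfl
        · exact h.sB x hx h1.1
      · rintro x rfl y ⟨hy, hyb⟩ ⟨⟨_, h1 | ⟨_, h1⟩ | ⟨h1, _⟩⟩, _⟩
        · exact h.no x ha y hy h1
        · exact hyb h1
        · exact hab h1
      · have hbm : b ∉ A \ {a} := fun h1 => hbA h1.1
        have hsm : ∀ x ∈ S, x ∉ A \ {a} := fun x hx h1 => h.sA x hx h1.1
        rintro x (rfl | hx) y (rfl | hy) hxy
        · exact (hxy rfl).elim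
        · exact ⟨le_add _ _ _ (hSb y hy).symm, hbm, hsm y hy⟩
        · exact ⟨le_add _ _ _ (hSb x hx), hsm x hx, hbm⟩
        · exact (hxy ((hS x hx).trans (hS y hy).symm)).elim
    refine glue2 s2 (small (X := {a, b, x0}) ?_ ?_) (hG.mono ?_) ⟨b, x0, ?_⟩
    · rintro u v ⟨huv, hu, hv⟩
      rcases s2.cov u v huv with h1 | h1 | h1 | h1
      · exact Or.inl h1
      · exact (hu h1).elim
      · exact Or.inr (Or.inl h1)
      · exact Or.inr (Or.inr (hS u h1))
    · have e1 := Set.ncard_insert_le a ({b, x0} : Set V)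
      have e2 := Set.ncard_insert_le b ({x0} : Set V)
      have e3 := Set.ncard_singleton x0
      omega
    · rintro u v ⟨⟨⟨_, h1 | ⟨h1, h2⟩ | ⟨h1, h2⟩⟩, _⟩, h3, h4⟩
      · exact h1
      · exact (h3 h1).elim
      · exact (h4 h2).elim
    · rintro p (rfl | hp)
      · exact Or.inl rfl
      · exact Or.inr (hS p hp)
  · rintro p (rfl | hp)
    · exact Or.inl rfl
    · exact Or.inr (hS p hp)

theorem no_cut0 [Finite V] {G : SimpleGraph V} {X A B S : Set V} (hM : MaxPl G X) (h : Sp G X A B S)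
    (hS : ∀ x, x ∉ S) {a b : V} (ha : a ∈ A) (hb : b ∈ B) : False :=
  h.no a ha b hb (hM.2.2 a (h.AX ha) b (h.BX hb) (by rintro rfl; exact h.dj a ha hb)
    (addab hM.1 hM.2.1 h (x0 := a) (fun p hp => (hS p hp).elim) ha hb (fun p hp => (hS p hp).elim)
      (fun p hp => (hS p hp).elim)))

/-- in a separation with `S` of size at most one impossible -/
theorem no_cut1 [Finite V] {G : SimpleGraph V} {X A B S : Set V} (hM : MaxPl G X) (h : Sp G X A B S)
    {x0 : V} (hS : ∀ x ∈ S, x = x0) (hA : A.Nonempty) (hB : B.Nonempty) : False := by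
  have key : ∀ {A B : Set V}, Sp G X A B S → A.Nonempty → B.Nonempty → ∃ a ∈ A, ∀ u ∈ S, G.Adj u a := by
    intro A B h hA hB
    by_contra hcon
    push Not at hcon
    obtain ⟨a, ha⟩ := hA
    obtain ⟨b, hb⟩ := hB
    refine no_cut0 hM (A := A) (B := B ∪ S) (S := ∅) ?_ (by simp) ha (Or.inl hb)
    refine ⟨?_, h.AX, Set.union_subset h.BX h.SX, by simp, ?_, by simp, by simp, ?_⟩
    · intro u hu
      have := h.cov u hu
      simp
      tauto
    · rintro x hx (h1 | h1)
      · exact h.dj x hx h1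
      · exact h.sA x h1 hx
    · rintro x hx y (hy | hy) hxy
      · exact h.no x hx y hy hxy
      · obtain ⟨u, hu, hne⟩ := hcon x hx
        rw [hS u hu, ← hS y hy] at hne
        exact hne hxy.symm
  obtain ⟨a, ha, ha'⟩ := key h hA hB
  obtain ⟨b, hb, hb'⟩ := key h.symm hB hA
  exact h.no a ha b hb (hM.2.2 a (h.AX ha) b (h.BX hb) (by rintro rfl; exact h.dj a ha hb)
    (addab hM.1 hM.2.1 h (x0 := x0) hS ha hb ha' hb'))

/-- components attach to everything -/
theorem comp_att [Finite V] {G : SimpleGraph V} {X A B : Set V} {s t : V} (hM : MaxPl G X) (h : Sp G X A B {s, t})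
    (hA : A.Nonempty) {b : V} (hb : b ∈ B) : ∃ y ∈ comp G B b, G.Adj y s := by
  by_contra hcon
  push Not at hcon
  have hsub := comp_subset (G := G) hb
  have hs : s ∈ ({s, t} : Set V) := Or.inl rfl
  have ht : t ∈ ({s, t} : Set V) := Or.inr rfl
  obtain ⟨a, ha⟩ := hA
  refine no_cut1 hM (A := comp G B b) (B := X \ (insert t (comp G B b))) (S := {t}) (x0 := t) ?_ (by simp)
    ⟨b, mem_comp_self _ _ _⟩ ⟨a, h.AX ha, ?_⟩
  · refine ⟨?_, hsub.trans h.BX, Set.diff_subset, by simpa using h.SX ht, ?_, ?_, ?_, ?_⟩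
    · intro u hu
      simp
      tauto
    · intro x hx h1
      exact h1.2 (Or.inr hx)
    · rintro x rfl hx
      exact h.sB x ht (hsub hx)
    · rintro x rfl hx
      exact hx.2 (Or.inl rfl)
    · rintro x hx y ⟨hy, hy2⟩ hxy
      rcases h.symm.nb hM.1 (hsub hx) hxy with h1 | rfl | rfl
      · exact hy2 (Or.inr (comp_closed hb hx h1 hxy))
      · exact hcon x hx hxy
      · exact hy2 (Or.inl rfl)
  · rintro (rfl | h1)
    · exact h.sA a ht ha
    · exact h.dj a ha (hsub h1)

theorem pair_swap {G : SimpleGraph V} {X A B : Set V} {s t : V} (h : Sp G X A B {s, t}) : Sp G X A B {t, s} := by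
  rwa [Set.pair_comm]

theorem half2 [Finite V] {G : SimpleGraph V} {X A B : Set V} {s t : V} (hM : MaxPl G X) (h : Sp G X A B {s, t})
    (hA : A.Nonempty) (hB : B.Nonempty) (hst : s ≠ t) : Pl (res (add G s t) Bᶜ) := by
  classical
  obtain ⟨b, hb⟩ := hB
  obtain ⟨y, hy, hys⟩ := comp_att hM h hA hb
  obtain ⟨z, hz, hzt⟩ := comp_att hM (pair_swap h) hA hb
  have hsub := comp_subset (G := G) hb
  have hs : s ∉ B := h.sB s (Or.inl rfl)
  have ht : t ∉ B := h.sB t (Or.inr rfl)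
  have hself : ∀ v, v ∈ (if v = s then insert s (comp G B b) else {v} : Set V) := by
    intro v
    split_ifs with h1
    · exact Or.inl h1
    · rfl
  refine hM.2.1.pull (X := Bᶜ) ?_ (fun v => if v = s then insert s (comp G B b) else {v}) ?_ ?_ ?_
  · intro u v huv
    exact huv.2.1
  · intro v _
    split_ifs
    · exact (cn_comp hb).insert hy hys.symm
    · exact cn_singleton _ _
  · intro u hu v hv x hxu hxv
    have e : ∀ u, u ∈ Bᶜ → x ∈ (if u = s then insert s (comp G B b) else {u} : Set V) →
       (x ∈ B ∧ u = s) ∨ x = u := by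
      intro u hu hx
      split_ifs at hx with h1
      · rcases hx with hx | hx
        · exact Or.inr (hx.trans h1.symm)
        · exact Or.inl ⟨hsub hx, h1⟩
      · exact Or.inr hx
    rcases e u hu hxu with ⟨h1, h2⟩ | h1 <;> rcases e v hv hxv with ⟨h3, h4⟩ | h3
    · rw [h2, h4]
    · exact (hv (h3 ▸ h1)).elim
    · exact (hu (h1 ▸ h3)).elim
    · exact h1.symm.trans h3
  · have base : Tch G (if s = s then insert s (comp G B b) else {s} : Set V) (if t = s then insert s (comp G B b) else {t} : Set V) := by
      rw [if_pos rfl, if_neg hst.symm]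
      exact ⟨z, Or.inr hz, t, rfl, hzt⟩
    rintro u v ⟨⟨_, h1 | ⟨rfl, rfl⟩ | ⟨rfl, rfl⟩⟩, h3, h4⟩
    · exact ⟨u, hself u, v, hself v, h1⟩
    · exact base
    · exact base.symm

theorem no_cut2 [Finite V] {G : SimpleGraph V} {X A B : Set V} {s t : V} (hM : MaxPl G X) (h : Sp G X A B {s, t})
    (hA : A.Nonempty) (hB : B.Nonempty) : G.Adj s t := by
  by_cases hst : s = t
  · subst hst
    exact (no_cut1 hM h (x0 := s) (by simp) hA hB).elim
  have hs : s ∈ ({s, t} : Set V) := Or.inl rfl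
  have ht : t ∈ ({s, t} : Set V) := Or.inr rfl
  refine hM.2.2 s (h.SX hs) t (h.SX ht) hst (glue2 (A := A) (B := B) (S := {s, t}) ?_ (half2 hM h hA hB hst)
    (half2 hM h.symm hB hA hst) ⟨s, t, by simp⟩)
  refine ⟨?_, h.dj, h.sA, h.sB, ?_, ?_⟩
  · rintro u v ⟨_, h1 | ⟨rfl, rfl⟩ | ⟨rfl, rfl⟩⟩
    · exact h.cov u (hM.1 _ _ h1)
    · exact Or.inr (Or.inr hs)
    · exact Or.inr (Or.inr ht)
  · rintro a ha b hb ⟨_, h1 | ⟨rfl, rfl⟩ | ⟨rfl, rfl⟩⟩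
    · exact h.no a ha b hb h1
    · exact h.sA _ hs ha
    · exact h.sA _ ht ha
  · rintro x (rfl | rfl) y (rfl | rfl) hxy
    · exact (hxy rfl).elim
    · exact ⟨hxy, Or.inr (Or.inl ⟨rfl, rfl⟩)⟩
    · exact ⟨hxy, Or.inr (Or.inr ⟨rfl, rfl⟩)⟩
    · exact (hxy rfl).elim

/-- sides of 2-separations are maximal planar -/
theorem side_max [Finite V] {G : SimpleGraph V} {X A B : Set V} {s t : V} (hM : MaxPl G X) (h : Sp G X A B {s, t})
    (st : G.Adj s t) : MaxPl (res G Bᶜ) (A ∪ {s, t}) := by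
  have hs : s ∈ ({s, t} : Set V) := Or.inl rfl
  have ht : t ∈ ({s, t} : Set V) := Or.inr rfl
  refine ⟨?_, hM.2.1.mono (res_le _ _), ?_⟩
  · rintro u v ⟨huv, hu, hv⟩
    rcases h.cov u (hM.1 _ _ huv) with h1 | h1 | h1
    · exact Or.inl h1
    · exact (hu h1).elim
    · exact Or.inr h1
  intro x hx y hy hxy hP
  have nB : ∀ x ∈ A ∪ {s, t}, x ∉ B := by
    rintro x (hx | hx)
    · exact h.dj x hx
    · exact h.sB x hx
  have inX : ∀ x ∈ A ∪ {s, t}, x ∈ X := by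
    rintro x (hx | hx)
    · exact h.AX hx
    · exact h.SX hx
  suffices hG : G.Adj x y from ⟨hG, nB x hx, nB y hy⟩
  by_contra hn
  refine hn (hM.2.2 x (inX x hx) y (inX y hy) hxy (glue2 (A := A) (B := B) (S := {s, t}) ?_ (hP.mono ?_) 
    (hM.2.1.mono ?_) ⟨s, t, by simp⟩))
  · refine ⟨?_, h.dj, h.sA, h.sB, ?_, ?_⟩
    · rintro u v ⟨_, h1 | ⟨rfl, rfl⟩ | ⟨rfl, rfl⟩⟩
      · exact h.cov u (hM.1 _ _ h1)
      · exact h.cov _ (inX _ hx)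
      · exact h.cov _ (inX _ hy)
    · rintro a ha b hb ⟨_, h1 | ⟨rfl, rfl⟩ | ⟨rfl, rfl⟩⟩
      · exact h.no a ha b hb h1
      · exact nB _ hy hb
      · exact nB _ hx hb
    · rintro x (rfl | rfl) y (rfl | rfl) hxy
      · exact (hxy rfl).elim
      · exact le_add _ _ _ st
      · exact le_add _ _ _ st.symm
      · exact (hxy rfl).elim
  · rintro u v ⟨⟨h0, h1 | h1⟩, h2, h3⟩
    · exact ⟨h0, Or.inl ⟨h1, h2, h3⟩⟩
    · exact ⟨h0, Or.inr h1⟩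
  · have key : ¬ (x ∉ A ∧ y ∉ A) := by
      rintro ⟨h1, h2⟩
      rcases hx.resolve_left h1 with rfl | rfl <;> rcases hy.resolve_left h2 with rfl | rfl
      · exact hxy rfl
      · exact hn st
      · exact hn st.symm
      · exact hxy rfl
    rintro u v ⟨⟨h0, h1 | ⟨rfl, rfl⟩ | ⟨rfl, rfl⟩⟩, h2, h3⟩
    · exact h1
    · exact (key ⟨h2, h3⟩).elim
    · exact (key ⟨h3, h2⟩).elim

theorem apexA [Finite V] {G : SimpleGraph V} {X A B : Set V} {s t : V} (hM : MaxPl G X) (h : Sp G X A B {s, t})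
    (hA : A.Nonempty) (hB : B.Nonempty)
    (ih : 4 ≤ (A ∪ {s, t} : Set V).ncard → Sep3 (res G Bᶜ) (A ∪ {s, t})) : 
    ∃ a ∈ A, G.Adj s a ∧ G.Adj a t ∧ PCn G (A \ {a}) ∧ PCn G A := by
  have st := no_cut2 hM h hA hB
  have hs : s ∈ ({s, t} : Set V) := Or.inl rfl
  have ht : t ∈ ({s, t} : Set V) := Or.inr rfl
  have hMA := side_max hM h st
  by_cases hc : 4 ≤ (A ∪ {s, t} : Set V).ncard
  · have hS := ih hc
    have st' : (res G Bᶜ).Adj s t := ⟨st, h.sB s hs, h.sB t ht⟩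
    obtain ⟨c, k, D, hcy, c0, ck, hDX, hcov⟩ := tutte hMA.1 hS (by omega) st'
    have hk := hcy.hk
    have hX : ∀ i ≤ k, c i ∈ A ∪ {s, t} := by
      intro i hi
      by_cases h1 : i = k
      · have := hcy.adj (k - 1) (by omega)
        rw [show k - 1 + 1 = i by omega] at this
        exact hMA.1 _ _ this.symm
      · exact hMA.1 _ _ (hcy.adj i (by omega))
    have hch := chord hMA.2.1 (plus_add _ (c 1) (c k)) (hcy.adj 0 (by omega)) hcy.adj0 (hcy.noR23 hMA.2.1)
    have h1k : c 1 ≠ c k := by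
      intro e
      have := hcy.inj _ (by omega) _ le_rfl e
      omega
    have hadj := hMA.2.2 _ (hX 1 (by omega)) _ (hX k le_rfl) h1k hch
    have hk2 : k = 2 := by
      have := hcy.ind 1 k (by omega) le_rfl hadj
      omega
    subst hk2
    have a01 := hcy.adj 0 (by omega)
    have a12 := hcy.adj 1 (by omega)
    simp only [zero_add, Nat.reduceAdd] at a01 a12
    rw [c0] at a01
    rw [ck] at a12
    have haA : c 1 ∈ A := by
      rcases hX 1 (by omega) with h1 | h1 | h1
      · exact h1
      · exact (a01.ne h1.symm).elim
      · exact (a12.ne h1).elim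
    have hD : A \ {c 1} = D := by
      ext x
      constructor
      · rintro ⟨hx, hx1⟩
        rcases hcov x (Or.inl hx) with h1 | ⟨i, hi, rfl⟩
        · exact h1
        · interval_cases i
          · rw [c0] at hx; exact (h.sA s hs hx).elim
          · exact (hx1 rfl).elim
          · rw [ck] at hx; exact (h.sA t ht hx).elim
      · intro hx
        refine ⟨?_, fun e => hcy.dD 1 (by omega) (by rw [← (show x = c 1 from e)]; exact hx)⟩
        rcases hDX hx with h1 | h1 | h1
        · exact h1
        · exact (hcy.dD 0 (by omega) (by rw [c0, ← h1]; exact hx)).elim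
        · exact (hcy.dD 2 (by omega) (by rw [ck, ← (show x = t from h1)]; exact hx)).elim
    have hDp : PCn G (A \ {c 1}) := by
      rw [hD]
      intro Y hY hcl
      exact hcy.conn Y hY fun y hy hyY x hx hyx => hcl y hy hyY x hx hyx.1
    refine ⟨c 1, haA, a01.1, a12.1, hDp, ?_⟩
    have hAe : A = insert (c 1) (A \ {c 1}) := by
      rw [Set.insert_diff_singleton, Set.insert_eq_of_mem haA]
    by_cases hDn : (A \ {c 1}).Nonempty
    · have : ∃ x ∈ A \ {c 1}, G.Adj (c 1) x := by
        by_contra hcon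
        push Not at hcon
        obtain ⟨d, hd⟩ := hDn
        have := hS {c 1} (by simpa using Or.inr (Or.inr haA)) ⟨c 1, rfl⟩ s t (by simpa using a01.ne) (by simpa using a12.ne.symm) (by
          rintro y rfl x hx hyx
          rcases hx with hx | hx | hx
          · exact (hcon x ⟨hx, fun e => hyx.ne (Eq.symm e)⟩ hyx.1).elim
          · exact Or.inr (Or.inl hx)
          · exact Or.inr (Or.inr hx)) d (Or.inl hd.1)
        rcases this with h1 | h1 | h1
        · exact hd.2 h1
        · exact h.sA s hs (h1 ▸ hd.1)
        · exact h.sA t ht (h1 ▸ hd.1)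
      obtain ⟨x, hx, hax⟩ := this
      rw [hAe]
      exact (Cn.insert ⟨hDn, hDp⟩ hx hax).2
    · rw [Set.not_nonempty_iff_eq_empty] at hDn
      rw [hAe, hDn]
      simpa using (cn_singleton G (c 1)).2
  · obtain ⟨a, ha⟩ := hA
    have hA1 : A = {a} := by
      have hd : Disjoint A {s, t} := Set.disjoint_left.2 fun x hx hx2 => h.sA x hx2 hx
      rw [Set.ncard_union_eq hd, Set.ncard_pair st.ne] at hc
      have : A.ncard ≤ 1 := by omega
      rw [Set.ncard_le_one] at this
      ext x
      exact ⟨fun hx => this x hx a ha, by rintro rfl; exact ha⟩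
    obtain ⟨y, hy, hys⟩ := comp_att hM h.symm hB ha
    obtain ⟨z, hz, hzt⟩ := comp_att hM (pair_swap h.symm) hB ha
    have hy := comp_subset ha hy
    have hz := comp_subset ha hz
    rw [hA1] at hy hz
    obtain rfl : y = a := hy
    obtain rfl : z = y := hz
    refine ⟨z, ha, hys.symm, hzt, ?_, ?_⟩
    · rw [hA1]
      rintro Y ⟨x, hx, _⟩
      exact (hx.2 hx.1).elim
    · rw [hA1]
      exact (cn_singleton G z).2

end Tri

namespace Tri
variable {V : Type} {W : Type}

theorem PCn.mono_on {G G' : SimpleGraph V} {X : Set V} (h : PCn G X)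
    (hG : ∀ u ∈ X, ∀ v ∈ X, G.Adj u v → G'.Adj u v) : PCn G' X :=
  fun Y hY hcl => h Y hY fun y hy hyY x hx hyx => hcl y hy hyY x hx (hG y hy x hx hyx)

theorem two_cut [Finite V] {G : SimpleGraph V} {X A B : Set V} {s t a b : V} (hM : MaxPl G X)
    (h : Sp G X A B {s, t}) (st : G.Adj s t) (ha : a ∈ A) (hb : b ∈ B) (sa : G.Adj s a) (at1 : G.Adj a t)
    (sb : G.Adj s b) (bt : G.Adj b t) (hDA : PCn G (A \ {a})) (hDB : PCn G (B \ {b})) (hB : PCn G B) :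
    False := by
  have hs : s ∈ ({s, t} : Set V) := Or.inl rfl
  have ht : t ∈ ({s, t} : Set V) := Or.inr rfl
  have sA := h.sA s hs
  have tA := h.sA t ht
  have sB := h.sB s hs
  have tB := h.sB t ht
  have aB := h.dj a ha
  have bA : b ∉ A := fun h1 => h.dj b h1 hb
  have hab : a ≠ b := by rintro rfl; exact aB hb
  have dj := h.dj
  have no := h.no
  have cov : ∀ u v, G.Adj u v → u ∈ A ∨ u ∈ B ∨ u = s ∨ u = t := fun u v huv => h.cov u (hM.1 u v huv)
  refine no a ha b hb (hM.2.2 a (h.AX ha) b (h.BX hb) hab ?_)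
  have sep : Sepn (add G a b) (A \ {a}) B {s, t, a} := by
    refine ⟨?_, ?_, ?_, ?_, ?_, ?_⟩
    · rintro u v ⟨_, huv | ⟨rfl, _⟩ | ⟨rfl, _⟩⟩
      · rcases cov u v huv with h1 | h1 | h1 | h1
        · by_cases e : u = a
          · exact Or.inr (Or.inr (Or.inr (Or.inr e)))
          · exact Or.inl ⟨h1, e⟩
        · exact Or.inr (Or.inl h1)
        · exact Or.inr (Or.inr (Or.inl h1))
        · exact Or.inr (Or.inr (Or.inr (Or.inl h1)))
      · exact Or.inr (Or.inr (Or.inr (Or.inr rfl)))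
      · exact Or.inr (Or.inl hb)
    · exact fun x hx => dj x hx.1
    · rintro x (rfl | rfl | rfl) hx
      · exact sA hx.1
      · exact tA hx.1
      · exact hx.2 rfl
    · rintro x (rfl | rfl | rfl)
      · exact sB
      · exact tB
      · exact aB
    · rintro x hx y hy ⟨_, huv | ⟨rfl, _⟩ | ⟨rfl, _⟩⟩
      · exact no x hx.1 y hy huv
      · exact hx.2 rfl
      · exact bA hx.1
    · intro x hx y hy hxy
      have : G.Adj x y := by
        rcases hx with rfl | rfl | rfl <;> rcases hy with rfl | rfl | rfl <;>
          first | exact (hxy rfl).elim | assumption | exact SimpleGraph.Adj.symm (by assumption)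
      exact le_add _ _ _ this
  have hresB : res (add G a b) Bᶜ ≤ res G Bᶜ := by
    rintro u v ⟨⟨_, huv | ⟨rfl, rfl⟩ | ⟨rfl, rfl⟩⟩, hu, hv⟩
    · exact ⟨huv, hu, hv⟩
    · exact (hv hb).elim
    · exact (hu hb).elim
  have plB : Pl (res G Bᶜ) := hM.2.1.mono (res_le _ _)
  have plA : Pl (res G Aᶜ) := hM.2.1.mono (res_le _ _)
  have key : Pl (res (add G a b) (A \ {a})ᶜ) := by
    refine lemF (G := res G Aᶜ) (w := a) (s := s) (a := b) (t := t) (D := B \ {b}) plA ?_ ?_ ?_ ?_ ?_ ?_ ?_ ?_ ?_ ?_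
    · refine ⟨?_, ?_⟩
      · rintro u v ⟨huv, hu, hv⟩
        exact ⟨le_add _ _ _ huv, fun h1 => hu h1.1, fun h1 => hv h1.1⟩
      · rintro u v ⟨⟨_, huv | ⟨rfl, rfl⟩ | ⟨rfl, rfl⟩⟩, hu, hv⟩
        · by_cases eu : u = a
          · subst eu
            refine Or.inr (Or.inl ⟨rfl, ?_⟩)
            have evA : v ∉ A := fun h1 => hv ⟨h1, huv.ne.symm⟩
            rcases h.nb hM.1 ha huv with h1 | h1 | h1
            · exact (evA h1).elim
            · exact Or.inl h1
            · exact Or.inr (Or.inr h1)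
          · have euA : u ∉ A := fun h1 => hu ⟨h1, eu⟩
            by_cases ev : v = a
            · subst ev
              refine Or.inr (Or.inr ⟨rfl, ?_⟩)
              rcases h.nb hM.1 ha huv.symm with h1 | h1 | h1
              · exact (euA h1).elim
              · exact Or.inl h1
              · exact Or.inr (Or.inr h1)
            · exact Or.inl ⟨huv, euA, fun h1 => hv ⟨h1, ev⟩⟩
        · exact Or.inr (Or.inl ⟨rfl, Or.inr (Or.inl rfl)⟩)
        · exact Or.inr (Or.inr ⟨rfl, Or.inr (Or.inl rfl)⟩)
    · exact fun v hv => hv.2.1 ha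
    · exact ⟨sb, sA, bA⟩
    · exact ⟨st, sA, tA⟩
    · exact ⟨bt, bA, tA⟩
    · exact hDB.mono_on fun u hu v hv huv => ⟨huv, fun h1 => dj u h1 hu.1, fun h1 => dj v h1 hv.1⟩
    · exact fun h1 => sB h1.1
    · exact fun h1 => h1.2 rfl
    · exact fun h1 => tB h1.1
    · rintro u v ⟨huv, hu, hv⟩
      rcases cov u v huv with h1 | h1 | h1 | h1
      · exact (hu h1).elim
      · by_cases e : u = b
        · exact Or.inr (Or.inr (Or.inl e))
        · exact Or.inl ⟨h1, e⟩
      · exact Or.inr (Or.inl h1)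
      · exact Or.inr (Or.inr (Or.inr h1))
  have conv : ∀ {x : V}, x ∈ ({s, t, a} : Set V) → x = s ∨ x = a ∨ x = t := by
    rintro x (rfl | rfl | rfl) <;> simp
  refine glue3 sep (plB.mono hresB) key ?_ ?_
  · intro w hw
    refine lemF (G := res G Bᶜ) (w := w) (s := s) (a := a) (t := t) (D := A \ {a}) plB ?_ ?_ ?_ ?_ ?_ ?_ ?_ ?_ ?_ ?_
    · refine ⟨?_, ?_⟩
      · rintro u v ⟨huv, hu, hv⟩
        exact ⟨huv.ne, Or.inl ⟨le_add _ _ _ huv, hu, hv⟩⟩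
      · rintro u v ⟨_, huv | ⟨hu, hv⟩ | ⟨hv, hu⟩⟩
        · exact Or.inl (hresB huv)
        · exact Or.inr (Or.inl ⟨hu, conv hv⟩)
        · exact Or.inr (Or.inr ⟨hv, conv hu⟩)
    · exact fun v hv => hv.2.1 hw
    · exact ⟨sa, sB, aB⟩
    · exact ⟨st, sB, tB⟩
    · exact ⟨at1, aB, tB⟩
    · exact hDA.mono_on fun u hu v hv huv => ⟨huv, dj u hu.1, dj v hv.1⟩
    · exact fun h1 => sA h1.1
    · exact fun h1 => h1.2 rfl
    · exact fun h1 => tA h1.1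
    · rintro u v ⟨huv, hu, hv⟩
      rcases cov u v huv with h1 | h1 | h1 | h1
      · by_cases e : u = a
        · exact Or.inr (Or.inr (Or.inl e))
        · exact Or.inl ⟨h1, e⟩
      · exact (hu h1).elim
      · exact Or.inr (Or.inl h1)
      · exact Or.inr (Or.inr (Or.inr h1))
  · intro w hw
    have ha2 : a ∈ (A \ {a})ᶜ := fun h1 => h1.2 rfl
    have hs2 : s ∈ (A \ {a})ᶜ := fun h1 => sA h1.1
    have ht2 : t ∈ (A \ {a})ᶜ := fun h1 => tA h1.1
    refine lemF (w := w) (s := s) (a := a) (t := t) (D := B) key ?_ ?_ ?_ ?_ ?_ ?_ ?_ ?_ ?_ ?_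
    · refine ⟨?_, ?_⟩
      · rintro u v huv
        exact ⟨huv.ne, Or.inl huv⟩
      · rintro u v ⟨_, huv | ⟨hu, hv⟩ | ⟨hv, hu⟩⟩
        · exact Or.inl huv
        · exact Or.inr (Or.inl ⟨hu, conv hv⟩)
        · exact Or.inr (Or.inr ⟨hv, conv hu⟩)
    · exact fun v hv => hv.2.1 hw
    · exact ⟨le_add _ _ _ sa, hs2, ha2⟩
    · exact ⟨le_add _ _ _ st, hs2, ht2⟩
    · exact ⟨le_add _ _ _ at1, ha2, ht2⟩
    · exact hB.mono_on fun u hu v hv huv =>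
        ⟨le_add _ _ _ huv, fun h1 => dj u h1.1 hu, fun h1 => dj v h1.1 hv⟩
    · exact sB
    · exact aB
    · exact tB
    · rintro u v ⟨huv, hu, hv⟩
      rcases sep.cov u v huv with h1 | h1 | h1
      · exact (hu h1).elim
      · exact Or.inl h1
      · exact Or.inr (conv h1)

theorem max_sep3 [Finite V] : ∀ (n : ℕ) (X : Set V) (G : SimpleGraph V), X.ncard = n → MaxPl G X → Sep3 G X := by
  intro n
  induction n using Nat.strong_induction_on with
  | _ n ih =>
  intro X G hn hM Y hYX hY u v hu hv hcl
  by_contra hcon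
  push Not at hcon
  obtain ⟨z, hzX, hzY, hzu, hzv⟩ := hcon
  have sp : Sp G X Y (X \ (Y ∪ {u, v})) ({u, v} ∩ X) := by
    refine ⟨?_, hYX, fun x hx => hx.1, fun x hx => hx.2, fun x hx h1 => h1.2 (Or.inl hx), ?_,
      fun x hx h1 => h1.2 (Or.inr hx.1), ?_⟩
    · intro x hx
      by_cases h1 : x ∈ Y
      · exact Or.inl h1
      · by_cases h2 : x ∈ ({u, v} : Set V)
        · exact Or.inr (Or.inr ⟨h2, hx⟩)
        · exact Or.inr (Or.inl ⟨hx, fun h3 => h3.elim h1 h2⟩)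
    · rintro x ⟨rfl | rfl, _⟩
      · exact hu
      · exact hv
    · intro a ha b hb hab
      exact hb.2 (hcl a ha b hb.1 hab)
  have hB : (X \ (Y ∪ {u, v})).Nonempty := ⟨z, hzX, by rintro (h1 | h1 | h1); exacts [hzY h1, hzu h1, hzv h1]⟩
  by_cases huX : u ∈ X
  · by_cases hvX : v ∈ X
    · have e : ({u, v} ∩ X : Set V) = {u, v} := by
        apply Set.inter_eq_left.2
        rintro x (rfl | rfl) <;> assumption
      rw [e] at sp
      generalize X \ (Y ∪ {u, v}) = B at sp hB
      have st := no_cut2 hM sp hY hB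
      have lt : ∀ {A B : Set V}, Sp G X A B {u, v} → B.Nonempty → (A ∪ {u, v} : Set V).ncard < n := by
        rintro A B h ⟨b, hb⟩
        rw [← hn]
        refine Set.ncard_lt_ncard ⟨?_, ?_⟩ (Set.toFinite _)
        · rintro x (hx | hx)
          · exact h.AX hx
          · exact h.SX hx
        · intro h1
          rcases h1 (h.BX hb) with h2 | h2
          · exact h.dj b h2 hb
          · exact h.sB b h2 hb
      obtain ⟨a, ha, sa, at1, hDA, _⟩ := apexA hM sp hY hB
        fun _ => ih _ (lt sp hB) _ _ rfl (side_max hM sp st)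
      obtain ⟨b, hb, sb, bt, hDB, hPB⟩ := apexA hM sp.symm hB hY
        fun _ => ih _ (lt sp.symm hY) _ _ rfl (side_max hM sp.symm st)
      exact two_cut hM sp st ha hb sa at1 sb bt hDA hDB hPB
    · refine no_cut1 hM sp (x0 := u) ?_ hY hB
      rintro x ⟨rfl | rfl, hx⟩
      · rfl
      · exact (hvX hx).elim
  · refine no_cut1 hM sp (x0 := v) ?_ hY hB
    rintro x ⟨rfl | rfl, hx⟩
    · exact (huX hx).elim
    · rfl

end Tri

namespace Tri
variable {V : Type} {W : Type}

/-- add a triangle -/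
def add3 (G : SimpleGraph V) (x y z : V) : SimpleGraph V := add (add (add G x y) x z) y z

theorem le_add3 (G : SimpleGraph V) (x y z : V) : G ≤ add3 G x y z :=
  (le_add _ _ _).trans ((le_add _ _ _).trans (le_add _ _ _))

theorem add3_adj {G : SimpleGraph V} {x y z u v : V} (h : (add3 G x y z).Adj u v) :
    G.Adj u v ∨ (u ≠ v ∧ u ∈ ({x, y, z} : Set V) ∧ v ∈ ({x, y, z} : Set V)) := by
  obtain ⟨huv, ⟨_, ⟨_, h1 | ⟨rfl, rfl⟩ | ⟨rfl, rfl⟩⟩ | ⟨rfl, rfl⟩ | ⟨rfl, rfl⟩⟩ | ⟨rfl, rfl⟩ | ⟨rfl, rfl⟩⟩ := h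
  · exact Or.inl h1
  all_goals exact Or.inr ⟨huv, by simp, by simp⟩

theorem add3_cl {G : SimpleGraph V} {x y z u v : V} (huv : u ≠ v) (hu : u ∈ ({x, y, z} : Set V))
    (hv : v ∈ ({x, y, z} : Set V)) : (add3 G x y z).Adj u v := by
  have e1 : u ≠ v → (add (add (add G x y) x z) y z).Adj u v := by
    intro huv
    have huv' := huv.symm
    rcases hu with rfl | rfl | rfl <;> rcases hv with rfl | rfl | rfl <;> simp_all [add_adj]
  exact e1 huv

theorem side3 {G : SimpleGraph V} {A B : Set V} {x y z w : V} (hG : Pl G)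
    (h : Sp G Set.univ A B {x, y, z}) (hw : w ∈ B)
    (att : ∀ p ∈ ({x, y, z} : Set V), ∃ q ∈ comp G B w, G.Adj q p) :
    Pl (app (add3 G x y z) Bᶜ w {x, y, z}) := by
  classical
  have P0 : Pl (app G Bᶜ w {x, y, z}) := by
    refine hG.pull (X := insert w Bᶜ) ?_ (fun v => if v = w then comp G B w else {v}) ?_ ?_ ?_
    · rintro u v ⟨_, ⟨_, hu, _⟩ | ⟨hu, _⟩ | ⟨_, hu⟩⟩
      · exact Or.inr hu
      · exact Or.inl hu
      · exact Or.inr (h.sB u hu)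
    · intro v _
      by_cases e : v = w
      · simp only [e, if_true]; exact cn_comp hw
      · simp only [e, if_false]; exact cn_singleton G v
    · have sub : comp G B w ⊆ B := comp_subset hw
      intro u hu v hv p hp hq
      by_cases eu : u = w <;> by_cases ev : v = w
      · rw [eu, ev]
      · simp only [eu, ev, if_true, if_false] at hp hq
        rcases hv with hv | hv
        · exact (ev hv).elim
        · rw [Set.mem_singleton_iff] at hq
          subst hq
          exact (hv (sub hp)).elim
      · simp only [eu, ev, if_true, if_false] at hp hq
        rcases hu with hu | hu
        · exact (eu hu).elim
        · rw [Set.mem_singleton_iff] at hp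
          subst hp
          exact (hu (sub hq)).elim
      · simp only [eu, ev, if_false, Set.mem_singleton_iff] at hp hq
        rw [← hp, ← hq]
    · have nw : ∀ {u}, u ∈ Bᶜ → u ≠ w := by rintro u hu rfl; exact hu hw
      rintro u v ⟨_, ⟨huv, hu, hv⟩ | ⟨hu, hv⟩ | ⟨hv, hu⟩⟩
      · simp only [nw hu, nw hv, if_false]
        exact ⟨u, rfl, v, rfl, huv⟩
      · simp only [hu, nw (h.sB v hv), if_true, if_false]
        obtain ⟨q, hq, hqv⟩ := att v hv
        exact ⟨q, hq, v, rfl, hqv⟩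
      · simp only [hv, nw (h.sB u hu), if_true, if_false]
        obtain ⟨q, hq, hqv⟩ := att u hu
        exact ⟨u, rfl, q, hq, hqv.symm⟩
  have hx : x ∈ ({x, y, z} : Set V) := by simp
  have hy : y ∈ ({x, y, z} : Set V) := by simp
  have hz : z ∈ ({x, y, z} : Set V) := by simp
  have ns : ∀ p ∈ ({x, y, z} : Set V), w ≠ p := by rintro p hp rfl; exact h.sB _ hp hw
  have wS : ∀ p ∈ ({x, y, z} : Set V), (app G Bᶜ w {x, y, z}).Adj w p :=
    fun p hp => ⟨ns p hp, Or.inr (Or.inl ⟨rfl, hp⟩)⟩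
  have n0 : ∀ v, (app G Bᶜ w {x, y, z}).Adj w v → v = x ∨ v = y ∨ v = z := by
    rintro v ⟨_, ⟨_, h1, _⟩ | ⟨_, h1⟩ | ⟨_, h1⟩⟩
    · exact (h1 hw).elim
    · exact h1
    · exact (ns w h1 rfl).elim
  have step : ∀ {H : SimpleGraph V} {p q : V}, (∀ v, H.Adj w v → v = x ∨ v = y ∨ v = z) → w ≠ p → w ≠ q →
      ∀ v, (add H p q).Adj w v → v = x ∨ v = y ∨ v = z := by
    rintro H p q hH hp hq v ⟨_, h1 | ⟨h1, _⟩ | ⟨h1, _⟩⟩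
    · exact hH v h1
    · exact (hp h1).elim
    · exact (hq h1).elim
  have n1 := step (p := x) (q := y) n0 (ns x hx) (ns y hy)
  have n2 := step (p := x) (q := z) n1 (ns x hx) (ns z hz)
  have P1 := ylemma (u := z) P0 (plus_add _ x y) n0 (wS x hx) (wS y hy)
  have P2 := ylemma (u := y) P1 (plus_add _ x z) (fun v hv => by have := n1 v hv; tauto)
    (le_add _ _ _ (wS x hx)) (le_add _ _ _ (wS z hz))
  have P3 := ylemma (u := x) P2 (plus_add _ y z) (fun v hv => by have := n2 v hv; tauto)
    (le_add _ _ _ (le_add _ _ _ (wS y hy))) (le_add _ _ _ (le_add _ _ _ (wS z hz)))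
  refine P3.mono ?_
  rintro u v ⟨huv, ⟨h1, hu, hv⟩ | h1 | h1⟩
  · rcases add3_adj h1 with h2 | ⟨_, h2, h3⟩
    · exact le_add3 _ x y z ⟨huv, Or.inl ⟨h2, hu, hv⟩⟩
    · exact add3_cl huv h2 h3
  · exact le_add3 _ x y z ⟨huv, Or.inr (Or.inl h1)⟩
  · exact le_add3 _ x y z ⟨huv, Or.inr (Or.inr h1)⟩

theorem att3 {G : SimpleGraph V} {A B : Set V} {x y z w a : V} (hS : Sep3 G Set.univ)
    (h : Sp G Set.univ A B {x, y, z}) (ha : a ∈ A) (hw : w ∈ B) : ∃ q ∈ comp G B w, G.Adj q x := by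
  by_contra hcon
  push Not at hcon
  have sub : comp G B w ⊆ B := comp_subset hw
  have := hS (comp G B w) (fun _ _ => trivial) ⟨w, mem_comp_self G B w⟩ y z
    (fun h1 => h.sB y (by simp) (sub h1)) (fun h1 => h.sB z (by simp) (sub h1)) (by
      intro p hp q _ hpq
      rcases h.symm.nb (fun _ _ _ => trivial) (sub hp) hpq with h1 | h1 | h1 | h1
      · exact Or.inl (comp_closed hw hp h1 hpq)
      · subst h1; exact (hcon p hp hpq).elim
      · exact Or.inr (Or.inl h1)
      · exact Or.inr (Or.inr h1)) a trivial
  rcases this with h1 | rfl | rfl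
  · exact h.dj a ha (sub h1)
  · exact h.sA a (by simp) ha
  · exact h.sA a (by simp) ha

theorem att3' {G : SimpleGraph V} {A B : Set V} {x y z w a : V} (hS : Sep3 G Set.univ)
    (h : Sp G Set.univ A B {x, y, z}) (ha : a ∈ A) (hw : w ∈ B) :
    ∀ p ∈ ({x, y, z} : Set V), ∃ q ∈ comp G B w, G.Adj q p := by
  rintro p (rfl | rfl | rfl)
  · exact att3 hS h ha hw
  · exact att3 (y := x) (z := z) hS (by rwa [Set.insert_comm]) ha hw
  · refine att3 (y := x) (z := y) hS ?_ ha hw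
    have e : ({p, x, y} : Set V) = {x, y, p} := by ext q; simp; tauto
    rwa [e]

theorem tri_planar {G : SimpleGraph V} {A B : Set V} {x y z : V} (hG : Pl G) (hS : Sep3 G Set.univ)
    (h : Sp G Set.univ A B {x, y, z}) (hA : A.Nonempty) (hB : B.Nonempty) : Pl (add3 G x y z) := by
  obtain ⟨a, ha⟩ := hA
  obtain ⟨b, hb⟩ := hB
  have sA : ∀ w ∈ B, Pl (app (add3 G x y z) Bᶜ w {x, y, z}) :=
    fun w hw => side3 hG h hw (att3' hS h ha hw)
  have sB : ∀ w ∈ A, Pl (app (add3 G x y z) Aᶜ w {x, y, z}) :=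
    fun w hw => side3 hG h.symm hw (att3' hS h.symm hb hw)
  refine glue3 (A := A) (B := B) ?_ ((sA b hb).mono ?_) ((sB a ha).mono ?_) sA sB
  · refine ⟨fun u v _ => h.cov u trivial, h.dj, h.sA, h.sB, ?_, ?_⟩
    · intro p hp q hq hpq
      rcases add3_adj hpq with h1 | ⟨_, h1, _⟩
      · exact h.no p hp q hq h1
      · exact h.sA p h1 hp
    · exact fun p hp q hq hpq => add3_cl hpq hp hq
  · exact fun u v huv => ⟨huv.ne, Or.inl huv⟩
  · exact fun u v huv => ⟨huv.ne, Or.inl huv⟩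

theorem mod_iff {K : SimpleGraph W} {G : SimpleGraph V} : K.IsMinor G ↔ ∃ f, Mod K G f := by
  constructor
  · rintro ⟨f, h1, h2, h3, h4⟩
    refine ⟨f, fun i => (cn_iff G _).2 (h2 i), ?_, fun i j hij => h4 hij⟩
    intro i j x hi hj
    by_contra hne
    exact Set.disjoint_left.1 (h3 hne) hi hj
  · rintro ⟨f, hf⟩
    refine ⟨f, fun i => (hf.cn i).1, fun i => (cn_iff G _).1 (hf.cn i), ?_, fun i j hij => hf.tch i j hij⟩
    intro i j hij
    exact Set.disjoint_left.2 fun x hi hj => hij (hf.dj i j x hi hj)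

theorem planar_iff {G : SimpleGraph V} : G.Planar ↔ Pl G := by
  unfold SimpleGraph.Planar Pl
  rw [mod_iff, mod_iff, not_exists, not_exists]

theorem main_bwd [Finite V] (T : SimpleGraph V) (hT : IsPlanarTriangulation T) (hV : 5 ≤ Nat.card V)
    (hno : ∀ a b c : V, ¬ IsSeparatingTriangle T a b c) (S : Set V) (hc : Nat.card S ≤ 3) :
    (T.induce Sᶜ).Connected := by
  obtain ⟨_, hP, hmax⟩ := hT
  have hPl := planar_iff.1 hP
  have hM : MaxPl T Set.univ := by
    refine ⟨fun _ _ _ => trivial, hPl, fun u _ v _ huv h => ?_⟩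
    rw [← hmax _ (le_add T u v) (planar_iff.2 h)]
    exact ⟨huv, Or.inr (Or.inl ⟨rfl, rfl⟩)⟩
  have hS := max_sep3 _ _ _ rfl hM
  rw [← cn_iff]
  have hcS : S.ncard ≤ 3 := hc
  have hne : (Sᶜ).Nonempty := by
    by_contra hcon
    rw [Set.not_nonempty_iff_eq_empty, Set.compl_empty_iff] at hcon
    rw [hcon, Set.ncard_univ] at hcS
    omega
  obtain ⟨a, ha⟩ := hne
  by_contra hcn
  have hB : (Sᶜ \ comp T Sᶜ a).Nonempty := by
    by_contra hcon
    rw [Set.not_nonempty_iff_eq_empty, Set.diff_eq_empty] at hcon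
    exact hcn ((comp_subset ha).antisymm hcon ▸ cn_comp ha)
  have sp : Sp T Set.univ (comp T Sᶜ a) (Sᶜ \ comp T Sᶜ a) S := by
    refine ⟨?_, fun _ _ => trivial, fun _ _ => trivial, fun _ _ => trivial, fun x hx h1 => h1.2 hx,
      fun x hx h1 => comp_subset ha h1 hx, fun x hx h1 => h1.1 hx, ?_⟩
    · intro u _
      by_cases h1 : u ∈ S
      · exact Or.inr (Or.inr h1)
      · by_cases h2 : u ∈ comp T Sᶜ a
        · exact Or.inl h2
        · exact Or.inr (Or.inl ⟨h1, h2⟩)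
    · exact fun p hp q hq hpq => hq.2 (comp_closed ha hp hq.1 hpq)
  have hA : (comp T Sᶜ a).Nonempty := ⟨a, mem_comp_self _ _ _⟩
  generalize comp T Sᶜ a = A at sp hB hA
  generalize Sᶜ \ A = B at sp hB
  obtain ⟨b, hb⟩ := hB
  have two : ∀ u v, u ∉ A → v ∉ A → (∀ p ∈ S, p = u ∨ p = v) → b = u ∨ b = v := by
    intro u v hu hv hp
    rcases hS A (fun _ _ => trivial) hA u v hu hv (fun p hpA q _ hpq =>
      (sp.nb (fun _ _ _ => trivial) hpA hpq).imp_right (hp q)) b trivial with h1 | h1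
    · exact (sp.dj b h1 hb).elim
    · exact h1
  obtain h3 | h3 : S.ncard = 3 ∨ S.ncard ≤ 2 := by omega
  · obtain ⟨x, y, z, xy, xz, yz, rfl⟩ := Set.ncard_eq_three.1 h3
    have h := tri_planar hPl hS sp hA ⟨b, hb⟩
    have e := hmax _ (le_add3 T x y z) (planar_iff.2 h)
    refine hno x y z ⟨⟨?_, ?_, ?_⟩, ?_⟩
    · rw [← e]; exact add3_cl xy (by simp) (by simp)
    · rw [← e]; exact add3_cl xz (by simp) (by simp)
    · rw [← e]; exact add3_cl yz (by simp) (by simp)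
    · rw [← pcn_iff]
      intro hp
      have e2 : {v | v ≠ x ∧ v ≠ y ∧ v ≠ z} = ({x, y, z} : Set V)ᶜ := by ext v; simp
      rw [e2] at hp
      exact hcn ⟨⟨a, ha⟩, hp⟩
  · have key : ∃ u v, u ∉ A ∧ v ∉ A ∧ u ≠ b ∧ v ≠ b ∧ ∀ p ∈ S, p = u ∨ p = v := by
      obtain h2 | h2 | h2 : S.ncard = 2 ∨ S.ncard = 1 ∨ S.ncard = 0 := by omega
      · obtain ⟨x, y, xy, rfl⟩ := Set.ncard_eq_two.1 h2
        refine ⟨x, y, sp.sA x (by simp), sp.sA y (by simp), ?_, ?_, by simp⟩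
        · rintro rfl; exact sp.sB x (by simp) hb
        · rintro rfl; exact sp.sB y (by simp) hb
      · obtain ⟨x, rfl⟩ := Set.ncard_eq_one.1 h2
        exact ⟨x, x, sp.sA x (by simp), sp.sA x (by simp), fun e => sp.sB x (by simp) (e ▸ hb),
          fun e => sp.sB x (by simp) (e ▸ hb), by simp⟩
      · exfalso
        rw [Set.ncard_eq_zero] at h2
        exact no_cut1 hM sp (x0 := a) (by simp [h2]) hA ⟨b, hb⟩
    obtain ⟨u, v, hu, hv, h1, h2, h4⟩ := key
    rcases two u v hu hv h4 with h5 | h5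
    · exact h1 h5.symm
    · exact h2 h5.symm

end Tri

/-- a planar triangulation on at least 5 vertices is 4-connected iff it has
no separating triangle. -/
theorem stmt_13 (V : Type) [Finite V] (T : SimpleGraph V)
    (hT : IsPlanarTriangulation T) (hV : 5 ≤ Nat.card V) :
    FourConnected T ↔ ∀ a b c : V, ¬ IsSeparatingTriangle T a b c := by
  constructor
  · rintro ⟨_, h⟩ a b c ⟨_, hn⟩
    have e : {v | v ≠ a ∧ v ≠ b ∧ v ≠ c} = ({a, b, c} : Set V)ᶜ := by ext v; simp
    rw [e] at hn
    refine hn (h {a, b, c} ?_).preconnected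
    change ({a, b, c} : Set V).ncard ≤ 3
    have e1 := Set.ncard_insert_le a ({b, c} : Set V)
    have e2 := Set.ncard_insert_le b ({c} : Set V)
    have e3 := Set.ncard_singleton c
    omega
  · intro h
    exact ⟨hV, fun S hS => Tri.main_bwd T hT hV h S hS⟩
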